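/- Almost surely, the locally signed random measures M'_t(dx) = (√(2d)·t − X_t(x)) e^{√(2d)·X_t(x) − d·t} dx converge weakly (i.e., tested against compactly supported continuous functions) as t → ∞ to a positive Radon measure M'(dx) on ℝ^d, and almost surely M' has full support, i.e., M'(A) > 0 for every nonempty open set A ⊂ ℝ^d. -/

import Mathlib

open MeasureTheory ProbabilityTheory Filter

noncomputable section

set_option linter.unusedSectionVars false
set_option linter.unusedVariables false
set_option linter.style.longLine false

namespace DM

abbrev EE (d : ℕ) := EuclideanSpace ℝ (Fin d)

variable {d : ℕ} {Ω : Type*} [m0 : MeasurableSpace Ω]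

/-- sigma-algebra of the past. -/
def Fil (X : ℝ → EE d → Ω → ℝ) (s : ℝ) : MeasurableSpace Ω :=
  ⨆ u ∈ Set.Icc (0:ℝ) s, ⨆ x : EE d, MeasurableSpace.comap (X u x) inferInstance

/-- sigma-algebra of an increment. -/
def Inc (X : ℝ → EE d → Ω → ℝ) (s t : ℝ) : MeasurableSpace Ω :=
  ⨆ x : EE d, MeasurableSpace.comap (fun ω => X t x ω - X s x ω) inferInstance

structure Setup (P : Measure Ω) (X : ℝ → EE d → Ω → ℝ) (L R : ℝ) : Prop where
  prob : IsProbabilityMeasure P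
  cont : ∀ ω, Continuous fun p : ℝ × EE d => X p.1 p.2 ω
  meas : ∀ t x, Measurable (X t x)
  Lpos : 0 ≤ L
  Rpos : 0 < R
  zero : ∀ x, ∀ᵐ ω ∂P, X 0 x ω = 0
  indep : ∀ s t, 0 ≤ s → s < t → Indep (Inc X s t) (Fil X s) P
  law : ∀ s t, 0 ≤ s → s < t → ∀ x,
    Measure.map (fun ω => X t x ω - X s x ω) P = gaussianReal 0 (t - s).toNNReal
  edge : ∀ s t, 0 ≤ s → s < t → ∀ x y, ∃ v : NNReal, (v : ℝ) ≤ L * Real.exp t * ‖x - y‖ ∧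
    Measure.map (fun ω => (X t x ω - X s x ω) - (X t y ω - X s y ω)) P = gaussianReal 0 v
  far : ∀ s t, 0 ≤ s → s < t → ∀ x y, R * Real.exp (-s) ≤ ‖x - y‖ →
    IndepFun (fun ω => X t x ω - X s x ω) (fun ω => X t y ω - X s y ω) P

lemma Fil_le {X : ℝ → EE d → Ω → ℝ} (h : ∀ t x, Measurable (X t x)) (s : ℝ) :
    Fil X s ≤ m0 := by
  unfold Fil
  exact iSup₂_le fun u _ => iSup_le fun x => (h u x).comap_le

lemma Inc_le {X : ℝ → EE d → Ω → ℝ} (h : ∀ t x, Measurable (X t x)) (s t : ℝ) :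
    Inc X s t ≤ m0 := by
  unfold Inc
  exact iSup_le fun x => ((h t x).sub (h s x)).comap_le

lemma meas_Fil (X : ℝ → EE d → Ω → ℝ) {u s : ℝ} (hu : 0 ≤ u) (hus : u ≤ s) (x : EE d) :
    Measurable[Fil X s] (X u x) := by
  have : MeasurableSpace.comap (X u x) inferInstance ≤ Fil X s := by
    unfold Fil
    exact le_iSup₂_of_le u ⟨hu, hus⟩ (le_iSup (fun x => MeasurableSpace.comap (X u x) inferInstance) x)
  exact measurable_iff_comap_le.2 this

lemma meas_Inc (X : ℝ → EE d → Ω → ℝ) (s t : ℝ) (x : EE d) :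
    Measurable[Inc X s t] (fun ω => X t x ω - X s x ω) := by
  refine measurable_iff_comap_le.2 ?_
  exact le_iSup (fun x => MeasurableSpace.comap (fun ω => X t x ω - X s x ω) inferInstance) x

lemma Fil_mono (X : ℝ → EE d → Ω → ℝ) {s t : ℝ} (hst : s ≤ t) : Fil X s ≤ Fil X t := by
  unfold Fil
  exact iSup₂_le fun u hu => le_iSup₂_of_le (f := fun u _ => ⨆ x : EE d, MeasurableSpace.comap (X u x) inferInstance) u ⟨hu.1, hu.2.trans hst⟩ le_rfl

/-- combine measurability to get independent functions -/
lemma indepFun_of {P : Measure Ω} {m1 m2 : MeasurableSpace Ω} (h : Indep m1 m2 P) {α β : Type*}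
    [MeasurableSpace α] [MeasurableSpace β] {U : Ω → α} {V : Ω → β}
    (hU : Measurable[m1] U) (hV : Measurable[m2] V) : IndepFun U V P := by
  rw [IndepFun_iff_Indep]
  exact indep_of_indep_of_le_left (indep_of_indep_of_le_right h (measurable_iff_comap_le.1 hV))
    (measurable_iff_comap_le.1 hU)

section build

variable (P : Measure Ω) [IsProbabilityMeasure P]
    (k : EE d → ℝ)
    (hk1 : ContDiff ℝ 1 k) (hk0 : k 0 = 1)
    (hksupp : HasCompactSupport k)
    (X : ℝ → EE d → Ω → ℝ)
    (hXmeas : ∀ t x, Measurable (X t x))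
    (hXgauss : ∀ (n : ℕ) (c : Fin n → ℝ) (t : Fin n → ℝ) (x : Fin n → EE d),
      ∃ v : NNReal,
        Measure.map (fun ω => ∑ i, c i * X (t i) (x i) ω) P = gaussianReal 0 v)
    (hXcent : ∀ t x, ∫ ω, X t x ω ∂P = 0)
    (hXcov : ∀ t, 0 ≤ t → ∀ x y : EE d,
      ∫ ω, X t x ω * X t y ω ∂P = ∫ u in Set.Icc (1:ℝ) (Real.exp t), k (u • (x - y)) / u)
    (hXcont : ∀ ω, Continuous fun p : ℝ × EE d => X p.1 p.2 ω)
    (hXindep : ∀ s t : ℝ, 0 ≤ s → s < t → Indep (Inc X s t) (Fil X s) P)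

include hXmeas hXgauss in
lemma memLp2 (t : ℝ) (x : EE d) : MemLp (X t x) 2 P := by
  obtain ⟨v, hv⟩ := hXgauss 1 (fun _ => 1) (fun _ => t) (fun _ => x)
  simp only [Finset.univ_unique, Fin.default_eq_zero, Fin.isValue, one_mul, Finset.sum_const, Finset.card_singleton, one_smul] at hv
  have h := memLp_id_gaussianReal' (μ := 0) (v := v) 2 (by simp)
  rw [← hv] at h
  exact (memLp_map_measure_iff (by fun_prop) (hXmeas t x).aemeasurable).1 h

include hXmeas hXgauss hXcent hXindep in
lemma cov_cross (s t : ℝ) (hs : 0 ≤ s) (hst : s < t) (x y : EE d) :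
    ∫ ω, X t x ω * X s y ω ∂P = ∫ ω, X s x ω * X s y ω ∂P := by
  have h1 : IndepFun (fun ω => X t x ω - X s x ω) (X s y) P :=
    indepFun_of (hXindep s t hs hst) (meas_Inc X s t x) (meas_Fil X hs le_rfl y)
  have h2 := h1.integral_mul_eq_mul_integral ((hXmeas t x).sub (hXmeas s x)).aestronglyMeasurable
    (hXmeas s y).aestronglyMeasurable
  rw [hXcent s y, mul_zero] at h2
  have i1 : Integrable (fun ω => X t x ω * X s y ω) P :=
    (memLp2 P X hXmeas hXgauss t x).integrable_mul (memLp2 P X hXmeas hXgauss s y)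
  have i2 : Integrable (fun ω => X s x ω * X s y ω) P :=
    (memLp2 P X hXmeas hXgauss s x).integrable_mul (memLp2 P X hXmeas hXgauss s y)
  have h3 : ∫ ω, (X t x ω * X s y ω - X s x ω * X s y ω) ∂P = 0 := by
    rw [← h2]; congr 1; ext ω; simp; ring
  rw [integral_sub i1 i2] at h3
  linarith

include hk1 hksupp hXmeas hXgauss hXcent hXindep hXcov in
lemma cov_inc (s t : ℝ) (hs : 0 ≤ s) (hst : s < t) (x y : EE d) :
    ∫ ω, (X t x ω - X s x ω) * (X t y ω - X s y ω) ∂P =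
      ∫ u in (Real.exp s)..(Real.exp t), k (u • (x - y)) / u := by
  have I : ∀ t1 x1 t2 x2, Integrable (fun ω => X t1 x1 ω * X t2 x2 ω) P := fun t1 x1 t2 x2 =>
    (memLp2 P X hXmeas hXgauss t1 x1).integrable_mul (memLp2 P X hXmeas hXgauss t2 x2)
  have e : ∀ ω, (X t x ω - X s x ω) * (X t y ω - X s y ω) =
    X t x ω * X t y ω - X t x ω * X s y ω - X t y ω * X s x ω + X s x ω * X s y ω := by
    intro ω; ring
  simp_rw [e]
  have i1 : Integrable (fun ω => X t x ω * X t y ω - X t x ω * X s y ω) P := (I t x t y).sub (I t x s y)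
  have i2 : Integrable (fun ω => X t x ω * X t y ω - X t x ω * X s y ω - X t y ω * X s x ω) P :=
    i1.sub (I t y s x)
  rw [integral_add i2 (I _ _ _ _),
    integral_sub i1 (I _ _ _ _), integral_sub (I _ _ _ _) (I _ _ _ _),
    cov_cross P X hXmeas hXgauss hXcent hXindep s t hs hst,
    cov_cross P X hXmeas hXgauss hXcent hXindep s t hs hst]
  have hc : ∫ ω, X s y ω * X s x ω ∂P = ∫ ω, X s x ω * X s y ω ∂P := by
    congr 1; ext ω; ring
  rw [hc, hXcov t (hs.trans hst.le), hXcov s hs]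
  rw [integral_Icc_eq_integral_Ioc, integral_Icc_eq_integral_Ioc,
    ← intervalIntegral.integral_of_le (Real.one_le_exp hs),
    ← intervalIntegral.integral_of_le (Real.one_le_exp (hs.trans hst.le))]
  have ii : ∀ a b : ℝ, 1 ≤ a → 1 ≤ b → IntervalIntegrable (fun u : ℝ => k (u • (x - y)) / u) volume a b := by
    intro a b ha hb
    apply ContinuousOn.intervalIntegrable
    apply ContinuousOn.div
    · exact (hk1.continuous.comp (by fun_prop)).continuousOn
    · fun_prop
    · intro u hu
      have : min a b ≤ u := hu.1
      have : 1 ≤ min a b := le_min ha hb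
      have : 0 < u := by linarith
      exact this.ne'
  rw [← intervalIntegral.integral_add_adjacent_intervals (ii 1 (Real.exp s) le_rfl (Real.one_le_exp hs))
    (ii (Real.exp s) (Real.exp t) (Real.one_le_exp hs) (Real.one_le_exp (hs.trans hst.le)))]
  ring

/-- real gaussian with second moment. -/
lemma var_of_map {v : NNReal} {Z : Ω → ℝ} (hZ : Measurable Z)
    (h : Measure.map Z P = gaussianReal 0 v) : (v : ℝ) = ∫ ω, Z ω * Z ω ∂P := by
  have h1 : ∫ z, z * z ∂(Measure.map Z P) = ∫ ω, Z ω * Z ω ∂P := by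
    rw [integral_map hZ.aemeasurable (by fun_prop)]
  rw [← h1, h]
  have h2 := variance_fun_id_gaussianReal (μ := 0) (v := v)
  rw [variance_eq_sub (by simpa using! memLp_id_gaussianReal' 2 (by simp))] at h2
  simp only [Pi.pow_apply, integral_id_gaussianReal] at h2
  rw [← h2]
  simp [pow_two]

include hk1 hk0 hksupp hXmeas hXgauss hXcent hXindep hXcov hXcont in
theorem setup_of : ∃ L R, Setup P X L R := by
  obtain ⟨C, hC⟩ := hk1.lipschitzWith_of_hasCompactSupport hksupp (by simp)
  obtain ⟨R, hR⟩ := hksupp.isCompact.isBounded.subset_closedBall 0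
  have hR' : ∀ z, |R| + 1 ≤ ‖z‖ → k z = 0 := by
    intro z hz
    by_contra h
    have := hR (subset_tsupport _ h)
    simp at this
    have := le_abs_self R
    linarith
  have inv_int : ∀ s t, 0 ≤ s → s < t → ∫ u in (Real.exp s)..(Real.exp t), u⁻¹ = t - s := by
    intro s t hs hst
    rw [integral_inv_of_pos (Real.exp_pos _) (Real.exp_pos _), ← Real.exp_sub, Real.log_exp]
  have hm : ∀ s t x, Measurable (fun ω => X t x ω - X s x ω) :=
    fun s t x => (hXmeas t x).sub (hXmeas s x)
  have I : ∀ t1 x1 t2 x2, Integrable (fun ω => X t1 x1 ω * X t2 x2 ω) P := fun t1 x1 t2 x2 =>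
    (memLp2 P X hXmeas hXgauss t1 x1).integrable_mul (memLp2 P X hXmeas hXgauss t2 x2)
  have J : ∀ s t x y, Integrable (fun ω => (X t x ω - X s x ω) * (X t y ω - X s y ω)) P := fun s t x y =>
    MemLp.integrable_mul ((memLp2 P X hXmeas hXgauss t x).sub (memLp2 P X hXmeas hXgauss s x))
      ((memLp2 P X hXmeas hXgauss t y).sub (memLp2 P X hXmeas hXgauss s y))
  have ci := cov_inc P k hk1 hksupp X hXmeas hXgauss hXcent hXcov hXindep
  have ci0 : ∀ s t, 0 ≤ s → s < t → ∀ x, ∫ ω, (X t x ω - X s x ω) * (X t x ω - X s x ω) ∂P = t - s := by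
    intro s t hs hst x
    rw [ci s t hs hst x x, ← inv_int s t hs hst]
    simp [hk0]
  have g4 : ∀ (s t : ℝ) (x y : EE d) (a b : ℝ), ∃ v : NNReal,
      Measure.map (fun ω => a * (X t x ω - X s x ω) + b * (X t y ω - X s y ω)) P = gaussianReal 0 v := by
    intro s t x y a b
    obtain ⟨v, hv⟩ := hXgauss 4 ![a, -a, b, -b] ![t, s, t, s] ![x, x, y, y]
    refine ⟨v, ?_⟩
    rw [← hv]
    congr 1
    ext ω
    simp [Fin.sum_univ_four]
    ring
  refine ⟨2 * C, |R| + 1, ‹_›, hXcont, hXmeas, by positivity, by positivity, ?_, hXindep, ?_, ?_, ?_⟩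
  · intro x
    have h := hXcov 0 le_rfl x x
    simp at h
    have h2 := (integral_eq_zero_iff_of_nonneg (fun ω => mul_self_nonneg (X 0 x ω)) (I 0 x 0 x)).1 h
    filter_upwards [h2] with ω hω
    simpa using hω
  · intro s t hs hst x
    obtain ⟨v, hv⟩ := g4 s t x x 1 0
    simp at hv
    have h := var_of_map P (hm s t x) hv
    rw [ci0 s t hs hst x] at h
    rw [hv, ← h, Real.toNNReal_coe]
  · intro s t hs hst x y
    obtain ⟨v, hv⟩ := g4 s t x y 1 (-1)
    have e : (fun ω => 1 * (X t x ω - X s x ω) + -1 * (X t y ω - X s y ω)) =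
      (fun ω => (X t x ω - X s x ω) - (X t y ω - X s y ω)) := by ext; ring
    rw [e] at hv
    refine ⟨v, ?_, hv⟩
    have h := var_of_map P ((hm s t x).sub (hm s t y)) hv
    rw [h]
    have e2 : ∀ ω, ((fun ω => X t x ω - X s x ω) - fun ω => X t y ω - X s y ω) ω * ((fun ω => X t x ω - X s x ω) - fun ω => X t y ω - X s y ω) ω
       = (X t x ω - X s x ω) * (X t x ω - X s x ω) + (X t y ω - X s y ω) * (X t y ω - X s y ω)
         - 2 * ((X t x ω - X s x ω) * (X t y ω - X s y ω)) := by
      intro ω; simp; ring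
    simp_rw [e2]
    have i1 : Integrable (fun ω => (X t x ω - X s x ω) * (X t x ω - X s x ω) + (X t y ω - X s y ω) * (X t y ω - X s y ω)) P :=
      (J s t x x).add (J s t y y)
    rw [integral_sub i1 ((J _ _ _ _).const_mul 2), integral_add (J _ _ _ _) (J _ _ _ _),
      integral_const_mul, ci0 s t hs hst, ci0 s t hs hst, ci s t hs hst]
    have ii : IntervalIntegrable (fun u : ℝ => k (u • (x - y)) / u) volume (Real.exp s) (Real.exp t) := by
      apply ContinuousOn.intervalIntegrable
      apply ContinuousOn.div
      · exact (hk1.continuous.comp (by fun_prop)).continuousOn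
      · fun_prop
      · intro u hu
        have : min (Real.exp s) (Real.exp t) ≤ u := hu.1
        have : 0 < min (Real.exp s) (Real.exp t) := by positivity
        have : 0 < u := by linarith
        exact this.ne'
    have i2 : IntervalIntegrable (fun u : ℝ => u⁻¹) volume (Real.exp s) (Real.exp t) := by
      apply intervalIntegral.intervalIntegrable_inv _ continuousOn_id
      intro u hu
      have : min (Real.exp s) (Real.exp t) ≤ u := hu.1
      have : 0 < min (Real.exp s) (Real.exp t) := by positivity
      have : 0 < u := by linarith
      exact this.ne'
    have hexp : Real.exp s ≤ Real.exp t := Real.exp_le_exp.2 hst.le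
    have hle : (t - s) - C * ‖x - y‖ * (Real.exp t - Real.exp s) ≤ ∫ u in (Real.exp s)..(Real.exp t), k (u • (x - y)) / u := by
      rw [← inv_int s t hs hst]
      have h3 : ∫ u in (Real.exp s)..(Real.exp t), (u⁻¹ - C * ‖x - y‖) ≤ ∫ u in (Real.exp s)..(Real.exp t), k (u • (x - y)) / u := by
        apply intervalIntegral.integral_mono_on hexp (i2.sub (by simp)) ii
        intro u hu
        have hu0 : 0 < u := (Real.exp_pos s).trans_le hu.1
        have := hC.dist_le_mul 0 (u • (x - y))
        rw [hk0, Real.dist_eq, dist_zero_left, norm_smul, Real.norm_eq_abs, abs_of_pos hu0] at this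
        have h4 := (abs_le.1 this).2
        rw [le_div_iff₀ hu0, sub_mul, inv_mul_cancel₀ hu0.ne']
        nlinarith
      rw [intervalIntegral.integral_sub i2 (by simp), intervalIntegral.integral_const] at h3
      simp at h3 ⊢
      linarith
    have : 0 ≤ C * ‖x - y‖ * Real.exp s := by positivity
    nlinarith
  · intro s t hs hst x y hxy
    have hG : HasGaussianLaw (fun ω => (X t x ω - X s x ω, X t y ω - X s y ω)) P := by
      constructor
      apply isGaussian_of_map_eq_gaussianReal
      intro l
      obtain ⟨v, hv⟩ := g4 s t x y (l (1, 0)) (l (0, 1))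
      refine ⟨0, v, ?_⟩
      rw [← hv, Measure.map_map (by fun_prop) ((hm s t x).prodMk (hm s t y))]
      congr 1
      ext ω
      have : ((X t x ω - X s x ω, X t y ω - X s y ω) : ℝ × ℝ) =
         (X t x ω - X s x ω) • ((1, 0) : ℝ × ℝ) + (X t y ω - X s y ω) • ((0, 1) : ℝ × ℝ) := by
        simp
      simp only [Function.comp]
      rw [this, map_add, map_smul, map_smul]
      simp [mul_comm]
    apply hG.indepFun_of_covariance_eq_zero
    have m1 : ∀ x, MemLp (fun ω => X t x ω - X s x ω) 2 P := fun x =>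
      (memLp2 P X hXmeas hXgauss t x).sub (memLp2 P X hXmeas hXgauss s x)
    rw [covariance_eq_sub (m1 x) (m1 y)]
    have z1 : ∫ ω, X t x ω - X s x ω ∂P = 0 := by
      rw [integral_sub ((memLp2 P X hXmeas hXgauss t x).integrable (by simp)) ((memLp2 P X hXmeas hXgauss s x).integrable (by simp)), hXcent, hXcent]; simp
    rw [z1, zero_mul, sub_zero]
    have := ci s t hs hst x y
    simp only [Pi.mul_apply]
    rw [this]
    have : ∫ u in (Real.exp s)..(Real.exp t), k (u • (x - y)) / u = ∫ u in (Real.exp s)..(Real.exp t), (0:ℝ) := by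
      apply intervalIntegral.integral_congr
      intro u hu
      rw [Set.uIcc_of_le (Real.exp_le_exp.2 hst.le)] at hu
      have hu0 : 0 < u := (Real.exp_pos s).trans_le hu.1
      simp only
      rw [hR', zero_div]
      rw [norm_smul, Real.norm_eq_abs, abs_of_pos hu0]
      calc |R| + 1 = Real.exp s * ((|R| + 1) * Real.exp (-s)) := by
            rw [Real.exp_neg]; field_simp
        _ ≤ u * ‖x - y‖ := by
            apply mul_le_mul hu.1 hxy (by positivity) hu0.le
    rw [this]; simp

end build

end DM

set_option linter.unusedSectionVars false
set_option linter.unusedVariables false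

namespace DM

variable {d : ℕ} {Ω : Type*} [m0 : MeasurableSpace Ω]

/-- exponential tilt of a centered gaussian. -/
lemma tilt {v : NNReal} (hv : v ≠ 0) (β : ℝ) {F : ℝ → ENNReal} (hF : Measurable F) :
    ∫⁻ z, ENNReal.ofReal (Real.exp (β * z)) * F z ∂(gaussianReal 0 v) =
      ENNReal.ofReal (Real.exp (β ^ 2 * v / 2)) * ∫⁻ z, F (z + β * v) ∂(gaussianReal 0 v) := by
  rw [gaussianReal_of_var_ne_zero _ hv]
  rw [lintegral_withDensity_eq_lintegral_mul _ (measurable_gaussianPDF _ _) (by fun_prop),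
    lintegral_withDensity_eq_lintegral_mul _ (measurable_gaussianPDF _ _) (by fun_prop),
    ← lintegral_const_mul _ (by fun_prop)]
  rw [← lintegral_add_right_eq_self _ (β * (v:ℝ))]
  congr 1
  ext z
  simp only [Pi.mul_apply, gaussianPDF]
  rw [← mul_assoc, ← mul_assoc, ← ENNReal.ofReal_mul (gaussianPDFReal_nonneg _ _ _),
    ← ENNReal.ofReal_mul (Real.exp_nonneg _)]
  congr 2
  simp only [gaussianPDFReal]
  rw [mul_left_comm, mul_assoc, ← Real.exp_add, ← Real.exp_add]
  congr 2
  have : (v:ℝ) ≠ 0 := by exact_mod_cast hv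
  field_simp
  ring

lemma gauss_symm {v : NNReal} {F : ℝ → ENNReal} (hF : Measurable F) :
    ∫⁻ z, F (-z) ∂(gaussianReal 0 v) = ∫⁻ z, F z ∂(gaussianReal 0 v) := by
  have := gaussianReal_map_neg (μ := 0) (v := v)
  rw [neg_zero] at this
  conv_rhs => rw [← this]
  rw [lintegral_map hF (by fun_prop)]

/-- expectation of product structure: past times function of increment -/
lemma step0 {P : Measure Ω} {X : ℝ → EE d → Ω → ℝ} {L R : ℝ} (h : Setup P X L R)
    {s t : ℝ} (hs : 0 ≤ s) (hst : s < t) (x : EE d) {β : Type*} [MeasurableSpace β]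
    {V : Ω → β} (hV : Measurable[Fil X s] V) {F : β × ℝ → ENNReal} (hF : Measurable F) :
    ∫⁻ ω, F (V ω, X t x ω - X s x ω) ∂P =
      ∫⁻ ω, ∫⁻ z, F (V ω, z) ∂(gaussianReal 0 (t - s).toNNReal) ∂P := by
  have := h.prob
  have hV' : Measurable V := hV.mono (Fil_le h.meas s) le_rfl
  have hm : Measurable (fun ω => X t x ω - X s x ω) := (h.meas t x).sub (h.meas s x)
  have hi : IndepFun V (fun ω => X t x ω - X s x ω) P :=
    (indepFun_of (h.indep s t hs hst) (meas_Inc X s t x) hV).symm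
  rw [indepFun_iff_map_prod_eq_prod_map_map hV'.aemeasurable hm.aemeasurable, h.law s t hs hst x] at hi
  have e : ∫⁻ ω, F (V ω, X t x ω - X s x ω) ∂P =
    ∫⁻ p, F p ∂(Measure.map (fun ω => (V ω, X t x ω - X s x ω)) P) := by
    rw [lintegral_map hF (hV'.prodMk hm)]
  rw [e, hi, lintegral_prod _ (by fun_prop), lintegral_map _ hV']
  exact hF.lintegral_prod_right'

def gam (d : ℕ) : ℝ := Real.sqrt (2 * (d:ℝ))
lemma gam_sq (d : ℕ) : gam d ^ 2 = 2 * d := Real.sq_sqrt (by positivity)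
lemma gam_nonneg (d : ℕ) : 0 ≤ gam d := Real.sqrt_nonneg _
lemma gam_pos {d : ℕ} (hd : 1 ≤ d) : 0 < gam d := Real.sqrt_pos.2 (by positivity)

def tt (n : ℕ) : ℝ := n * Real.log 2
lemma ell_pos : 0 < Real.log 2 := Real.log_pos (by norm_num)
lemma tt_nonneg (n : ℕ) : 0 ≤ tt n := mul_nonneg (by positivity) ell_pos.le
lemma tt_succ (n : ℕ) : tt (n+1) = tt n + Real.log 2 := by simp [tt]; ring
lemma tt_lt_succ (n : ℕ) : tt n < tt (n+1) := by rw [tt_succ]; linarith [ell_pos]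
lemma tt_mono : Monotone tt := monotone_nat_of_le_succ fun n => (tt_lt_succ n).le
lemma tt_zero : tt 0 = 0 := by simp [tt]
lemma exp_tt (n : ℕ) : Real.exp (tt n) = 2 ^ n := by
  rw [tt, mul_comm, Real.exp_mul, Real.exp_log (by norm_num)]; simp

def Yq (X : ℝ → EE d → Ω → ℝ) (q t : ℝ) (x : EE d) (ω : Ω) : ℝ := gam d * t - X t x ω + q
def wt (X : ℝ → EE d → Ω → ℝ) (t : ℝ) (x : EE d) (ω : Ω) : ℝ :=
  Real.exp (gam d * X t x ω - d * t)
def psi (X : ℝ → EE d → Ω → ℝ) (q t : ℝ) (x : EE d) (ω : Ω) : ℝ := Yq X q t x ω * wt X t x ω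
def surv (X : ℝ → EE d → Ω → ℝ) (q : ℝ) (n : ℕ) (x : EE d) : Set Ω :=
  {ω | ∀ i ≤ n, 0 ≤ Yq X q (tt i) x ω}

lemma wt_pos (X : ℝ → EE d → Ω → ℝ) (t : ℝ) (x : EE d) (ω : Ω) : 0 < wt X t x ω := Real.exp_pos _

lemma surv_succ (X : ℝ → EE d → Ω → ℝ) (q : ℝ) (n : ℕ) (x : EE d) :
    surv X q (n+1) x = surv X q n x ∩ {ω | 0 ≤ Yq X q (tt (n+1)) x ω} := by
  ext ω
  simp only [surv, Set.mem_setOf_eq, Set.mem_inter_iff]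
  constructor
  · intro h; exact ⟨fun i hi => h i (by omega), h _ le_rfl⟩
  · rintro ⟨h1, h2⟩ i hi
    rcases Nat.le_succ_iff.1 hi with h | h
    · exact h1 i h
    · subst h; exact h2

lemma meas_Yq_Fil (X : ℝ → EE d → Ω → ℝ) (q : ℝ) {u s : ℝ} (hu : 0 ≤ u) (hus : u ≤ s) (x : EE d) :
    Measurable[Fil X s] (Yq X q u x) := by
  have := meas_Fil X hu hus x
  unfold Yq
  exact (this.const_sub _).add_const _

lemma meas_wt_Fil (X : ℝ → EE d → Ω → ℝ) {u s : ℝ} (hu : 0 ≤ u) (hus : u ≤ s) (x : EE d) :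
    Measurable[Fil X s] (wt X u x) := by
  have := meas_Fil X hu hus x
  unfold wt
  exact Real.measurable_exp.comp ((this.const_mul _).sub_const _)

lemma meas_surv_Fil (X : ℝ → EE d → Ω → ℝ) (q : ℝ) (n : ℕ) {s : ℝ} (hs : tt n ≤ s) (x : EE d) :
    MeasurableSet[Fil X s] (surv X q n x) := by
  have : surv X q n x = ⋂ i ∈ Finset.range (n+1), (Yq X q (tt i) x) ⁻¹' Set.Ici 0 := by
    ext ω; simp [surv, Nat.lt_succ_iff]
  rw [this]
  apply Finset.measurableSet_biInter
  intro i hi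
  have : i ≤ n := by simp at hi; omega
  exact (meas_Yq_Fil X q (tt_nonneg i) ((tt_mono this).trans hs) x) measurableSet_Ici

lemma wt_step (X : ℝ → EE d → Ω → ℝ) (s t : ℝ) (x : EE d) (ω : Ω) :
    wt X t x ω = wt X s x ω * Real.exp (gam d * (X t x ω - X s x ω) - d * (t - s)) := by
  unfold wt; rw [← Real.exp_add]; ring_nf

lemma Yq_step (X : ℝ → EE d → Ω → ℝ) (q s t : ℝ) (x : EE d) (ω : Ω) :
    Yq X q t x ω = Yq X q s x ω + (gam d * (t - s) - (X t x ω - X s x ω)) := by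
  unfold Yq; ring

/-- change of measure. -/
lemma cm {v : NNReal} (hv : v ≠ 0) {F : ℝ → ENNReal} (hF : Measurable F) :
    ∫⁻ z, ENNReal.ofReal (Real.exp (gam d * z - d * v)) * F (gam d * v - z) ∂(gaussianReal 0 v) =
      ∫⁻ z, F z ∂(gaussianReal 0 v) := by
  have e : ∀ z : ℝ, ENNReal.ofReal (Real.exp (gam d * z - d * v)) * F (gam d * v - z)
     = ENNReal.ofReal (Real.exp (gam d * z)) * (ENNReal.ofReal (Real.exp (- (d * v))) * F (gam d * v - z)) := by
    intro z
    rw [← mul_assoc, ← ENNReal.ofReal_mul (Real.exp_nonneg _), ← Real.exp_add, sub_eq_add_neg]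
  simp_rw [e]
  rw [tilt hv (F := fun z => ENNReal.ofReal (Real.exp (- (d * v))) * F (gam d * v - z)) (gam d) (by fun_prop)]
  rw [lintegral_const_mul _ (by fun_prop), ← mul_assoc, ← ENNReal.ofReal_mul (Real.exp_nonneg _), ← Real.exp_add,
    gam_sq]
  have : 2 * (d:ℝ) * v / 2 + -(d * v) = 0 := by ring
  rw [this, Real.exp_zero, ENNReal.ofReal_one, one_mul, ← gauss_symm hF]
  congr 1; ext z; congr 1; ring

lemma step1 {P : Measure Ω} {X : ℝ → EE d → Ω → ℝ} {L R : ℝ} (h : Setup P X L R) (q : ℝ)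
    {s t : ℝ} (hs : 0 ≤ s) (hst : s < t) (x : EE d) {B : Set Ω} (hB : MeasurableSet[Fil X s] B)
    {F : ℝ → ENNReal} (hF : Measurable F) :
    ∫⁻ ω in B, ENNReal.ofReal (wt X t x ω) * F (Yq X q t x ω) ∂P =
      ∫⁻ ω in B, ENNReal.ofReal (wt X s x ω) *
        ∫⁻ z, F (Yq X q s x ω + z) ∂(gaussianReal 0 (t - s).toNNReal) ∂P := by
  have hB' : MeasurableSet B := Fil_le h.meas s B hB
  have hv : (t-s).toNNReal ≠ 0 := by simp; linarith
  rw [← lintegral_indicator hB', ← lintegral_indicator hB']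
  let V : Ω → ENNReal × ℝ := fun ω => (B.indicator (fun ω => ENNReal.ofReal (wt X s x ω)) ω, Yq X q s x ω)
  have hV : Measurable[Fil X s] V := by
    apply Measurable.prodMk
    · exact Measurable.indicator (ENNReal.measurable_ofReal.comp (meas_wt_Fil X hs le_rfl x)) hB
    · exact meas_Yq_Fil X q hs le_rfl x
  have := step0 h hs hst x hV (F := fun p => p.1.1 * (ENNReal.ofReal (Real.exp (gam d * p.2 - d * (t-s))) * F (p.1.2 + (gam d * (t-s) - p.2))))
    (by fun_prop)
  calc _ = ∫⁻ ω, (V ω).1 * (ENNReal.ofReal (Real.exp (gam d * (X t x ω - X s x ω) - d * (t-s))) * F ((V ω).2 + (gam d * (t-s) - (X t x ω - X s x ω)))) ∂P := by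
        congr 1; ext ω
        by_cases hω : ω ∈ B
        · simp only [Set.indicator_of_mem hω, V]
          rw [wt_step X s t, ENNReal.ofReal_mul (wt_pos _ _ _ _).le, Yq_step X q s t, mul_assoc]
        · simp [hω, V]
    _ = _ := by
        rw [this]
        congr 1; ext ω
        have e : ((t-s).toNNReal : ℝ) = t - s := Real.coe_toNNReal _ (by linarith)
        have := cm (d := d) hv (F := fun z => F ((V ω).2 + z)) (by fun_prop)
        rw [e] at this
        simp only
        rw [lintegral_const_mul _ (by fun_prop), this]
        by_cases hω : ω ∈ B
        · simp [hω, V]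
        · simp [hω, V]

/-- tail lemma -/
lemma tail {v : NNReal} (hv : v ≠ 0) {θ : ℝ} (hθ : 0 ≤ θ) {y : ℝ} (hy : 0 ≤ y) :
    ∫⁻ z, (Set.Iio (0:ℝ)).indicator (fun u => ENNReal.ofReal (Real.exp (-θ * u))) (y + z) ∂(gaussianReal 0 v)
     ≤ ENNReal.ofReal (2 * Real.exp (θ ^ 2 * v)) *
       ∫⁻ z, (Set.Iio (0:ℝ)).indicator (fun _ => 1) (y + z) ∂(gaussianReal 0 v) := by
  have key : ∀ z : ℝ, (Set.Iio (0:ℝ)).indicator (fun u => ENNReal.ofReal (Real.exp (-θ * u))) (y + z) ≤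
     ENNReal.ofReal (Real.exp (θ ^ 2 * v)) * (Set.Iio (0:ℝ)).indicator (fun _ => 1) (y + z) +
     ENNReal.ofReal (Real.exp (-θ * z)) * (Set.Iio (0:ℝ)).indicator (fun _ => 1) (y + (z + θ * v)) := by
    intro z
    by_cases h0 : y + z < 0
    · rw [Set.indicator_of_mem (by exact h0), Set.indicator_of_mem (by exact h0), mul_one]
      by_cases h1 : y + (z + θ * v) < 0
      · rw [Set.indicator_of_mem (by exact h1), mul_one]
        refine le_trans (ENNReal.ofReal_le_ofReal ?_) le_add_self
        apply Real.exp_le_exp.2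
        nlinarith
      · refine le_trans (ENNReal.ofReal_le_ofReal ?_) le_self_add
        apply Real.exp_le_exp.2
        nlinarith
    · rw [Set.indicator_of_notMem (by exact h0)]; exact zero_le
  refine (lintegral_mono key).trans ?_
  have hm : ∀ c : ℝ, Measurable fun z : ℝ => (Set.Iio (0:ℝ)).indicator (fun _ => (1:ENNReal)) (y + (z + c)) := by
    intro c
    exact (measurable_const.indicator measurableSet_Iio).comp (by fun_prop)
  have hm0 : Measurable fun z : ℝ => (Set.Iio (0:ℝ)).indicator (fun _ => (1:ENNReal)) (y + z) := by
    simpa using hm 0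
  rw [lintegral_add_left (hm0.const_mul _), lintegral_const_mul _ hm0,
    tilt hv (-θ) (F := fun z => (Set.Iio (0:ℝ)).indicator (fun _ => 1) (y + (z + θ * v))) (hm _)]
  have e : ∀ z : ℝ, y + (z + -θ * v + θ * v) = y + z := by intro z; ring
  simp only [e]
  rw [← add_mul, ← ENNReal.ofReal_add (Real.exp_nonneg _) (Real.exp_nonneg _)]
  gcongr
  have : Real.exp ((-θ)^2 * v / 2) ≤ Real.exp (θ^2 * v) := by
    apply Real.exp_le_exp.2
    have : 0 ≤ θ^2 * v := by positivity
    nlinarith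
  linarith

def ggE (P : Measure Ω) (X : ℝ → EE d → Ω → ℝ) (q θ : ℝ) (n : ℕ) (x : EE d) : ENNReal :=
  ∫⁻ ω in surv X q n x, ENNReal.ofReal (wt X (tt n) x ω) * ENNReal.ofReal (Real.exp (-θ * Yq X q (tt n) x ω)) ∂P

def pp (P : Measure Ω) (X : ℝ → EE d → Ω → ℝ) (q : ℝ) (n : ℕ) (x : EE d) : ENNReal :=
  ∫⁻ ω in surv X q n x, ENNReal.ofReal (wt X (tt n) x ω) ∂P

def kk (P : Measure Ω) (X : ℝ → EE d → Ω → ℝ) (q : ℝ) (n : ℕ) (x : EE d) : ENNReal :=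
  ∫⁻ ω in surv X q n x, ENNReal.ofReal (wt X (tt (n+1)) x ω) *
    (Set.Iio (0:ℝ)).indicator (fun _ => 1) (Yq X q (tt (n+1)) x ω) ∂P

lemma meas_surv {P : Measure Ω} {X : ℝ → EE d → Ω → ℝ} {L R : ℝ} (h : Setup P X L R) (q : ℝ) (n : ℕ) (x : EE d) :
    MeasurableSet (surv X q n x) := Fil_le h.meas _ _ (meas_surv_Fil X q n le_rfl x)

lemma meas_Yq {P : Measure Ω} {X : ℝ → EE d → Ω → ℝ} {L R : ℝ} (h : Setup P X L R) (q t : ℝ) (x : EE d) :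
    Measurable (Yq X q t x) := by
  have := h.meas t x
  unfold Yq; fun_prop

lemma meas_wt {P : Measure Ω} {X : ℝ → EE d → Ω → ℝ} {L R : ℝ} (h : Setup P X L R) (t : ℝ) (x : EE d) :
    Measurable (wt X t x) := by
  have := h.meas t x
  unfold wt; fun_prop

lemma tt_sub (n : ℕ) : tt (n+1) - tt n = Real.log 2 := by rw [tt_succ]; ring

/-- split into surviving and killed. -/
lemma split_surv {P : Measure Ω} {X : ℝ → EE d → Ω → ℝ} {L R : ℝ} (h : Setup P X L R) (q : ℝ) (n : ℕ) (x : EE d)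
    {F : ℝ → ENNReal} (hF : Measurable F) :
    ∫⁻ ω in surv X q n x, ENNReal.ofReal (wt X (tt (n+1)) x ω) * F (Yq X q (tt (n+1)) x ω) ∂P =
    ∫⁻ ω in surv X q (n+1) x, ENNReal.ofReal (wt X (tt (n+1)) x ω) * F (Yq X q (tt (n+1)) x ω) ∂P +
    ∫⁻ ω in surv X q n x, ENNReal.ofReal (wt X (tt (n+1)) x ω) *
      (Set.Iio (0:ℝ)).indicator F (Yq X q (tt (n+1)) x ω) ∂P := by
  have m1 := meas_surv h q n x
  have m2 := meas_surv h q (n+1) x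
  have m3 := meas_Yq h q (tt (n+1)) x
  have m4 := meas_wt h (tt (n+1)) x
  rw [← lintegral_indicator m1, ← lintegral_indicator m2, ← lintegral_indicator m1, ← lintegral_add_left]
  · congr 1; ext ω
    rw [surv_succ]
    by_cases h1 : ω ∈ surv X q n x
    · by_cases h2 : 0 ≤ Yq X q (tt (n+1)) x ω
      · have : ω ∈ surv X q n x ∩ {ω | 0 ≤ Yq X q (tt (n+1)) x ω} := ⟨h1, h2⟩
        simp [h1, this, h2]
      · have : ω ∉ surv X q n x ∩ {ω | 0 ≤ Yq X q (tt (n+1)) x ω} := fun h => h2 h.2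
        simp only [Set.indicator_of_mem h1, Set.indicator_of_notMem this]
        rw [Set.indicator_of_mem (by simpa using h2)]; simp
    · have : ω ∉ surv X q n x ∩ {ω | 0 ≤ Yq X q (tt (n+1)) x ω} := fun h => h1 h.1
      simp only [Set.indicator_of_notMem h1, Set.indicator_of_notMem this]; simp
  · apply Measurable.indicator _ m2
    exact (ENNReal.measurable_ofReal.comp m4).mul (hF.comp m3)

lemma pp_step {P : Measure Ω} {X : ℝ → EE d → Ω → ℝ} {L R : ℝ} (h : Setup P X L R) (q : ℝ) (n : ℕ) (x : EE d) :
    pp P X q n x = pp P X q (n+1) x + kk P X q n x := by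
  have h1 := split_surv h q n x (F := fun _ => 1) measurable_const
  have h2 := step1 h q (tt_nonneg n) (tt_lt_succ n) x (meas_surv_Fil X q n le_rfl x) (F := fun _ => 1) measurable_const
  rw [h2] at h1
  simp at h1
  simpa [pp, kk] using h1

lemma pp_le_one {P : Measure Ω} {X : ℝ → EE d → Ω → ℝ} {L R : ℝ} (h : Setup P X L R) (q : ℝ) (n : ℕ) (x : EE d) :
    pp P X q n x ≤ 1 := by
  have := h.prob
  induction n with
  | zero =>
    unfold pp
    refine (setLIntegral_le_lintegral _ _).trans ?_
    have : ∫⁻ ω, ENNReal.ofReal (wt X (tt 0) x ω) ∂P = ∫⁻ ω, 1 ∂P := by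
      apply lintegral_congr_ae
      filter_upwards [h.zero x] with ω hω
      simp [wt, tt_zero, hω]
    rw [this]; simp
  | succ n ih => rw [pp_step h] at ih; exact le_self_add.trans ih

lemma gauss_exp {v : NNReal} (hv : v ≠ 0) (β : ℝ) :
    ∫⁻ z, ENNReal.ofReal (Real.exp (β * z)) ∂(gaussianReal 0 v) = ENNReal.ofReal (Real.exp (β ^ 2 * v / 2)) := by
  have := tilt hv β (F := fun _ => 1) measurable_const
  simpa using this

lemma gg_step {P : Measure Ω} {X : ℝ → EE d → Ω → ℝ} {L R : ℝ} (h : Setup P X L R) (q : ℝ) {θ : ℝ} (hθ : 0 ≤ θ) (n : ℕ) (x : EE d) :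
    ENNReal.ofReal (Real.exp (θ^2 * Real.log 2 / 2)) * ggE P X q θ n x ≤ ggE P X q θ (n+1) x +
      ENNReal.ofReal (2 * Real.exp (θ ^ 2 * Real.log 2)) * kk P X q n x := by
  have hF : Measurable fun u : ℝ => ENNReal.ofReal (Real.exp (-θ * u)) := by fun_prop
  have h1 := split_surv h q n x hF
  have hm := meas_surv_Fil X q n le_rfl x
  have h2 := step1 h q (tt_nonneg n) (tt_lt_succ n) x hm hF
  have hv : (tt (n+1) - tt n).toNNReal ≠ 0 := by rw [tt_sub]; simp; linarith [ell_pos]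
  have hvv : ((tt (n+1) - tt n).toNNReal : ℝ) = Real.log 2 := by rw [tt_sub]; exact Real.coe_toNNReal _ ell_pos.le
  have e1 : ENNReal.ofReal (Real.exp (θ^2 * Real.log 2 / 2)) * ggE P X q θ n x =
     ∫⁻ ω in surv X q n x, ENNReal.ofReal (wt X (tt (n+1)) x ω) * ENNReal.ofReal (Real.exp (-θ * Yq X q (tt (n+1)) x ω)) ∂P := by
    rw [h2]; unfold ggE
    rw [← lintegral_const_mul']
    · congr 1; ext ω
      have : ∀ z : ℝ, ENNReal.ofReal (Real.exp (-θ * (Yq X q (tt n) x ω + z))) = ENNReal.ofReal (Real.exp (-θ * (Yq X q (tt n) x ω))) * ENNReal.ofReal (Real.exp (-θ * z)) := by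
        intro z; rw [← ENNReal.ofReal_mul (Real.exp_nonneg _), ← Real.exp_add]; ring_nf
      simp_rw [this]
      rw [lintegral_const_mul _ (by fun_prop), gauss_exp hv, hvv]
      rw [neg_sq]
      ring
    · simp
  rw [e1, h1]
  unfold ggE
  gcongr
  have h3 := step1 h q (tt_nonneg n) (tt_lt_succ n) x hm (F := (Set.Iio (0:ℝ)).indicator (fun u => ENNReal.ofReal (Real.exp (-θ * u))))
    (hF.indicator measurableSet_Iio)
  have h4 := step1 h q (tt_nonneg n) (tt_lt_succ n) x hm (F := (Set.Iio (0:ℝ)).indicator (fun u => 1))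
    (measurable_const.indicator measurableSet_Iio)
  unfold kk
  rw [h3, h4, ← lintegral_const_mul' _ _ ENNReal.ofReal_ne_top]
  apply setLIntegral_mono_ae' (meas_surv h q n x)
  refine Eventually.of_forall fun ω hω => ?_
  rw [mul_left_comm]
  gcongr
  have := tail hv hθ (hω n le_rfl)
  rwa [hvv] at this

lemma gg_le_pp {P : Measure Ω} {X : ℝ → EE d → Ω → ℝ} {L R : ℝ} (h : Setup P X L R) (q : ℝ) {θ : ℝ} (hθ : 0 ≤ θ) (n : ℕ) (x : EE d) :
    ggE P X q θ n x ≤ pp P X q n x := by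
  unfold ggE pp
  apply setLIntegral_mono_ae' (meas_surv h q n x)
  refine Eventually.of_forall fun ω hω => ?_
  have h1 := hω n le_rfl
  have : ENNReal.ofReal (Real.exp (-θ * Yq X q (tt n) x ω)) ≤ 1 := by
    rw [ENNReal.ofReal_le_one, Real.exp_le_one_iff]
    nlinarith
  calc _ ≤ ENNReal.ofReal (wt X (tt n) x ω) * 1 := by gcongr
    _ = _ := mul_one _

/-- real Green quantities -/
def gg (P : Measure Ω) (X : ℝ → EE d → Ω → ℝ) (q θ : ℝ) (n : ℕ) (x : EE d) : ℝ := (ggE P X q θ n x).toReal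

lemma gg_nonneg (P : Measure Ω) (X : ℝ → EE d → Ω → ℝ) (q θ : ℝ) (n : ℕ) (x : EE d) : 0 ≤ gg P X q θ n x :=
  ENNReal.toReal_nonneg

lemma ggE_ne_top {P : Measure Ω} {X : ℝ → EE d → Ω → ℝ} {L R : ℝ} (h : Setup P X L R) (q : ℝ) {θ : ℝ} (hθ : 0 ≤ θ) (n : ℕ) (x : EE d) :
    ggE P X q θ n x ≠ ⊤ :=
  ne_top_of_le_ne_top ENNReal.one_ne_top ((gg_le_pp h q hθ n x).trans (pp_le_one h q n x))

lemma ggE_eq {P : Measure Ω} {X : ℝ → EE d → Ω → ℝ} {L R : ℝ} (h : Setup P X L R) (q : ℝ) {θ : ℝ} (hθ : 0 ≤ θ) (n : ℕ) (x : EE d) :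
    ggE P X q θ n x = ENNReal.ofReal (gg P X q θ n x) := (ENNReal.ofReal_toReal (ggE_ne_top h q hθ n x)).symm

/-- constant in Green bound -/
def greenC (θ : ℝ) : ℝ := (2 * Real.exp (θ ^ 2 * Real.log 2) + 1) / (Real.exp (θ^2 * Real.log 2 / 2) - 1)

lemma greenC_aux {θ : ℝ} (hθ : 0 < θ) : 0 < Real.exp (θ^2 * Real.log 2 / 2) - 1 := by
  have : 0 < θ^2 * Real.log 2 / 2 := by have := ell_pos; positivity
  have := Real.add_one_lt_exp this.ne'
  linarith

theorem green {P : Measure Ω} {X : ℝ → EE d → Ω → ℝ} {L R : ℝ} (h : Setup P X L R) (q : ℝ) {θ : ℝ} (hθ : 0 < θ) (x : EE d) (N : ℕ) :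
    ∑ n ∈ Finset.range N, gg P X q θ n x ≤ greenC θ := by
  have pf : ∀ n, pp P X q n x ≠ ⊤ := fun n => ne_top_of_le_ne_top ENNReal.one_ne_top (pp_le_one h q n x)
  have kf : ∀ n, kk P X q n x ≠ ⊤ := fun n => ne_top_of_le_ne_top (pf n) (by rw [pp_step h]; exact le_add_self)
  have hp : ∀ n, (pp P X q n x).toReal = (pp P X q (n+1) x).toReal + (kk P X q n x).toReal := by
    intro n
    rw [pp_step h, ENNReal.toReal_add (pf _) (kf n)]
  have hg : ∀ n, Real.exp (θ^2 * Real.log 2 / 2) * gg P X q θ n x ≤ gg P X q θ (n+1) x + 2 * Real.exp (θ ^ 2 * Real.log 2) * (kk P X q n x).toReal := by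
    intro n
    have := ENNReal.toReal_mono (by finiteness [ggE_ne_top h q hθ.le (n+1) x, kf n]) (gg_step h q hθ.le n x)
    rw [ENNReal.toReal_mul, ENNReal.toReal_add (ggE_ne_top h q hθ.le _ x) (by finiteness [kf n]), ENNReal.toReal_mul,
      ENNReal.toReal_ofReal (by positivity), ENNReal.toReal_ofReal (by positivity)] at this
    exact this
  have hgp : ∀ n, gg P X q θ n x ≤ (pp P X q n x).toReal := fun n =>
    ENNReal.toReal_mono (pf n) (gg_le_pp h q hθ.le n x)
  have hp1 : (pp P X q 0 x).toReal ≤ 1 := by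
    have := ENNReal.toReal_mono ENNReal.one_ne_top (pp_le_one h q 0 x); simpa using this
  have key : ∀ N, (Real.exp (θ^2 * Real.log 2 / 2) - 1) * ∑ n ∈ Finset.range N, gg P X q θ n x ≤
     gg P X q θ N x - gg P X q θ 0 x + 2 * Real.exp (θ ^ 2 * Real.log 2) * ((pp P X q 0 x).toReal - (pp P X q N x).toReal) := by
    intro N
    induction N with
    | zero => simp
    | succ n ih =>
      rw [Finset.sum_range_succ, mul_add]
      have h1 := hg n
      have h2 := hp n
      have h3 : (kk P X q n x).toReal = (pp P X q n x).toReal - (pp P X q (n+1) x).toReal := by linarith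
      rw [h3] at h1
      nlinarith
  rw [greenC, le_div_iff₀ (greenC_aux hθ), mul_comm]
  refine (key N).trans ?_
  have h1 := hgp N
  have h2 := gg_nonneg P X q θ 0 x
  have h3 : 1 ≤ Real.exp (θ ^ 2 * Real.log 2) := Real.one_le_exp (by have := ell_pos; positivity)
  have h4 : 0 ≤ (pp P X q N x).toReal := ENNReal.toReal_nonneg
  nlinarith

end DM

set_option linter.unusedSectionVars false
set_option linter.unusedVariables false

namespace DM

variable {d : ℕ} {Ω : Type*} [m0 : MeasurableSpace Ω]

def kap : NNReal := NNReal.sqrt (NNReal.sqrt 2)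
lemma kap_four : kap ^ 4 = 2 := by
  have : kap ^ 4 = (kap ^ 2) ^ 2 := by ring
  rw [this, kap, NNReal.sq_sqrt, NNReal.sq_sqrt]
lemma kap_four' : (kap:ℝ) ^ 4 = 2 := by exact_mod_cast kap_four
lemma one_lt_kap : 1 < kap := by
  by_contra h
  push Not at h
  have := pow_le_one₀ (n := 4) (zero_le : 0 ≤ kap) h
  rw [kap_four] at this
  norm_num at this
lemma kap_pos : 0 < kap := zero_lt_one.trans one_lt_kap

def Cub (r : ℕ) (c : Fin d → ℕ) : Finset (Fin d → ℕ) :=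
  Fintype.piFinset fun i => Finset.Ico (c i * 2 ^ r) ((c i + 1) * 2 ^ r)

lemma mem_Cub {r : ℕ} {c e : Fin d → ℕ} : e ∈ Cub r c ↔ ∀ i, c i * 2 ^ r ≤ e i ∧ e i < (c i + 1) * 2 ^ r := by
  simp [Cub]

lemma card_Cub (r : ℕ) (c : Fin d → ℕ) : (Cub r c).card = (2 ^ r) ^ d := by
  have : ∀ i, (c i + 1) * 2 ^ r - c i * 2 ^ r = 2 ^ r := by
    intro i; rw [add_mul, one_mul]; exact Nat.add_sub_cancel_left _ _
  simp [Cub, this]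

def hf (e : Fin d → ℕ) : Fin d → ℕ := fun i => e i / 2

lemma hf_mem {r : ℕ} {c e : Fin d → ℕ} (h : e ∈ Cub (r+1) c) : hf e ∈ Cub r c := by
  rw [mem_Cub] at h ⊢
  intro i
  have := h i
  simp only [pow_succ, hf] at this ⊢
  constructor
  · have := this.1; rw [← mul_assoc] at this; omega
  · have := this.2; rw [← mul_assoc] at this; omega

lemma up_mem {r : ℕ} {c e : Fin d → ℕ} (h : e ∈ Cub r c) : e ∈ Cub (r+1) (hf c) := by
  rw [mem_Cub] at h ⊢
  intro i
  obtain ⟨h1, h2⟩ := h i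
  simp only [pow_succ, hf] at *
  constructor
  · calc c i / 2 * (2 ^ r * 2) = (c i / 2 * 2) * 2 ^ r := by ring
      _ ≤ c i * 2 ^ r := by gcongr; exact Nat.div_mul_le_self _ _
      _ ≤ _ := h1
  · calc e i < (c i + 1) * 2 ^ r := h2
      _ ≤ ((c i / 2 + 1) * 2) * 2 ^ r := by gcongr; omega
      _ = _ := by ring

def pt (v : EE d) (s : ℝ) (k : ℕ) (e : Fin d → ℕ) : EE d :=
  v + (s / 2 ^ k) • WithLp.toLp 2 (fun i => (e i : ℝ))

lemma pt_apply (v : EE d) (s : ℝ) (k : ℕ) (e : Fin d → ℕ) (i : Fin d) :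
    pt v s k e i = v i + s / 2 ^ k * e i := by simp [pt]

lemma pt_refine (v : EE d) (s : ℝ) (k r : ℕ) (e : Fin d → ℕ) :
    pt v s (k + r) (fun i => e i * 2 ^ r) = pt v s k e := by
  ext i
  simp only [pt_apply, Nat.cast_mul, Nat.cast_pow, Nat.cast_ofNat, pow_add]
  field_simp

lemma norm_le_coord {x : EE d} {b : ℝ} (hb : 0 ≤ b) (h : ∀ i, |x i| ≤ b) : ‖x‖ ≤ d * b := by
  rw [EuclideanSpace.norm_eq]
  apply Real.sqrt_le_iff.2 ⟨by positivity, ?_⟩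
  have h1 : ∑ i : Fin d, ‖x i‖ ^ 2 ≤ ∑ i : Fin d, b ^ 2 := by
    apply Finset.sum_le_sum; intro i _
    exact pow_le_pow_left₀ (norm_nonneg _) (h i) 2
  refine h1.trans ?_
  simp only [Finset.sum_const, Finset.card_univ, Fintype.card_fin, nsmul_eq_mul]
  rcases Nat.eq_zero_or_pos d with h0 | h0
  · subst h0; simp
  · have : (1:ℝ) ≤ d := by exact_mod_cast h0
    have : 0 ≤ b^2 := by positivity
    nlinarith

lemma norm_edge (v : EE d) {s : ℝ} (hs : 0 ≤ s) (k : ℕ) (e : Fin d → ℕ) :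
    ‖pt v s (k+1) e - pt v s k (hf e)‖ ≤ d * (s / 2 ^ (k+1)) := by
  apply norm_le_coord (by positivity)
  intro i
  simp only [PiLp.sub_apply, pt_apply, hf, pow_succ]
  have h1 : e i = 2 * (e i / 2) + e i % 2 := (Nat.div_add_mod _ _).symm
  have h2 : (e i : ℝ) = 2 * ((e i / 2 : ℕ) : ℝ) + ((e i % 2 : ℕ) : ℝ) := by exact_mod_cast h1
  have h3 : ((e i % 2 : ℕ) : ℝ) ≤ 1 := by
    have : e i % 2 ≤ 1 := by omega
    exact_mod_cast this
  have h4 : (0:ℝ) ≤ ((e i % 2 : ℕ) : ℝ) := by positivity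
  have e5 : v i + s / (2 ^ k * 2) * (e i:ℝ) - (v i + s / 2 ^ k * ((e i / 2 : ℕ) : ℝ)) = s / (2 ^ k * 2) * ((e i % 2 : ℕ) : ℝ) := by
    rw [h2]; field_simp; ring
  rw [e5, abs_of_nonneg (by positivity)]
  exact mul_le_of_le_one_right (by positivity) h3

def Dn (v : EE d) (s : ℝ) (M j : ℕ) (c : Fin d → ℕ) (φ : EE d → ℝ) : NNReal :=
  (Finset.range M).sup fun r => (Cub (r+1) c).sup fun e =>
    kap ^ r * ‖φ (pt v s (j + r + 1) e) - φ (pt v s (j + r) (hf e))‖₊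

lemma Dn_add (v : EE d) (s : ℝ) (M j : ℕ) (c : Fin d → ℕ) (φ φ' : EE d → ℝ) :
    Dn v s M j c (fun x => φ x + φ' x) ≤ Dn v s M j c φ + Dn v s M j c φ' := by
  refine Finset.sup_le fun r hr => Finset.sup_le fun e he => ?_
  have h1 : kap ^ r * ‖φ (pt v s (j + r + 1) e) - φ (pt v s (j + r) (hf e))‖₊ ≤ Dn v s M j c φ :=
    (Finset.le_sup (f := fun e => kap ^ r * ‖φ (pt v s (j + r + 1) e) - φ (pt v s (j + r) (hf e))‖₊) he).trans
    (Finset.le_sup (f := fun r => (Cub (r+1) c).sup fun e =>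
    kap ^ r * ‖φ (pt v s (j + r + 1) e) - φ (pt v s (j + r) (hf e))‖₊) hr)
  have h2 : kap ^ r * ‖φ' (pt v s (j + r + 1) e) - φ' (pt v s (j + r) (hf e))‖₊ ≤ Dn v s M j c φ' :=
    (Finset.le_sup (f := fun e => kap ^ r * ‖φ' (pt v s (j + r + 1) e) - φ' (pt v s (j + r) (hf e))‖₊) he).trans
    (Finset.le_sup (f := fun r => (Cub (r+1) c).sup fun e =>
    kap ^ r * ‖φ' (pt v s (j + r + 1) e) - φ' (pt v s (j + r) (hf e))‖₊) hr)
  refine le_trans ?_ (add_le_add h1 h2)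
  rw [← mul_add]
  gcongr
  refine le_trans (le_of_eq ?_) (nnnorm_add_le _ _)
  congr 1; ring

lemma Dn_child (v : EE d) (s : ℝ) (M j : ℕ) (c : Fin d → ℕ) (φ : EE d → ℝ) :
    Dn v s M (j+1) c φ ≤ kap⁻¹ * Dn v s (M+1) j (hf c) φ := by
  refine Finset.sup_le fun r hr => Finset.sup_le fun e he => ?_
  have hr' : r + 1 ∈ Finset.range (M+1) := by simp at hr ⊢; omega
  have h1 : kap ^ (r+1) * ‖φ (pt v s (j + (r+1) + 1) e) - φ (pt v s (j + (r+1)) (hf e))‖₊ ≤ Dn v s (M+1) j (hf c) φ :=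
    (Finset.le_sup (f := fun e => kap ^ (r+1) * ‖φ (pt v s (j + (r+1) + 1) e) - φ (pt v s (j + (r+1)) (hf e))‖₊) (up_mem he)).trans
    (Finset.le_sup (f := fun r => (Cub (r+1) (hf c)).sup fun e =>
    kap ^ r * ‖φ (pt v s (j + r + 1) e) - φ (pt v s (j + r) (hf e))‖₊) hr')
  have e1 : j + 1 + r = j + (r + 1) := by ring
  rw [e1]
  calc _ = kap⁻¹ * (kap ^ (r+1) * ‖φ (pt v s (j + (r+1) + 1) e) - φ (pt v s (j + (r+1)) (hf e))‖₊) := by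
        rw [pow_succ]; field_simp [kap_pos.ne']
    _ ≤ _ := by gcongr

/-- chaining -/
lemma chain (v : EE d) (s : ℝ) (M j : ℕ) (c : Fin d → ℕ) (φ : EE d → ℝ) :
    ∀ r ≤ M, ∀ e ∈ Cub r c, ‖φ (pt v s (j + r) e) - φ (pt v s j c)‖₊ ≤ (∑ i ∈ Finset.range r, (kap⁻¹) ^ i) * Dn v s M j c φ := by
  intro r
  induction r with
  | zero =>
    intro _ e he
    have : e = c := by
      ext i
      have := (mem_Cub.1 he) i
      simp at this; omega
    subst this; simp
  | succ r ih =>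
    intro hr e he
    have h1 := ih (by omega) (hf e) (hf_mem he)
    have h2 : kap ^ r * ‖φ (pt v s (j + r + 1) e) - φ (pt v s (j + r) (hf e))‖₊ ≤ Dn v s M j c φ :=
      (Finset.le_sup (f := fun e => kap ^ r * ‖φ (pt v s (j + r + 1) e) - φ (pt v s (j + r) (hf e))‖₊) he).trans
      (Finset.le_sup (f := fun r => (Cub (r+1) c).sup fun e =>
      kap ^ r * ‖φ (pt v s (j + r + 1) e) - φ (pt v s (j + r) (hf e))‖₊) (by simp; omega : r ∈ Finset.range M))
    have h3 : ‖φ (pt v s (j + r + 1) e) - φ (pt v s (j + r) (hf e))‖₊ ≤ (kap⁻¹) ^ r * Dn v s M j c φ := by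
      calc _ = (kap⁻¹) ^ r * (kap ^ r * ‖φ (pt v s (j + r + 1) e) - φ (pt v s (j + r) (hf e))‖₊) := by
            rw [← mul_assoc, ← mul_pow, inv_mul_cancel₀ kap_pos.ne', one_pow, one_mul]
        _ ≤ _ := by gcongr
    rw [Finset.sum_range_succ, add_mul, ← add_assoc j r 1]
    calc _ = ‖(φ (pt v s (j + r) (hf e)) - φ (pt v s j c)) + (φ (pt v s (j + r + 1) e) - φ (pt v s (j + r) (hf e)))‖₊ := by
          congr 1; ring
      _ ≤ _ := nnnorm_add_le _ _
      _ ≤ _ := add_le_add h1 h3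

def Ck : NNReal := (1 - kap⁻¹)⁻¹

lemma kap_inv_lt : kap⁻¹ < 1 := inv_lt_one_of_one_lt₀ one_lt_kap

lemma chain' (v : EE d) (s : ℝ) (M j : ℕ) (c : Fin d → ℕ) (φ : EE d → ℝ) (e : Fin d → ℕ) (he : e ∈ Cub M c) :
    |φ (pt v s (j + M) e) - φ (pt v s j c)| ≤ Ck * Dn v s M j c φ := by
  have h := chain v s M j c φ M le_rfl e he
  have h2 : ∑ i ∈ Finset.range M, (kap⁻¹) ^ i ≤ Ck := by
    have hs : HasSum (fun i => ((kap⁻¹ : NNReal)) ^ i) Ck := NNReal.hasSum_geometric kap_inv_lt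
    exact sum_le_hasSum _ (fun i _ => zero_le) hs
  have h3 := h.trans (mul_le_mul_left h2 _)
  exact_mod_cast h3

lemma meas_sup {m : MeasurableSpace Ω} {ι : Type*} (S : Finset ι) (f : ι → Ω → NNReal) (hf : ∀ i, Measurable[m] (f i)) :
    Measurable[m] (fun ω => S.sup fun i => f i ω) := by
  classical
  induction S using Finset.induction_on with
  | empty => simp only [Finset.sup_empty]; exact measurable_const
  | insert a S ha ih =>
    simp only [Finset.sup_insert]
    exact Measurable.max (hf a) ih

lemma meas_Dn {m : MeasurableSpace Ω} (v : EE d) (s : ℝ) (M j : ℕ) (c : Fin d → ℕ) (φ : EE d → Ω → ℝ)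
    (h : ∀ x, Measurable[m] (φ x)) : Measurable[m] (fun ω => Dn v s M j c (fun x => φ x ω)) := by
  unfold Dn
  refine meas_sup _ _ fun r => meas_sup _ _ fun e => ?_
  exact Measurable.const_mul (Measurable.nnnorm ((h _).sub (h _))) _

lemma Dn_cases (v : EE d) (s : ℝ) (M j : ℕ) (c : Fin d → ℕ) (φ : EE d → ℝ) (h1 : 0 < Dn v s M j c φ) :
    ∃ r ∈ Finset.range M, ∃ e ∈ Cub (r+1) c, Dn v s M j c φ = kap ^ r * ‖φ (pt v s (j + r + 1) e) - φ (pt v s (j + r) (hf e))‖₊ := by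
  have hM : (Finset.range M).Nonempty := by
    by_contra hne
    rw [Finset.not_nonempty_iff_eq_empty] at hne
    simp [Dn, hne] at h1
  obtain ⟨r, hr, hr2⟩ := Finset.exists_mem_eq_sup (Finset.range M) hM (fun r => (Cub (r+1) c).sup fun e =>
    kap ^ r * ‖φ (pt v s (j + r + 1) e) - φ (pt v s (j + r) (hf e))‖₊)
  have hC : (Cub (r+1) c).Nonempty := by
    rw [← Finset.card_pos, card_Cub]; positivity
  obtain ⟨e, he, he2⟩ := Finset.exists_mem_eq_sup (Cub (r+1) c) hC (fun e =>
    kap ^ r * ‖φ (pt v s (j + r + 1) e) - φ (pt v s (j + r) (hf e))‖₊)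
  exact ⟨r, hr, e, he, by rw [Dn, hr2, he2]⟩

end DM

set_option linter.unusedSectionVars false
set_option linter.unusedVariables false

namespace DM

variable {d : ℕ} {Ω : Type*} [m0 : MeasurableSpace Ω]

lemma gauss_exp' {P : Measure Ω} {v : NNReal} {Z : Ω → ℝ} (hZ : Measurable Z)
    (h : Measure.map Z P = gaussianReal 0 v) (β : ℝ) :
    ∫⁻ ω, ENNReal.ofReal (Real.exp (β * Z ω)) ∂P = ENNReal.ofReal (Real.exp (β ^ 2 * v / 2)) := by
  have e : ∫⁻ ω, ENNReal.ofReal (Real.exp (β * Z ω)) ∂P = ∫⁻ z, ENNReal.ofReal (Real.exp (β * z)) ∂(Measure.map Z P) := by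
    rw [lintegral_map (by fun_prop) hZ]
  rw [e, h]
  by_cases hv : v = 0
  · subst hv; simp
  · exact gauss_exp hv β

def momC (d : ℕ) (b L' : ℝ) : ℝ := (4 * (d+1)).factorial * (2 * Real.exp ((b+1)^2 * L' / 2))

lemma momC_nonneg (d : ℕ) (b L' : ℝ) : 0 ≤ momC d b L' := by unfold momC; positivity

lemma edge_mom {P : Measure Ω} {v : NNReal} {Z : Ω → ℝ} (hZ : Measurable Z)
    (h : Measure.map Z P = gaussianReal 0 v) {b L' : ℝ} (hb : 0 ≤ b) (r : ℕ) (hv : (v:ℝ) ≤ L' / 2 ^ r) :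
    ∫⁻ ω, ENNReal.ofReal ((kap ^ r * |Z ω|) ^ (4 * (d+1)) * Real.exp (b * (kap ^ r * |Z ω|))) ∂P ≤
      ENNReal.ofReal (momC d b L' / 2 ^ (r * (d+1))) := by
  set n := 4 * (d+1) with hn
  have k1 : (1:ℝ) ≤ (kap:ℝ) ^ r := one_le_pow₀ (by exact_mod_cast one_lt_kap.le)
  have kn : ((kap:ℝ) ^ r) ^ n = 2 ^ (r * (d+1)) := by
    rw [hn, ← pow_mul, pow_mul 2 r, ← kap_four', ← pow_mul, ← pow_mul]; ring_nf
  set c : ℝ := (b+1) * ((kap:ℝ)^r)^2 with hc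
  have key : ∀ ω, (kap ^ r * |Z ω|) ^ n * Real.exp (b * (kap ^ r * |Z ω|)) ≤
     (n.factorial / 2 ^ (r * (d+1))) * (Real.exp (c * Z ω) + Real.exp (-c * Z ω)) := by
    intro ω
    set u := (kap:ℝ) ^ r * |Z ω| with hu
    have u0 : 0 ≤ u := by positivity
    have h1 : ((kap:ℝ)^r * u) ^ n ≤ n.factorial * Real.exp ((kap:ℝ)^r * u) := by
      have := Real.pow_div_factorial_le_exp ((kap:ℝ)^r * u) (by positivity) n
      rwa [div_le_iff₀' (by positivity)] at this
    rw [mul_pow, kn] at h1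
    have h2 : Real.exp (b * u) ≤ Real.exp (b * ((kap:ℝ)^r * u)) := by
      apply Real.exp_le_exp.2
      apply mul_le_mul_of_nonneg_left _ hb
      nlinarith
    have h3 : u ^ n ≤ n.factorial / 2 ^ (r * (d+1)) * Real.exp ((kap:ℝ)^r * u) := by
      rw [div_mul_eq_mul_div, le_div_iff₀ (by positivity)]
      linarith
    have h4 : Real.exp ((kap:ℝ)^r * u) * Real.exp (b * ((kap:ℝ)^r * u)) = Real.exp (c * |Z ω|) := by
      rw [← Real.exp_add, hu, hc]; ring_nf
    have h5 : Real.exp (c * |Z ω|) ≤ Real.exp (c * Z ω) + Real.exp (-c * Z ω) := by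
      rcases abs_cases (Z ω) with h | h
      · rw [h.1]; linarith [Real.exp_pos (-c * Z ω)]
      · rw [h.1]
        have : c * -Z ω = -c * Z ω := by ring
        rw [this]; linarith [Real.exp_pos (c * Z ω)]
    calc u ^ n * Real.exp (b * u) ≤ (n.factorial / 2 ^ (r * (d+1)) * Real.exp ((kap:ℝ)^r * u)) * Real.exp (b * ((kap:ℝ)^r * u)) := by
          gcongr
      _ = n.factorial / 2 ^ (r * (d+1)) * Real.exp (c * |Z ω|) := by rw [mul_assoc, h4]
      _ ≤ _ := by gcongr
  refine (lintegral_mono fun ω => ENNReal.ofReal_le_ofReal (key ω)).trans ?_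
  have e : ∀ ω, ENNReal.ofReal ((n.factorial / 2 ^ (r * (d+1))) * (Real.exp (c * Z ω) + Real.exp (-c * Z ω))) =
    ENNReal.ofReal (n.factorial / 2 ^ (r * (d+1))) * (ENNReal.ofReal (Real.exp (c * Z ω)) + ENNReal.ofReal (Real.exp (-c * Z ω))) := by
    intro ω
    rw [ENNReal.ofReal_mul (by positivity), ENNReal.ofReal_add (by positivity) (by positivity)]
  simp_rw [e]
  rw [lintegral_const_mul _ (by fun_prop), lintegral_add_left (by fun_prop), gauss_exp' hZ h, gauss_exp' hZ h,
    ← ENNReal.ofReal_add (by positivity) (by positivity), ← ENNReal.ofReal_mul (by positivity)]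
  apply ENNReal.ofReal_le_ofReal
  have h6 : c ^ 2 * v / 2 ≤ (b+1)^2 * L' / 2 := by
    have : c ^ 2 = (b+1)^2 * 2 ^ r := by
      rw [hc, mul_pow, ← kap_four', ← pow_mul, ← pow_mul]; ring_nf
    rw [this]
    have : (2:ℝ) ^ r * v ≤ L' := by rwa [le_div_iff₀' (by positivity)] at hv
    have : (b+1)^2 * (2 ^ r * (v:ℝ)) ≤ (b+1)^2 * L' := by gcongr
    linarith
  rw [neg_sq, momC, ← hn]
  have := Real.exp_le_exp.2 h6
  rw [div_mul_eq_mul_div]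
  gcongr
  linarith

def Hc (d : ℕ) (b L' : ℝ) : ℝ := Real.exp b + 2 ^ (d+1) * momC d b L'

lemma hmom {P : Measure Ω} {X : ℝ → EE d → Ω → ℝ} {L R : ℝ} (h : Setup P X L R) (v : EE d) {s : ℝ} (hs : 0 ≤ s)
    (M i : ℕ) (c : Fin d → ℕ) {b : ℝ} (hb : 0 ≤ b) :
    ∫⁻ ω, ENNReal.ofReal (Real.exp (b * Dn v s M (i+1) c (fun x => X (tt (i+1)) x ω - X (tt i) x ω))) ∂P ≤
      ENNReal.ofReal (Hc d b (L * d * s)) := by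
  have := h.prob
  let Z : ℕ → (Fin d → ℕ) → Ω → ℝ := fun r e ω =>
    (X (tt (i+1)) (pt v s (i + 1 + r + 1) e) ω - X (tt i) (pt v s (i + 1 + r + 1) e) ω) -
    (X (tt (i+1)) (pt v s (i + 1 + r) (hf e)) ω - X (tt i) (pt v s (i + 1 + r) (hf e)) ω)
  have hZm : ∀ r e, Measurable (Z r e) := fun r e =>
    ((h.meas _ _).sub (h.meas _ _)).sub ((h.meas _ _).sub (h.meas _ _))
  set n := 4 * (d+1) with hn
  have key : ∀ ω, ENNReal.ofReal (Real.exp (b * Dn v s M (i+1) c (fun x => X (tt (i+1)) x ω - X (tt i) x ω))) ≤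
      ENNReal.ofReal (Real.exp b) + ∑ r ∈ Finset.range M, ∑ e ∈ Cub (r+1) c,
        ENNReal.ofReal ((kap ^ r * |Z r e ω|) ^ n * Real.exp (b * (kap ^ r * |Z r e ω|))) := by
    intro ω
    by_cases h1 : Dn v s M (i+1) c (fun x => X (tt (i+1)) x ω - X (tt i) x ω) ≤ 1
    · refine le_trans (ENNReal.ofReal_le_ofReal (Real.exp_le_exp.2 ?_)) le_self_add
      exact mul_le_of_le_one_right hb (by exact_mod_cast h1)
    · push Not at h1
      obtain ⟨r, hr, e, he, hD⟩ := Dn_cases v s M (i+1) c (fun x => X (tt (i+1)) x ω - X (tt i) x ω) (zero_lt_one.trans h1)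
      have hD' : ((Dn v s M (i+1) c (fun x => X (tt (i+1)) x ω - X (tt i) x ω) : NNReal) : ℝ) = kap ^ r * |Z r e ω| := by
        rw [hD]; simp [Z]
      have h1' : (1:ℝ) ≤ kap ^ r * |Z r e ω| := by rw [← hD']; exact_mod_cast h1.le
      rw [hD']
      have s1 := Finset.single_le_sum (f := fun e => ENNReal.ofReal ((kap ^ r * |Z r e ω|) ^ n * Real.exp (b * (kap ^ r * |Z r e ω|)))) (fun _ _ => zero_le) he
      have s2 := Finset.single_le_sum (f := fun r => ∑ e ∈ Cub (r+1) c, ENNReal.ofReal ((kap ^ r * |Z r e ω|) ^ n * Real.exp (b * (kap ^ r * |Z r e ω|)))) (fun _ _ => zero_le) hr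
      refine le_trans (le_trans (ENNReal.ofReal_le_ofReal ?_) (s1.trans s2)) le_add_self
      exact le_mul_of_one_le_left (Real.exp_nonneg _) (one_le_pow₀ h1')
  refine (lintegral_mono key).trans ?_
  have mz : ∀ r e, Measurable fun ω => ENNReal.ofReal ((kap ^ r * |Z r e ω|) ^ n * Real.exp (b * (kap ^ r * |Z r e ω|))) := by
    intro r e; have := hZm r e; fun_prop
  rw [lintegral_add_left measurable_const, lintegral_finsetSum _ (fun r _ => Finset.measurable_fun_sum _ fun e _ => mz r e)]
  simp_rw [lintegral_finsetSum _ (fun e _ => mz _ e)]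
  simp only [lintegral_const, measure_univ, mul_one]
  have bd : ∀ r e, ∫⁻ ω, ENNReal.ofReal ((kap ^ r * |Z r e ω|) ^ n * Real.exp (b * (kap ^ r * |Z r e ω|))) ∂P ≤
     ENNReal.ofReal (momC d b (L * d * s) / 2 ^ (r * (d+1))) := by
    intro r e
    obtain ⟨w, hw1, hw2⟩ := h.edge (tt i) (tt (i+1)) (tt_nonneg i) (tt_lt_succ i) (pt v s (i + 1 + r + 1) e) (pt v s (i + 1 + r) (hf e))
    apply edge_mom (hZm r e) hw2 hb
    refine hw1.trans ?_
    have h1 := norm_edge v hs (i+1+r) e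
    calc _ ≤ L * Real.exp (tt (i+1)) * (d * (s / 2 ^ (i+1+r+1))) := by
          have := h.Lpos
          gcongr
      _ = (L * d * s / 2 ^ r) * (1/2) := by
          rw [exp_tt, pow_succ 2 (i+1+r), pow_add 2 (i+1) r]; field_simp
      _ ≤ _ := by
          have := h.Lpos
          have : 0 ≤ L * d * s / 2 ^ r := by positivity
          linarith
  have m0' := momC_nonneg d b (L * d * s)
  have sm : ∑ r ∈ Finset.range M, ∑ e ∈ Cub (r+1) c, ∫⁻ ω, ENNReal.ofReal ((kap ^ r * |Z r e ω|) ^ n * Real.exp (b * (kap ^ r * |Z r e ω|))) ∂P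
     ≤ ENNReal.ofReal (2 ^ (d+1) * momC d b (L * d * s)) := by
    calc _ ≤ ∑ r ∈ Finset.range M, ∑ e ∈ Cub (r+1) c, ENNReal.ofReal (momC d b (L * d * s) / 2 ^ (r * (d+1))) :=
          Finset.sum_le_sum fun r _ => Finset.sum_le_sum fun e _ => bd r e
      _ = ∑ r ∈ Finset.range M, ENNReal.ofReal (2 ^ d * momC d b (L * d * s) * (1/2)^r) := by
          apply Finset.sum_congr rfl
          intro r _
          rw [Finset.sum_const, card_Cub, nsmul_eq_mul, ← ENNReal.ofReal_natCast, ← ENNReal.ofReal_mul (by positivity)]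
          congr 1
          push_cast
          rw [← pow_mul, add_mul, pow_add, mul_add, pow_add]
          simp only [one_mul, mul_one, one_div, inv_pow]
          field_simp
      _ = ENNReal.ofReal (∑ r ∈ Finset.range M, 2 ^ d * momC d b (L * d * s) * (1/2)^r) := by
          rw [ENNReal.ofReal_sum_of_nonneg]; intro r _; positivity
      _ ≤ _ := by
          apply ENNReal.ofReal_le_ofReal
          rw [← Finset.mul_sum]
          have g : ∑ r ∈ Finset.range M, (1/2:ℝ)^r ≤ 2 := by
            have := sum_le_hasSum (Finset.range M) (fun i _ => by positivity) hasSum_geometric_two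
            simpa using this
          calc _ ≤ 2 ^ d * momC d b (L * d * s) * 2 := by gcongr
            _ = _ := by rw [pow_succ]; ring
  rw [Hc, ENNReal.ofReal_add (by positivity) (by positivity)]
  gcongr

/-- survival strictly before `n`. -/
def sb (X : ℝ → EE d → Ω → ℝ) (q : ℝ) (n : ℕ) (x : EE d) : Set Ω :=
  {ω | ∀ i < n, 0 ≤ Yq X q (tt i) x ω}

lemma sb_succ (X : ℝ → EE d → Ω → ℝ) (q : ℝ) (n : ℕ) (x : EE d) : sb X q (n+1) x = surv X q n x := by
  ext ω; simp [sb, surv, Nat.lt_succ_iff]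

lemma meas_sb {P : Measure Ω} {X : ℝ → EE d → Ω → ℝ} {L R : ℝ} (h : Setup P X L R) (q : ℝ) (n : ℕ) (x : EE d) :
    MeasurableSet (sb X q n x) := by
  cases n with
  | zero => simp [sb]
  | succ n => rw [sb_succ]; exact meas_surv h q n x

def wE (P : Measure Ω) (X : ℝ → EE d → Ω → ℝ) (q θ a : ℝ) (v : EE d) (s : ℝ) (M j : ℕ) (c : Fin d → ℕ) (y : EE d) : ENNReal :=
  ∫⁻ ω in sb X q j y, ENNReal.ofReal (wt X (tt j) y ω * Real.exp (-θ * Yq X q (tt j) y ω) *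
    Real.exp (a * Dn v s M j c (fun x => X (tt j) x ω))) ∂P

lemma exp_interp {a ρ ε D : ℝ} (hρ : ρ < 1) (hρ0 : 0 ≤ ρ) (hε : 0 < ε) :
    Real.exp (ρ * D) ≤ ε * Real.exp D + Real.exp (|Real.log ε| / (1 - ρ)) := by
  have h1 : 0 < 1 - ρ := by linarith
  by_cases h : D ≤ |Real.log ε| / (1 - ρ)
  · have : Real.exp (ρ * D) ≤ Real.exp (|Real.log ε| / (1 - ρ)) := by
      apply Real.exp_le_exp.2
      have h2 : 0 ≤ |Real.log ε| / (1 - ρ) := by positivity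
      calc ρ * D ≤ ρ * (|Real.log ε| / (1 - ρ)) := by gcongr
        _ ≤ _ := mul_le_of_le_one_left h2 hρ.le
    have := Real.exp_pos D
    nlinarith
  · push Not at h
    rw [div_lt_iff₀ h1] at h
    have h3 : - |Real.log ε| ≤ Real.log ε := neg_abs_le _
    have : Real.exp (ρ * D) ≤ ε * Real.exp D := by
      have e9 : ε * Real.exp D = Real.exp (Real.log ε + D) := by rw [Real.exp_add, Real.exp_log hε]
      rw [e9]
      apply Real.exp_le_exp.2
      nlinarith
    have := Real.exp_pos (|Real.log ε| / (1 - ρ))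
    linarith

def ChC (d : ℕ) (θ a L' : ℝ) : ℝ := Real.exp ((2 * (gam d + θ))^2 * Real.log 2 / 2) + Hc d (2 * a) L'

lemma ChC_pos (d : ℕ) (θ a L' : ℝ) : 0 < ChC d θ a L' := by
  have := momC_nonneg d (2*a) L'
  unfold ChC Hc; positivity

def CeC (d : ℕ) (θ a L' : ℝ) : ℝ :=
  Real.exp (|Real.log (1 / (2 * ChC d θ a L'))| / (1 - (kap:ℝ)⁻¹))

lemma wE_rec {P : Measure Ω} {X : ℝ → EE d → Ω → ℝ} {L R : ℝ} (h : Setup P X L R) (q : ℝ) {θ a : ℝ} (hθ : 0 ≤ θ) (ha : 0 ≤ a)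
    (v : EE d) {s : ℝ} (hs : 0 ≤ s) (M i : ℕ) (c : Fin d → ℕ) (y : EE d) :
    wE P X q θ a v s M (i+1) c y ≤ ENNReal.ofReal (1/2) * wE P X q θ a v s (M+1) i (hf c) y +
      ENNReal.ofReal (ChC d θ a (L*d*s) * CeC d θ a (L*d*s)) * ggE P X q θ i y := by
  have hP := h.prob
  set Ch := ChC d θ a (L*d*s) with hCh
  have Ch0 : 0 < Ch := ChC_pos _ _ _ _
  set Ce := CeC d θ a (L*d*s) with hCe
  have Ce0 : 0 < Ce := Real.exp_pos _
  let A : Ω → ℝ := fun ω => wt X (tt i) y ω * Real.exp (-θ * Yq X q (tt i) y ω) *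
    Real.exp ((kap:ℝ)⁻¹ * (a * Dn v s (M+1) i (hf c) (fun x => X (tt i) x ω)))
  let B : Ω → ℝ := fun ω => Real.exp ((gam d + θ) * (X (tt (i+1)) y ω - X (tt i) y ω)) *
    Real.exp (a * Dn v s M (i+1) c (fun x => X (tt (i+1)) x ω - X (tt i) x ω))
  have hA0 : ∀ ω, 0 ≤ A ω := fun ω => by have := wt_pos X (tt i) y ω; positivity
  have hB0 : ∀ ω, 0 ≤ B ω := fun ω => by positivity
  have key : ∀ ω, wt X (tt (i+1)) y ω * Real.exp (-θ * Yq X q (tt (i+1)) y ω) *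
      Real.exp (a * Dn v s M (i+1) c (fun x => X (tt (i+1)) x ω)) ≤ A ω * B ω := by
    intro ω
    have h1 : ((Dn v s M (i+1) c (fun x => X (tt (i+1)) x ω) : NNReal) : ℝ) ≤
       (kap:ℝ)⁻¹ * Dn v s (M+1) i (hf c) (fun x => X (tt i) x ω) + Dn v s M (i+1) c (fun x => X (tt (i+1)) x ω - X (tt i) x ω) := by
      have e1 := Dn_add v s M (i+1) c (fun x => X (tt i) x ω) (fun x => X (tt (i+1)) x ω - X (tt i) x ω)
      simp only [add_sub_cancel] at e1
      have e2 := Dn_child v s M i c (fun x => X (tt i) x ω)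
      have e3 := e1.trans (add_le_add_left e2 _)
      exact_mod_cast e3
    have h2 := mul_le_mul_of_nonneg_left h1 ha
    simp only [A, B, wt]
    rw [Yq_step X q (tt i) (tt (i+1)), ← Real.exp_add, ← Real.exp_add, ← Real.exp_add, ← Real.exp_add, ← Real.exp_add, ← Real.exp_add]
    apply Real.exp_le_exp.2
    rw [tt_sub]
    have ed : (d:ℝ) * tt (i+1) = d * tt i + d * Real.log 2 := by rw [tt_succ]; ring
    have l0 := ell_pos
    have g0 := gam_nonneg d
    have : 0 ≤ θ * (gam d * Real.log 2) := by positivity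
    have : 0 ≤ (d:ℝ) * Real.log 2 := by positivity
    nlinarith
  have mS := meas_surv_Fil X q i le_rfl y
  have mS' := meas_surv h q i y
  have mA : Measurable[Fil X (tt i)] A := by
    have m1 := meas_wt_Fil X (tt_nonneg i) le_rfl y
    have m2 := meas_Yq_Fil X q (tt_nonneg i) le_rfl y
    have m3 := meas_Dn v s (M+1) i (hf c) (X (tt i)) (fun x => meas_Fil X (tt_nonneg i) le_rfl x)
    exact ((m1.mul (Real.measurable_exp.comp (m2.const_mul _))).mul (Real.measurable_exp.comp ((m3.coe_nnreal_real.const_mul _).const_mul _)))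
  have mB : Measurable[Inc X (tt i) (tt (i+1))] B := by
    have m1 := meas_Inc X (tt i) (tt (i+1)) y
    have m3 := meas_Dn v s M (i+1) c (fun x ω => X (tt (i+1)) x ω - X (tt i) x ω) (fun x => meas_Inc X (tt i) (tt (i+1)) x)
    exact (Real.measurable_exp.comp (m1.const_mul _)).mul (Real.measurable_exp.comp (m3.coe_nnreal_real.const_mul _))
  have EB : ∫⁻ ω, ENNReal.ofReal (B ω) ∂P ≤ ENNReal.ofReal Ch := by
    have e1 : ∀ ω, ENNReal.ofReal (B ω) ≤ ENNReal.ofReal (Real.exp (2 * (gam d + θ) * (X (tt (i+1)) y ω - X (tt i) y ω))) +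
       ENNReal.ofReal (Real.exp (2 * a * Dn v s M (i+1) c (fun x => X (tt (i+1)) x ω - X (tt i) x ω))) := by
      intro ω
      rw [← ENNReal.ofReal_add (by positivity) (by positivity)]
      apply ENNReal.ofReal_le_ofReal
      simp only [B]
      set p := Real.exp ((gam d + θ) * (X (tt (i+1)) y ω - X (tt i) y ω)) with hp
      set r := Real.exp (a * Dn v s M (i+1) c (fun x => X (tt (i+1)) x ω - X (tt i) x ω)) with hr
      have e2 : Real.exp (2 * (gam d + θ) * (X (tt (i+1)) y ω - X (tt i) y ω)) = p * p := by
        rw [hp, ← Real.exp_add]; ring_nf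
      have e3 : Real.exp (2 * a * Dn v s M (i+1) c (fun x => X (tt (i+1)) x ω - X (tt i) x ω)) = r * r := by
        rw [hr, ← Real.exp_add]; ring_nf
      rw [e2, e3]
      nlinarith [sq_nonneg (p - r), sq_nonneg p, sq_nonneg r]
    have mm : Measurable fun ω => X (tt (i+1)) y ω - X (tt i) y ω := (h.meas _ _).sub (h.meas _ _)
    refine (lintegral_mono e1).trans ?_
    rw [lintegral_add_left (by fun_prop), gauss_exp' mm (h.law _ _ (tt_nonneg i) (tt_lt_succ i) y), hCh, ChC, ENNReal.ofReal_add (by positivity)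
      (by have := momC_nonneg d (2*a) (L*d*s); unfold Hc; positivity)]
    gcongr
    · rw [tt_sub, Real.coe_toNNReal _ ell_pos.le]
    · exact hmom h v hs M i c (by positivity)
  have EA : ∫⁻ ω in surv X q i y, ENNReal.ofReal (A ω) ∂P ≤
      ENNReal.ofReal (1 / (2 * Ch)) * wE P X q θ a v s (M+1) i (hf c) y + ENNReal.ofReal Ce * ggE P X q θ i y := by
    have hsub : surv X q i y ⊆ sb X q i y := fun ω hω j hj => hω j hj.le
    have mD := meas_Dn v s (M+1) i (hf c) (X (tt i)) (fun x => h.meas (tt i) x)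
    have mw := meas_wt h (tt i) y
    have mY := meas_Yq h q (tt i) y
    calc _ ≤ ∫⁻ ω in surv X q i y, (ENNReal.ofReal (1 / (2 * Ch)) * ENNReal.ofReal (wt X (tt i) y ω * Real.exp (-θ * Yq X q (tt i) y ω) *
            Real.exp (a * Dn v s (M+1) i (hf c) (fun x => X (tt i) x ω))) + ENNReal.ofReal Ce * (ENNReal.ofReal (wt X (tt i) y ω) * ENNReal.ofReal (Real.exp (-θ * Yq X q (tt i) y ω)))) ∂P := by
          apply lintegral_mono
          intro ω
          have w0 := wt_pos X (tt i) y ω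
          simp only
          rw [← ENNReal.ofReal_mul w0.le, ← ENNReal.ofReal_mul (by positivity), ← ENNReal.ofReal_mul (by positivity), ← ENNReal.ofReal_add (by positivity) (by positivity)]
          apply ENNReal.ofReal_le_ofReal
          have := exp_interp (a := 0) (ρ := (kap:ℝ)⁻¹) (ε := 1 / (2 * Ch)) (D := a * Dn v s (M+1) i (hf c) (fun x => X (tt i) x ω))
            (by exact_mod_cast kap_inv_lt) (by positivity) (by positivity)
          simp only [A]
          calc _ ≤ wt X (tt i) y ω * Real.exp (-θ * Yq X q (tt i) y ω) * (1 / (2 * Ch) * Real.exp (a * Dn v s (M+1) i (hf c) (fun x => X (tt i) x ω)) + Ce) := by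
                gcongr
                exact this
            _ = _ := by ring
      _ = ENNReal.ofReal (1 / (2 * Ch)) * (∫⁻ ω in surv X q i y, ENNReal.ofReal (wt X (tt i) y ω * Real.exp (-θ * Yq X q (tt i) y ω) *
            Real.exp (a * Dn v s (M+1) i (hf c) (fun x => X (tt i) x ω))) ∂P) + ENNReal.ofReal Ce * ggE P X q θ i y := by
          rw [lintegral_add_left (by fun_prop), lintegral_const_mul _ (by fun_prop), lintegral_const_mul _ (by fun_prop)]; rfl
      _ ≤ _ := by
          gcongr
          exact lintegral_mono_set hsub
  unfold wE
  rw [sb_succ]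
  calc _ ≤ ∫⁻ ω in surv X q i y, ENNReal.ofReal (A ω) * ENNReal.ofReal (B ω) ∂P := by
        apply lintegral_mono; intro ω
        simp only
        rw [← ENNReal.ofReal_mul (hA0 ω)]
        exact ENNReal.ofReal_le_ofReal (key ω)
    _ = ∫⁻ ω, (surv X q i y).indicator (fun ω => ENNReal.ofReal (A ω)) ω * ENNReal.ofReal (B ω) ∂P := by
        rw [← lintegral_indicator mS']
        congr 1; ext ω
        by_cases hω : ω ∈ surv X q i y <;> simp [hω]
    _ = (∫⁻ ω, (surv X q i y).indicator (fun ω => ENNReal.ofReal (A ω)) ω ∂P) * ∫⁻ ω, ENNReal.ofReal (B ω) ∂P := by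
        apply lintegral_mul_eq_lintegral_mul_lintegral_of_independent_measurableSpace (Fil_le h.meas _) (Inc_le h.meas _ _)
          (h.indep _ _ (tt_nonneg i) (tt_lt_succ i)).symm
        · exact (ENNReal.measurable_ofReal.comp mA).indicator mS
        · exact ENNReal.measurable_ofReal.comp mB
    _ ≤ (ENNReal.ofReal (1 / (2 * Ch)) * wE P X q θ a v s (M+1) i (hf c) y + ENNReal.ofReal Ce * ggE P X q θ i y) * ENNReal.ofReal Ch := by
        rw [lintegral_indicator mS']
        gcongr
    _ = _ := by
        rw [add_mul, mul_right_comm, ← ENNReal.ofReal_mul (by positivity), mul_right_comm (ENNReal.ofReal Ce), ← ENNReal.ofReal_mul (by positivity)]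
        congr 3
        · field_simp
        · ring

end DM

set_option linter.unusedSectionVars false
set_option linter.unusedVariables false

namespace DM

variable {d : ℕ} {Ω : Type*} [m0 : MeasurableSpace Ω]

lemma surv_law {P : Measure Ω} {X : ℝ → EE d → Ω → ℝ} {L R : ℝ} (h : Setup P X L R) (q : ℝ) (n : ℕ) :
    ∀ {F : ℝ → ENNReal} (hF : Measurable F) (x y : EE d),
    ∫⁻ ω in surv X q n x, ENNReal.ofReal (wt X (tt n) x ω) * F (Yq X q (tt n) x ω) ∂P =
    ∫⁻ ω in surv X q n y, ENNReal.ofReal (wt X (tt n) y ω) * F (Yq X q (tt n) y ω) ∂P := by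
  induction n with
  | zero =>
    intro F hF x y
    rw [← lintegral_indicator (meas_surv h q 0 x), ← lintegral_indicator (meas_surv h q 0 y)]
    apply lintegral_congr_ae
    filter_upwards [h.zero x, h.zero y] with ω h1 h2
    simp [Set.indicator, surv, Yq, wt, tt_zero, h1, h2]
  | succ n ih =>
    intro F hF x y
    have key : ∀ x, ∫⁻ ω in surv X q (n+1) x, ENNReal.ofReal (wt X (tt (n+1)) x ω) * F (Yq X q (tt (n+1)) x ω) ∂P =
       ∫⁻ ω in surv X q n x, ENNReal.ofReal (wt X (tt n) x ω) *
        ∫⁻ z, (Set.Ici (0:ℝ)).indicator F (Yq X q (tt n) x ω + z) ∂(gaussianReal 0 (tt (n+1) - tt n).toNNReal) ∂P := by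
      intro x
      rw [← step1 h q (tt_nonneg n) (tt_lt_succ n) x (meas_surv_Fil X q n le_rfl x) (hF.indicator measurableSet_Ici),
        ← lintegral_indicator (meas_surv h q (n+1) x), ← lintegral_indicator (meas_surv h q n x)]
      congr 1
      ext ω
      rw [surv_succ]
      by_cases h1 : ω ∈ surv X q n x <;> by_cases h2 : 0 ≤ Yq X q (tt (n+1)) x ω <;> simp [Set.indicator, h1, h2]
    rw [key x, key y]
    have mG : Measurable fun u : ℝ => ∫⁻ z, (Set.Ici (0:ℝ)).indicator F (u + z) ∂(gaussianReal 0 (tt (n+1) - tt n).toNNReal) := by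
      apply Measurable.lintegral_prod_right'  (f := fun p : ℝ × ℝ => (Set.Ici (0:ℝ)).indicator F (p.1 + p.2))
      exact (hF.indicator measurableSet_Ici).comp (measurable_fst.add measurable_snd)
    exact ih mG x y

lemma ggE_const {P : Measure Ω} {X : ℝ → EE d → Ω → ℝ} {L R : ℝ} (h : Setup P X L R) (q θ : ℝ) (n : ℕ) (x : EE d) :
    ggE P X q θ n x = ggE P X q θ n 0 :=
  surv_law h q n (F := fun u => ENNReal.ofReal (Real.exp (-θ * u))) (by fun_prop) x 0

lemma gg_const {P : Measure Ω} {X : ℝ → EE d → Ω → ℝ} {L R : ℝ} (h : Setup P X L R) (q θ : ℝ) (n : ℕ) (x : EE d) :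
    gg P X q θ n x = gg P X q θ n 0 := by unfold gg; rw [ggE_const h]

def uu (K : ℝ) (g : ℕ → ℝ) : ℕ → ℝ
  | 0 => 1
  | n+1 => 1/2 * uu K g n + K * g n

lemma uu_nonneg {K : ℝ} (hK : 0 ≤ K) {g : ℕ → ℝ} (hg : ∀ n, 0 ≤ g n) (n : ℕ) : 0 ≤ uu K g n := by
  induction n with
  | zero => simp [uu]
  | succ n ih => have := hg n; simp only [uu]; positivity

lemma uu_sum {K : ℝ} (hK : 0 ≤ K) {g : ℕ → ℝ} (hg : ∀ n, 0 ≤ g n) {C : ℝ} (hC : ∀ N, ∑ n ∈ Finset.range N, g n ≤ C) (N : ℕ) :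
    ∑ n ∈ Finset.range N, uu K g n ≤ 2 + 2 * (K * C) := by
  have h1 : ∑ n ∈ Finset.range (N+1), uu K g n = 1 + (1/2 * ∑ n ∈ Finset.range N, uu K g n + K * ∑ n ∈ Finset.range N, g n) := by
    rw [Finset.sum_range_succ']
    simp only [uu]
    rw [Finset.sum_add_distrib, Finset.mul_sum, Finset.mul_sum]; ring
  have h2 : ∑ n ∈ Finset.range N, uu K g n ≤ ∑ n ∈ Finset.range (N+1), uu K g n := by
    rw [Finset.sum_range_succ]; linarith [uu_nonneg hK hg N]
  have h3 := mul_le_mul_of_nonneg_left (hC N) hK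
  linarith

lemma wE_le {P : Measure Ω} {X : ℝ → EE d → Ω → ℝ} {L R : ℝ} (h : Setup P X L R) {q : ℝ} (hq : 0 ≤ q) {θ a : ℝ} (hθ : 0 ≤ θ) (ha : 0 ≤ a)
    (v : EE d) {s : ℝ} (hs : 0 ≤ s) (i : ℕ) : ∀ (M : ℕ) (c : Fin d → ℕ) (y : EE d),
    wE P X q θ a v s M i c y ≤ ENNReal.ofReal (uu (ChC d θ a (L*d*s) * CeC d θ a (L*d*s)) (fun n => gg P X q θ n 0) i) := by
  have K0 : 0 ≤ ChC d θ a (L*d*s) * CeC d θ a (L*d*s) := mul_nonneg (ChC_pos _ _ _ _).le (Real.exp_pos _).le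
  induction i with
  | zero =>
    intro M c y
    have := h.prob
    have hz : ∀ᵐ ω ∂P, ∀ r ∈ Finset.range M, ∀ e ∈ Cub (r+1) c, X 0 (pt v s (0 + r + 1) e) ω = 0 ∧ X 0 (pt v s (0 + r) (hf e)) ω = 0 := by
      rw [eventually_all_finset]; intro r hr
      rw [eventually_all_finset]; intro e he
      exact (h.zero _).and (h.zero _)
    unfold wE
    calc _ ≤ ∫⁻ ω in sb X q 0 y, 1 ∂P := by
          apply lintegral_mono_ae
          apply ae_restrict_of_ae
          filter_upwards [hz, h.zero y] with ω h1 h2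
          have h3 : Dn v s M 0 c (fun x => X (tt 0) x ω) = 0 := by
            rw [← nonpos_iff_eq_zero]
            refine Finset.sup_le fun r hr => Finset.sup_le fun e he => ?_
            simp only [tt_zero]
            rw [(h1 r hr e he).1, (h1 r hr e he).2]; simp
          rw [h3, ← ENNReal.ofReal_one]
          apply ENNReal.ofReal_le_ofReal
          simp [wt, Yq, tt_zero, h2]
          positivity
      _ ≤ _ := by
          rw [setLIntegral_one]; simp [uu]; exact prob_le_one
  | succ i ih =>
    intro M c y
    refine (wE_rec h q hθ ha v hs M i c y).trans ?_
    have u0 := uu_nonneg K0 (fun n => gg_nonneg P X q θ n 0) i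
    simp only [uu]
    rw [ENNReal.ofReal_add (by positivity) (mul_nonneg K0 (gg_nonneg _ _ _ _ _ _)), ENNReal.ofReal_mul (p := 1/2) (by norm_num), ENNReal.ofReal_mul K0,
      ← ggE_eq h q hθ, ggE_const h]
    gcongr
    exact ih _ _ _

def Bad (X : ℝ → EE d → Ω → ℝ) (q : ℝ) (v : EE d) (s : ℝ) (N : ℕ) : Set Ω :=
  {ω | ∃ j ≤ N, ∃ e ∈ Cub N (0 : Fin d → ℕ), Yq X q (tt j) (pt v s N e) ω < 0}

def aC (d : ℕ) : ℝ := (gam d + 1) * Ck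

lemma aC_nonneg (d : ℕ) : 0 ≤ aC d := by have := gam_nonneg d; unfold aC; positivity

def badA (X : ℝ → EE d → Ω → ℝ) (q : ℝ) (v : EE d) (s : ℝ) (N j : ℕ) (c : Fin d → ℕ) : Set Ω :=
  sb X q j (pt v s j c) ∩ {ω | Yq X q (tt j) (pt v s j c) ω < Ck * Dn v s (N - j) j c (fun x => X (tt j) x ω)}

lemma bad_sub (X : ℝ → EE d → Ω → ℝ) (q : ℝ) (v : EE d) (s : ℝ) (N : ℕ) :
    Bad X q v s N ⊆ ⋃ j ∈ Finset.range (N+1), ⋃ c ∈ Cub j (0 : Fin d → ℕ), badA X q v s N j c := by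
  classical
  rintro ω ⟨j0, hj0, e0, he0, hY0⟩
  have hex : ∃ j, ∃ e ∈ Cub N (0 : Fin d → ℕ), Yq X q (tt j) (pt v s N e) ω < 0 := ⟨j0, e0, he0, hY0⟩
  obtain ⟨e, he, hY⟩ := Nat.find_spec hex
  have hmin : ∀ i < Nat.find hex, ∀ e ∈ Cub N (0 : Fin d → ℕ), 0 ≤ Yq X q (tt i) (pt v s N e) ω := by
    intro i hi e he
    have := Nat.find_min hex hi
    push Not at this
    exact this e he
  have hjN : Nat.find hex ≤ N := (Nat.find_min' hex ⟨e0, he0, hY0⟩).trans hj0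
  generalize Nat.find hex = j at *
  have hp : 2 ^ N = 2 ^ j * 2 ^ (N - j) := by rw [← pow_add]; congr 1; omega
  have hpos : 0 < 2 ^ (N - j) := by positivity
  simp only [mem_Cub, Pi.zero_apply, zero_mul, zero_add, one_mul] at he
  simp only [Set.mem_iUnion]
  refine ⟨j, by simp; omega, fun i => e i / 2 ^ (N - j), ?_, ?_⟩
  · rw [mem_Cub]; intro i
    simp only [Pi.zero_apply, zero_mul, zero_add, one_mul, zero_le, true_and]
    exact Nat.div_lt_of_lt_mul (by rw [mul_comm, ← hp]; exact (he i).2)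
  set c : Fin d → ℕ := fun i => e i / 2 ^ (N - j) with hc
  have hNj : j + (N - j) = N := by omega
  constructor
  · intro i hi
    have := hmin i hi (fun i => c i * 2 ^ (N - j)) (by
      rw [mem_Cub]; intro i
      simp only [Pi.zero_apply, zero_mul, zero_add, one_mul, zero_le, true_and]
      exact (Nat.div_mul_le_self _ _).trans_lt (he i).2)
    rwa [← pt_refine v s j (N - j) c, hNj]
  · have hec : e ∈ Cub (N - j) c := by
      rw [mem_Cub]; intro i
      exact ⟨Nat.div_mul_le_self _ _, by
        rw [mul_comm]; exact Nat.lt_mul_div_succ (e i) hpos⟩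
    have := chain' v s (N - j) j c (fun x => X (tt j) x ω) e hec
    rw [hNj] at this
    have := (abs_le.1 this).2
    simp only [Yq] at hY
    simp only [Set.mem_setOf_eq, Yq]
    linarith

lemma badA_le {P : Measure Ω} {X : ℝ → EE d → Ω → ℝ} {L R : ℝ} (h : Setup P X L R) {q : ℝ} (hq : 0 ≤ q)
    (v : EE d) {s : ℝ} (hs : 0 ≤ s) (N j : ℕ) (c : Fin d → ℕ) :
    P (badA X q v s N j c) ≤ ENNReal.ofReal (Real.exp (-gam d * q) * Real.exp (- (d * tt j))) *
      ENNReal.ofReal (uu (ChC d 1 (aC d) (L*d*s) * CeC d 1 (aC d) (L*d*s)) (fun n => gg P X q 1 n 0) j) := by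
  set y := pt v s j c with hy
  set T : Set Ω := {ω | Yq X q (tt j) y ω < Ck * Dn v s (N - j) j c (fun x => X (tt j) x ω)} with hT
  have mD := meas_Dn v s (N-j) j c (X (tt j)) (fun x => h.meas (tt j) x)
  have mY := meas_Yq h q (tt j) y
  have mT : MeasurableSet T := measurableSet_lt mY (mD.coe_nnreal_real.const_mul _)
  have mS := meas_sb h q j y
  have g0 := gam_nonneg d
  calc P (sb X q j y ∩ T) = ∫⁻ ω in sb X q j y, T.indicator 1 ω ∂P := by
        rw [lintegral_indicator_one mT, Measure.restrict_apply mT, Set.inter_comm]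
    _ ≤ ∫⁻ ω in sb X q j y, ENNReal.ofReal (Real.exp (-gam d * q) * Real.exp (- (d * tt j))) *
          ENNReal.ofReal (wt X (tt j) y ω * Real.exp (-1 * Yq X q (tt j) y ω) *
          Real.exp (aC d * Dn v s (N-j) j c (fun x => X (tt j) x ω))) ∂P := by
        apply lintegral_mono
        intro ω
        by_cases hω : ω ∈ T
        · simp only [Set.indicator_of_mem hω, Pi.one_apply]
          rw [← ENNReal.ofReal_mul (by positivity), ← ENNReal.ofReal_one]
          apply ENNReal.ofReal_le_ofReal
          unfold wt
          rw [← Real.exp_add, ← Real.exp_add, ← Real.exp_add, ← Real.exp_add, Real.one_le_exp_iff]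
          have h1 : Yq X q (tt j) y ω < Ck * Dn v s (N - j) j c (fun x => X (tt j) x ω) := hω
          have h2 := mul_le_mul_of_nonneg_left h1.le (show 0 ≤ gam d + 1 by linarith)
          have h3 := gam_sq d
          unfold aC
          simp only [Yq] at h2 ⊢
          have h4 : gam d * (gam d * tt j) = 2 * d * tt j := by rw [← mul_assoc, ← sq, h3]
          nlinarith
        · simp [Set.indicator_of_notMem hω]
    _ = ENNReal.ofReal (Real.exp (-gam d * q) * Real.exp (- (d * tt j))) * wE P X q 1 (aC d) v s (N-j) j c y := by
        rw [lintegral_const_mul' _ _ ENNReal.ofReal_ne_top]; rfl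
    _ ≤ _ := by
        gcongr
        exact wE_le h hq zero_le_one (aC_nonneg d) v hs j _ _ _

def badC (d : ℕ) (L s : ℝ) : ℝ := 2 + 2 * (ChC d 1 (aC d) (L*d*s) * CeC d 1 (aC d) (L*d*s) * greenC 1)

lemma bad_le {P : Measure Ω} {X : ℝ → EE d → Ω → ℝ} {L R : ℝ} (h : Setup P X L R) {q : ℝ} (hq : 0 ≤ q)
    (v : EE d) {s : ℝ} (hs : 0 ≤ s) (N : ℕ) :
    P (Bad X q v s N) ≤ ENNReal.ofReal (Real.exp (-gam d * q) * badC d L s) := by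
  set K := ChC d 1 (aC d) (L*d*s) * CeC d 1 (aC d) (L*d*s) with hK
  have K0 : 0 ≤ K := mul_nonneg (ChC_pos _ _ _ _).le (Real.exp_pos _).le
  set u := uu K (fun n => gg P X q 1 n 0)
  have u0 : ∀ n, 0 ≤ u n := uu_nonneg K0 (fun n => gg_nonneg P X q 1 n 0)
  calc P (Bad X q v s N) ≤ ∑ j ∈ Finset.range (N+1), ∑ c ∈ Cub j (0 : Fin d → ℕ), P (badA X q v s N j c) := by
        refine (measure_mono (bad_sub X q v s N)).trans ?_
        refine (measure_biUnion_finset_le _ _).trans ?_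
        exact Finset.sum_le_sum fun j _ => measure_biUnion_finset_le _ _
    _ ≤ ∑ j ∈ Finset.range (N+1), ENNReal.ofReal (Real.exp (-gam d * q) * u j) := by
        apply Finset.sum_le_sum; intro j _
        refine (Finset.sum_le_sum fun c _ => badA_le h hq v hs N j c).trans ?_
        rw [Finset.sum_const, card_Cub, nsmul_eq_mul, ← ENNReal.ofReal_natCast, ← ENNReal.ofReal_mul (by positivity), ← ENNReal.ofReal_mul (by positivity)]
        apply ENNReal.ofReal_le_ofReal
        have e1 : ((((2:ℕ) ^ j) ^ d : ℕ) : ℝ) = Real.exp (d * tt j) := by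
          rw [Real.exp_nat_mul, exp_tt]; push_cast; rfl
        rw [e1, Real.exp_neg]
        have := Real.exp_pos (d * tt j)
        apply le_of_eq
        change _ * (_ * u j) = _
        generalize u j = w
        field_simp
    _ = ENNReal.ofReal (Real.exp (-gam d * q) * ∑ j ∈ Finset.range (N+1), u j) := by
        rw [← ENNReal.ofReal_sum_of_nonneg (fun j _ => by have := u0 j; positivity), Finset.mul_sum]
    _ ≤ _ := by
        apply ENNReal.ofReal_le_ofReal
        gcongr
        unfold badC
        rw [mul_assoc]
        have := uu_sum K0 (fun n => gg_nonneg P X q 1 n 0) (green h q one_pos 0) (N+1)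
        rw [← mul_assoc, ← hK] at *
        linarith

lemma bad_mono (X : ℝ → EE d → Ω → ℝ) (q : ℝ) (v : EE d) (s : ℝ) : Monotone (Bad X q v s) := by
  apply monotone_nat_of_le_succ
  rintro N ω ⟨j, hj, e, he, hY⟩
  refine ⟨j, by omega, fun i => e i * 2 ^ 1, ?_, by rwa [pt_refine]⟩
  rw [mem_Cub] at he ⊢
  intro i
  have := he i
  simp only [Pi.zero_apply, zero_mul, zero_add, one_mul, zero_le, true_and, pow_succ, pow_zero] at this ⊢
  omega

def vv (d n : ℕ) : EE d := WithLp.toLp 2 (fun _ => -((n:ℝ)+1))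

lemma good_of (X : ℝ → EE d → Ω → ℝ) (hc : ∀ ω, Continuous fun p : ℝ × EE d => X p.1 p.2 ω) (q : ℝ) (n : ℕ) (ω : Ω)
    (hω : ∀ N, ω ∉ Bad X q (vv d n) (2 * (n+1)) N) : ∀ j, ∀ x ∈ Metric.closedBall (0 : EE d) n, 0 ≤ Yq X q (tt j) x ω := by
  intro j x hx
  have hn : 0 < 2 * ((n:ℝ)+1) := by positivity
  have hxi : ∀ i, |x i| ≤ n := by
    intro i
    have := PiLp.norm_apply_le x i
    rw [mem_closedBall_zero_iff] at hx
    exact this.trans hx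
  let α : Fin d → ℝ := fun i => (x i + (n+1)) / (2 * (n+1))
  have α0 : ∀ i, 0 ≤ α i := fun i => by
    have := (abs_le.1 (hxi i)).1
    apply div_nonneg _ hn.le; linarith
  have α1 : ∀ i, α i < 1 := fun i => by
    have := (abs_le.1 (hxi i)).2
    simp only [α]
    rw [div_lt_one hn]; linarith
  let e : ℕ → Fin d → ℕ := fun N i => ⌊α i * 2 ^ N⌋₊
  have he : ∀ N, e N ∈ Cub N (0 : Fin d → ℕ) := by
    intro N; rw [mem_Cub]; intro i
    simp only [Pi.zero_apply, zero_mul, zero_add, one_mul, zero_le, true_and, e]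
    rw [Nat.floor_lt (mul_nonneg (α0 i) (by positivity))]
    push_cast
    have : (0:ℝ) < 2 ^ N := by positivity
    nlinarith [α1 i]
  have hlim : Tendsto (fun N => pt (vv d n) (2 * (n+1)) N (e N)) atTop (nhds x) := by
    have e1 : ∀ N, pt (vv d n) (2 * (n+1)) N (e N) = WithLp.toLp 2 (fun i => -((n:ℝ)+1) + 2 * (n+1) * ((e N i : ℝ) / 2 ^ N)) := by
      intro N; ext i; rw [pt_apply]; simp [vv]; ring
    simp_rw [e1]
    have e2 : x = WithLp.toLp 2 (fun i => -((n:ℝ)+1) + 2 * (n+1) * α i) := by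
      ext i; simp only [α]; field_simp; ring
    conv => rhs; rw [e2]
    refine ((PiLp.continuous_toLp 2 _).tendsto _).comp ?_
    rw [tendsto_pi_nhds]
    intro i
    refine Tendsto.const_add _ (Tendsto.const_mul _ ?_)
    exact (tendsto_nat_floor_mul_div_atTop (α0 i)).comp (tendsto_pow_atTop_atTop_of_one_lt (one_lt_two : (1:ℝ) < 2))
  have hcY : Continuous fun x => Yq X q (tt j) x ω := by
    unfold Yq
    have : Continuous fun x => X (tt j) x ω := (hc ω).comp (by fun_prop : Continuous fun x : EE d => (tt j, x))
    fun_prop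
  refine ge_of_tendsto ((hcY.tendsto x).comp hlim) ?_
  filter_upwards [eventually_ge_atTop j] with N hN
  by_contra hneg
  exact hω N ⟨j, hN, e N, he N, not_le.1 hneg⟩

theorem good_ae {P : Measure Ω} {X : ℝ → EE d → Ω → ℝ} {L R : ℝ} (h : Setup P X L R) (hd : 1 ≤ d) :
    ∀ᵐ ω ∂P, ∀ n : ℕ, ∃ q : ℕ, ∀ j, ∀ x ∈ Metric.closedBall (0 : EE d) n, 0 ≤ Yq X q (tt j) x ω := by
  rw [ae_all_iff]
  intro n
  have key : P (⋂ q : ℕ, ⋃ N, Bad X q (vv d n) (2 * (n+1)) N) = 0 := by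
    apply le_antisymm _ (zero_le)
    have lim : Tendsto (fun q : ℕ => ENNReal.ofReal (Real.exp (-gam d * q) * badC d L (2 * (n+1)))) atTop (nhds 0) := by
      rw [← ENNReal.ofReal_zero]
      apply ENNReal.tendsto_ofReal
      rw [← zero_mul (badC d L (2 * (n+1)))]
      apply Tendsto.mul_const
      apply Real.tendsto_exp_atBot.comp
      have := gam_pos hd
      exact (tendsto_natCast_atTop_atTop).const_mul_atTop_of_neg (by linarith)
    refine ge_of_tendsto' lim fun q => ?_
    refine (measure_mono (Set.iInter_subset _ q)).trans ?_
    rw [(bad_mono X q (vv d n) (2 * (n+1))).measure_iUnion]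
    exact iSup_le fun N => bad_le h (by positivity) _ (by positivity) N
  have := measure_eq_zero_iff_ae_notMem.1 key
  filter_upwards [this] with ω hω
  simp only [Set.mem_iInter, Set.mem_iUnion, not_forall, not_exists] at hω
  obtain ⟨q, hq⟩ := hω
  exact ⟨q, good_of X h.cont q n ω hq⟩

end DM

set_option linter.unusedSectionVars false
set_option linter.unusedVariables false

namespace DM

section base

variable {d : ℕ} {Ω : Type*} [m0 : MeasurableSpace Ω]

lemma lawX {P : Measure Ω} {X : ℝ → EE d → Ω → ℝ} {L R : ℝ} (h : Setup P X L R) {t : ℝ} (ht : 0 ≤ t) (x : EE d) :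
    Measure.map (X t x) P = gaussianReal 0 t.toNNReal := by
  have := h.prob
  rcases ht.eq_or_lt with rfl | ht
  · rw [Measure.map_congr (h.zero x)]
    simp
  · have := h.law 0 t le_rfl ht x
    rw [sub_zero] at this
    rw [← this]
    apply Measure.map_congr
    filter_upwards [h.zero x] with ω hω
    rw [hω, sub_zero]

lemma exp_abs {P : Measure Ω} {X : ℝ → EE d → Ω → ℝ} {L R : ℝ} (h : Setup P X L R) {t : ℝ} (ht : 0 ≤ t) (x : EE d) (c : ℝ) :
    ∫⁻ ω, ENNReal.ofReal (Real.exp (c * |X t x ω|)) ∂P ≤ ENNReal.ofReal (2 * Real.exp (c^2 * t / 2)) := by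
  have mX := h.meas t x
  calc _ ≤ ∫⁻ ω, (ENNReal.ofReal (Real.exp (c * X t x ω)) + ENNReal.ofReal (Real.exp ((-c) * X t x ω))) ∂P := by
        apply lintegral_mono; intro ω
        simp only
        rw [← ENNReal.ofReal_add (by positivity) (by positivity)]
        apply ENNReal.ofReal_le_ofReal
        rcases abs_cases (X t x ω) with ⟨e, _⟩ | ⟨e, _⟩ <;> rw [e]
        · linarith [Real.exp_pos (-c * X t x ω)]
        · rw [mul_neg, ← neg_mul]; linarith [Real.exp_pos (c * X t x ω)]
    _ = _ := by
        rw [lintegral_add_left (by fun_prop), gauss_exp' mX (lawX h ht x), gauss_exp' mX (lawX h ht x),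
          ← ENNReal.ofReal_add (by positivity) (by positivity), Real.coe_toNNReal _ ht]
        congr 1; rw [neg_sq]; ring

lemma wt_bd (X : ℝ → EE d → Ω → ℝ) {t : ℝ} (ht : 0 ≤ t) (x : EE d) (ω : Ω) :
    wt X t x ω ≤ Real.exp ((gam d + 1) * |X t x ω|) := by
  unfold wt
  apply Real.exp_le_exp.2
  have := gam_nonneg d
  have h1 := le_abs_self (X t x ω)
  have h2 := abs_nonneg (X t x ω)
  have : 0 ≤ (d:ℝ) * t := by positivity
  nlinarith

lemma psi_bd (X : ℝ → EE d → Ω → ℝ) (q : ℝ) {t : ℝ} (ht : 0 ≤ t) (x : EE d) (ω : Ω) :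
    |psi X q t x ω| ≤ Real.exp (gam d * t + |q|) * Real.exp ((gam d + 1) * |X t x ω|) := by
  have g0 := gam_nonneg d
  unfold psi
  rw [abs_mul, abs_of_pos (wt_pos _ _ _ _)]
  have h1 : |Yq X q t x ω| ≤ Real.exp (gam d * t + |q| + |X t x ω|) := by
    have e1 := Real.add_one_le_exp (gam d * t + |q| + |X t x ω|)
    have e2 : |Yq X q t x ω| ≤ gam d * t + |q| + |X t x ω| := by
      unfold Yq
      have : 0 ≤ gam d * t := by positivity
      rw [abs_le]
      constructor <;> linarith [neg_abs_le q, le_abs_self q, neg_abs_le (X t x ω), le_abs_self (X t x ω)]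
    linarith
  have h2 : wt X t x ω ≤ Real.exp (gam d * |X t x ω|) := by
    unfold wt
    apply Real.exp_le_exp.2
    have h1 := le_abs_self (X t x ω)
    have : 0 ≤ (d:ℝ) * t := by positivity
    nlinarith
  calc _ ≤ Real.exp (gam d * t + |q| + |X t x ω|) * Real.exp (gam d * |X t x ω|) := by
        gcongr
        exact (wt_pos _ _ _ _).le
    _ = _ := by rw [← Real.exp_add, ← Real.exp_add]; ring_nf

def psiC (d : ℕ) (q t : ℝ) : ℝ := Real.exp (gam d * t + |q|) ^ 2 * (2 * Real.exp ((2 * (gam d + 1))^2 * t / 2))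

lemma psiC_nonneg (d : ℕ) (q t : ℝ) : 0 ≤ psiC d q t := by unfold psiC; positivity

lemma psi_sq {P : Measure Ω} {X : ℝ → EE d → Ω → ℝ} {L R : ℝ} (h : Setup P X L R) (q : ℝ) {t : ℝ} (ht : 0 ≤ t) (x : EE d) :
    ∫⁻ ω, ENNReal.ofReal (psi X q t x ω ^ 2) ∂P ≤ ENNReal.ofReal (psiC d q t) := by
  calc _ ≤ ∫⁻ ω, ENNReal.ofReal (Real.exp (gam d * t + |q|) ^ 2) * ENNReal.ofReal (Real.exp ((2 * (gam d + 1)) * |X t x ω|)) ∂P := by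
        apply lintegral_mono; intro ω
        simp only
        rw [← ENNReal.ofReal_mul (by positivity)]
        apply ENNReal.ofReal_le_ofReal
        rw [← sq_abs]
        have := psi_bd X q ht x ω
        calc _ ≤ (Real.exp (gam d * t + |q|) * Real.exp ((gam d + 1) * |X t x ω|)) ^ 2 := by gcongr
          _ = _ := by rw [mul_pow, ← Real.exp_nat_mul ((gam d + 1) * |X t x ω|)]; push_cast; ring_nf
    _ ≤ _ := by
        rw [lintegral_const_mul' _ _ ENNReal.ofReal_ne_top]
        unfold psiC
        rw [ENNReal.ofReal_mul (by positivity)]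
        gcongr
        exact exp_abs h ht x _

lemma wt_sq {P : Measure Ω} {X : ℝ → EE d → Ω → ℝ} {L R : ℝ} (h : Setup P X L R) {t : ℝ} (ht : 0 ≤ t) (x : EE d) :
    ∫⁻ ω, ENNReal.ofReal (wt X t x ω ^ 2) ∂P ≤ ENNReal.ofReal (2 * Real.exp ((2 * (gam d + 1))^2 * t / 2)) := by
  calc _ ≤ ∫⁻ ω, ENNReal.ofReal (Real.exp ((2 * (gam d + 1)) * |X t x ω|)) ∂P := by
        apply lintegral_mono; intro ω
        simp only
        apply ENNReal.ofReal_le_ofReal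
        have := wt_bd X ht x ω
        have := wt_pos X t x ω
        calc _ ≤ (Real.exp ((gam d + 1) * |X t x ω|)) ^ 2 := by gcongr
          _ = _ := by rw [← Real.exp_nat_mul ((gam d + 1) * |X t x ω|)]; push_cast; ring_nf
    _ ≤ _ := exp_abs h ht x _

/-- joint measurability -/
def JM (m : MeasurableSpace Ω) (g : EE d → Ω → ℝ) : Prop :=
  @Measurable (Ω × EE d) ℝ (@Prod.instMeasurableSpace _ _ m _) _ (fun p => g p.2 p.1)

lemma JM_of_cont' {Ω' : Type*} [MeasurableSpace Ω'] {g : EE d → Ω' → ℝ} (hm : ∀ x, Measurable (g x)) (hc : ∀ ω, Continuous fun x => g x ω) :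
    Measurable (fun p : Ω' × EE d => g p.2 p.1) := by
  have : Measurable (Function.uncurry g) :=
    measurable_uncurry_of_continuous_of_measurable (u := g) hc hm
  exact this.comp measurable_swap

lemma JM_of_cont {m : MeasurableSpace Ω} {g : EE d → Ω → ℝ} (hm : ∀ x, Measurable[m] (g x)) (hc : ∀ ω, Continuous fun x => g x ω) : JM m g :=
  @JM_of_cont' d Ω m g hm hc

lemma JM.mono {m m' : MeasurableSpace Ω} {g : EE d → Ω → ℝ} (h : JM m g) (hm : m ≤ m') : JM m' g := by
  unfold JM at *
  refine Measurable.mono h ?_ le_rfl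
  exact sup_le_sup (MeasurableSpace.comap_mono hm) le_rfl

end base

section flds

variable {d : ℕ} {Ω : Type*} {m m' : MeasurableSpace Ω} [m0 : MeasurableSpace Ω]

/-- measurable field with bounded second moments. -/
structure Fld (m : MeasurableSpace Ω) [m0 : MeasurableSpace Ω] (P : Measure Ω) (g : EE d → Ω → ℝ) : Prop where
  le : m ≤ m0
  jm : JM m g
  bd : ∃ C : ℝ, ∀ x, ∫⁻ ω, ENNReal.ofReal (g x ω ^ 2) ∂P ≤ ENNReal.ofReal C

lemma Fld.jm0 {P : Measure Ω} {g : EE d → Ω → ℝ} (h : Fld m P g) :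
    Measurable (fun p : Ω × EE d => g p.2 p.1) := h.jm.mono h.le

lemma Fld.mx {P : Measure Ω} {g : EE d → Ω → ℝ} (h : Fld m P g) (x : EE d) : Measurable (g x) :=
  h.jm0.comp (measurable_id.prodMk measurable_const)

lemma Fld.mono {P : Measure Ω} {g : EE d → Ω → ℝ} (h : Fld m P g) (hm : m ≤ m') (h' : m' ≤ m0) : Fld m' P g :=
  ⟨h', h.jm.mono hm, h.bd⟩

lemma Fld.of_le {P : Measure Ω} {g g' : EE d → Ω → ℝ} (h : Fld m P g) (hm : m ≤ m') (h' : m' ≤ m0)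
    (hj : JM m' g') (hle : ∀ x ω, |g' x ω| ≤ |g x ω|) : Fld m' P g' := by
  obtain ⟨C, hC⟩ := h.bd
  refine ⟨h', hj, C, fun x => (lintegral_mono fun ω => ENNReal.ofReal_le_ofReal ?_).trans (hC x)⟩
  exact sq_le_sq.2 (hle x ω)

lemma JM.sub {g g' : EE d → Ω → ℝ} (h : JM m g) (h' : JM m g') : JM m (fun x ω => g x ω - g' x ω) :=
  Measurable.sub h h'

lemma Fld.sub {P : Measure Ω} {g g' : EE d → Ω → ℝ} (h : Fld m P g) (h' : Fld m P g') :
    Fld m P (fun x ω => g x ω - g' x ω) := by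
  obtain ⟨C, hC⟩ := h.bd
  obtain ⟨C', hC'⟩ := h'.bd
  refine ⟨h.le, h.jm.sub h'.jm, 2 * |C| + 2 * |C'|, fun x => ?_⟩
  have m1 := h.mx x
  have m2 := h'.mx x
  calc _ ≤ ∫⁻ ω, (ENNReal.ofReal 2 * ENNReal.ofReal (g x ω ^ 2) + ENNReal.ofReal 2 * ENNReal.ofReal (g' x ω ^ 2)) ∂P := by
        apply lintegral_mono; intro ω
        simp only
        rw [← ENNReal.ofReal_mul (by positivity), ← ENNReal.ofReal_mul (by positivity), ← ENNReal.ofReal_add (by positivity) (by positivity)]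
        apply ENNReal.ofReal_le_ofReal
        nlinarith [sq_nonneg (g x ω + g' x ω)]
    _ ≤ ENNReal.ofReal 2 * ENNReal.ofReal |C| + ENNReal.ofReal 2 * ENNReal.ofReal |C'| := by
        rw [lintegral_add_left (by fun_prop), lintegral_const_mul' _ _ ENNReal.ofReal_ne_top, lintegral_const_mul' _ _ ENNReal.ofReal_ne_top]
        gcongr
        · exact (hC x).trans (ENNReal.ofReal_le_ofReal (le_abs_self _))
        · exact (hC' x).trans (ENNReal.ofReal_le_ofReal (le_abs_self _))
    _ = _ := by
        rw [← ENNReal.ofReal_mul (by positivity), ← ENNReal.ofReal_mul (by positivity), ← ENNReal.ofReal_add (by positivity) (by positivity)]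

lemma Fld.memLp {P : Measure Ω} {g : EE d → Ω → ℝ} (h : Fld m P g) (x : EE d) : MemLp (g x) 2 P := by
  obtain ⟨C, hC⟩ := h.bd
  rw [memLp_two_iff_integrable_sq (h.mx x).aestronglyMeasurable]
  refine ⟨((h.mx x).pow_const 2).aestronglyMeasurable, ?_⟩
  rw [hasFiniteIntegral_iff_ofReal (Eventually.of_forall fun ω => sq_nonneg _)]
  exact (hC x).trans_lt ENNReal.ofReal_lt_top

lemma Fld.int_prod {P : Measure Ω} [IsProbabilityMeasure P] {g : EE d → Ω → ℝ} (h : Fld m P g) {f : EE d → ℝ} (hf : Measurable f)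
    (hfi : Integrable f) : Integrable (fun p : Ω × EE d => f p.2 * g p.2 p.1) (P.prod volume) := by
  obtain ⟨C, hC⟩ := h.bd
  have mg := h.jm0
  refine ⟨((hf.comp measurable_snd).mul mg).aestronglyMeasurable, ?_⟩
  have mm : Measurable (fun a : Ω × EE d => ‖f a.2 * g a.2 a.1‖ₑ) := ((hf.comp measurable_snd).mul mg).enorm
  rw [HasFiniteIntegral, lintegral_prod_symm' _ mm]
  have : ∀ x, ∫⁻ ω, ‖f x * g x ω‖ₑ ∂P ≤ ‖f x‖ₑ * ENNReal.ofReal (1 + |C|) := by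
    intro x
    simp_rw [enorm_mul]
    rw [lintegral_const_mul' _ _ enorm_ne_top]
    gcongr
    calc _ ≤ ∫⁻ ω, (1 + ENNReal.ofReal (g x ω ^ 2)) ∂P := by
          apply lintegral_mono; intro ω
          simp only
          rw [Real.enorm_eq_ofReal_abs, ← ENNReal.ofReal_one, ← ENNReal.ofReal_add (by positivity) (by positivity)]
          apply ENNReal.ofReal_le_ofReal
          rw [← sq_abs]
          nlinarith [sq_nonneg (|g x ω| - 1)]
      _ ≤ _ := by
          rw [lintegral_add_left measurable_const, ENNReal.ofReal_add zero_le_one (abs_nonneg _)]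
          simp only [lintegral_const, measure_univ, mul_one, ENNReal.ofReal_one]
          gcongr
          exact (hC x).trans (ENNReal.ofReal_le_ofReal (le_abs_self _))
  refine (lintegral_mono this).trans_lt ?_
  rw [lintegral_mul_const' _ _ ENNReal.ofReal_ne_top]
  exact ENNReal.mul_lt_top hfi.2 ENNReal.ofReal_lt_top

def Fi (f : EE d → ℝ) (g : EE d → Ω → ℝ) (ω : Ω) : ℝ := ∫ x, f x * g x ω

lemma sm_int {Ω' : Type*} [MeasurableSpace Ω'] {F : Ω' × EE d → ℝ} (hF : Measurable F) :
    StronglyMeasurable fun ω => ∫ x, F (ω, x) :=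
  hF.stronglyMeasurable.integral_prod_right'

lemma Fi_sm' {Ω' : Type*} [MeasurableSpace Ω'] {g : EE d → Ω' → ℝ} (h : Measurable (fun p : Ω' × EE d => g p.2 p.1)) {f : EE d → ℝ} (hf : Measurable f) :
    StronglyMeasurable fun ω => ∫ x, f x * g x ω :=
  sm_int (F := fun p : Ω' × EE d => f p.2 * g p.2 p.1) ((hf.comp measurable_snd).mul h)

lemma Fi_sm {g : EE d → Ω → ℝ} (h : JM m g) {f : EE d → ℝ} (hf : Measurable f) :
    StronglyMeasurable[m] (Fi f g) := @Fi_sm' d Ω m g h f hf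

lemma Fld.Fi_int {P : Measure Ω} [IsProbabilityMeasure P] {g : EE d → Ω → ℝ} (h : Fld m P g) {f : EE d → ℝ} (hf : Measurable f)
    (hfi : Integrable f) : Integrable (Fi f g) P := (h.int_prod hf hfi).integral_prod_left

lemma Fld.set_int {P : Measure Ω} [IsProbabilityMeasure P] {g : EE d → Ω → ℝ} (h : Fld m P g) {f : EE d → ℝ} (hf : Measurable f)
    (hfi : Integrable f) {B : Set Ω} (hB : MeasurableSet B) : ∫ ω in B, Fi f g ω ∂P = ∫ x, f x * ∫ ω in B, g x ω ∂P := by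
  have h1 : Integrable (fun p : Ω × EE d => f p.2 * g p.2 p.1) ((P.restrict B).prod volume) := by
    have e : (P.restrict B).prod (volume : Measure (EE d)) = (P.prod volume).restrict (B ×ˢ Set.univ) := by
      rw [← Measure.prod_restrict, Measure.restrict_univ]
    rw [e]
    exact (h.int_prod hf hfi).restrict
  unfold Fi
  rw [integral_integral_swap h1]
  simp_rw [integral_const_mul]

end flds

end DM

set_option linter.unusedSectionVars false
set_option linter.unusedVariables false

namespace DM

variable {d : ℕ} {Ω : Type*} [m0 : MeasurableSpace Ω]

def HH (d : ℕ) (w y τ z : ℝ) : ℝ := w * ((y + gam d * τ - z) * Real.exp (gam d * z - d * τ) - y)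

lemma cm_map {v : NNReal} (hv : v ≠ 0) :
    Measure.map (fun z => gam d * v - z) ((gaussianReal 0 v).withDensity (fun z => ENNReal.ofReal (Real.exp (gam d * z - d * v)))) = gaussianReal 0 v := by
  ext A hA
  rw [Measure.map_apply (by fun_prop) hA, withDensity_apply _ ((by fun_prop : Measurable fun z : ℝ => gam d * v - z) hA)]
  have := cm (d := d) hv (F := A.indicator 1) (measurable_one.indicator hA)
  rw [lintegral_indicator_one hA] at this
  rw [← this, ← lintegral_indicator ((by fun_prop : Measurable fun z : ℝ => gam d * v - z) hA)]
  congr 1; ext z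
  by_cases h : gam d * v - z ∈ A <;> simp [Set.indicator, h]

lemma HH_int (d : ℕ) (w y : ℝ) {τ : ℝ} (hτ : 0 < τ) :
    ∫ z, HH d w y τ z ∂(gaussianReal 0 τ.toNNReal) = 0 := by
  have hv : τ.toNNReal ≠ 0 := by simpa using hτ
  have hvr : (τ.toNNReal : ℝ) = τ := Real.coe_toNNReal _ hτ.le
  have mdens : Measurable (fun z : ℝ => ENNReal.ofReal (Real.exp (gam d * z - d * (τ.toNNReal : ℝ)))) := by fun_prop
  have i1 : Integrable (fun u : ℝ => y + u) (gaussianReal 0 τ.toNNReal) := by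
    refine (integrable_const _).add ?_
    exact (memLp_id_gaussianReal (μ := 0) (v := τ.toNNReal) 1).integrable (by simp)
  have i1' := i1
  rw [← cm_map (d := d) hv, integrable_map_measure (by fun_prop) (by fun_prop),
    integrable_withDensity_iff mdens (Eventually.of_forall fun z => ENNReal.ofReal_lt_top)] at i1'
  have e1 : ∫ u, (y + u) ∂(gaussianReal 0 τ.toNNReal) = y := by
    have i0 : Integrable (fun u : ℝ => u) (gaussianReal 0 τ.toNNReal) := (memLp_id_gaussianReal (μ := 0) (v := τ.toNNReal) 1).integrable (by simp)
    rw [integral_add (integrable_const _) i0]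
    simp
  have e2 := e1
  rw [← cm_map (d := d) hv, integral_map (by fun_prop) (by fun_prop), integral_withDensity_eq_integral_toReal_smul mdens (Eventually.of_forall fun z => ENNReal.ofReal_lt_top)] at e2
  unfold HH
  rw [integral_const_mul, integral_sub _ (integrable_const _)]
  · have : ∫ z, (y + gam d * τ - z) * Real.exp (gam d * z - d * τ) ∂(gaussianReal 0 τ.toNNReal) = y := by
      refine Eq.trans ?_ e2
      congr 1; ext z
      simp only [smul_eq_mul]
      rw [ENNReal.toReal_ofReal (Real.exp_pos _).le, hvr]; ring
    rw [this]; simp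
  · refine i1'.congr (Eventually.of_forall fun z => ?_)
    simp only [Function.comp]
    rw [ENNReal.toReal_ofReal (Real.exp_pos _).le, hvr]; ring

lemma psi_diff (X : ℝ → EE d → Ω → ℝ) (q s t : ℝ) (x : EE d) (ω : Ω) :
    psi X q t x ω - psi X q s x ω = HH d (wt X s x ω) (Yq X q s x ω) (t - s) (X t x ω - X s x ω) := by
  unfold psi HH
  rw [Yq_step X q s t, wt_step X s t]; ring

lemma int_zero {P : Measure Ω} {X : ℝ → EE d → Ω → ℝ} {L R : ℝ} (h : Setup P X L R)
    {s t : ℝ} (hs : 0 ≤ s) (hst : s < t) {α β : Type*} [MeasurableSpace α] [MeasurableSpace β]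
    {V : Ω → β} (hV : Measurable[Fil X s] V) {D : Ω → α} (hD : Measurable[Inc X s t] D) {F : β × α → ℝ} (hF : Measurable F)
    (hi : Integrable (fun ω => F (V ω, D ω)) P) (h0 : ∀ v, ∫ a, F (v, a) ∂(Measure.map D P) = 0) :
    ∫ ω, F (V ω, D ω) ∂P = 0 := by
  have := h.prob
  have ind : IndepFun V D P := (indepFun_of (h.indep s t hs hst) hD hV).symm
  have mV : Measurable V := hV.mono (Fil_le h.meas s) le_rfl
  have mD : Measurable D := hD.mono (Inc_le h.meas s t) le_rfl
  have e := (indepFun_iff_map_prod_eq_prod_map_map mV.aemeasurable mD.aemeasurable).1 ind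
  have pV := Measure.isProbabilityMeasure_map (μ := P) mV.aemeasurable
  have pD := Measure.isProbabilityMeasure_map (μ := P) mD.aemeasurable
  have hi' : Integrable F (Measure.map (fun ω => (V ω, D ω)) P) := by
    rw [integrable_map_measure hF.aestronglyMeasurable (mV.prodMk mD).aemeasurable]; exact hi
  have : ∫ ω, F (V ω, D ω) ∂P = ∫ p, F p ∂(Measure.map (fun ω => (V ω, D ω)) P) := by
    rw [integral_map (mV.prodMk mD).aemeasurable hF.aestronglyMeasurable]
  rw [this, e, integral_prod _ (by rw [← e]; exact hi')]
  simp [h0]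

lemma meas_HH (d : ℕ) (τ : ℝ) : Measurable fun p : (ℝ × ℝ) × ℝ => HH d p.1.1 p.1.2 τ p.2 := by
  unfold HH; fun_prop

lemma Fil_V (X : ℝ → EE d → Ω → ℝ) (q : ℝ) {s : ℝ} (hs : 0 ≤ s) (x : EE d) {B : Set Ω} (hB : MeasurableSet[Fil X s] B) :
    Measurable[Fil X s] fun ω => (B.indicator (wt X s x) ω, Yq X q s x ω) := by
  have m1 := meas_wt_Fil X hs le_rfl x
  have m2 := meas_Yq_Fil X q hs le_rfl x
  exact (Measurable.indicator m1 hB).prodMk m2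

lemma ind_psi (X : ℝ → EE d → Ω → ℝ) (q s t : ℝ) (x : EE d) (B : Set Ω) (ω : Ω) :
    B.indicator (fun ω => psi X q t x ω - psi X q s x ω) ω =
      HH d (B.indicator (wt X s x) ω) (Yq X q s x ω) (t - s) (X t x ω - X s x ω) := by
  by_cases h : ω ∈ B
  · simp only [Set.indicator_of_mem h]; exact psi_diff X q s t x ω
  · simp [Set.indicator_of_notMem h, HH]

lemma cont_X {P : Measure Ω} {X : ℝ → EE d → Ω → ℝ} {L R : ℝ} (h : Setup P X L R) (t : ℝ) (ω : Ω) :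
    Continuous fun x => X t x ω := (h.cont ω).comp (by fun_prop : Continuous fun x : EE d => (t, x))

lemma cont_psi {P : Measure Ω} {X : ℝ → EE d → Ω → ℝ} {L R : ℝ} (h : Setup P X L R) (q t : ℝ) (ω : Ω) :
    Continuous fun x => psi X q t x ω := by
  have := cont_X h t ω
  unfold psi Yq wt; fun_prop

lemma meas_psi_Fil (X : ℝ → EE d → Ω → ℝ) (q : ℝ) {u s : ℝ} (hu : 0 ≤ u) (hus : u ≤ s) (x : EE d) :
    Measurable[Fil X s] (psi X q u x) := by
  have m1 := meas_wt_Fil X hu hus x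
  have m2 := meas_Yq_Fil X q hu hus x
  exact m2.mul m1

lemma psi_fld {P : Measure Ω} {X : ℝ → EE d → Ω → ℝ} {L R : ℝ} (h : Setup P X L R) (q : ℝ) {s t : ℝ} (hs : 0 ≤ s) (hst : s ≤ t) :
    Fld (Fil X t) P (psi X q s) :=
  ⟨Fil_le h.meas t, JM_of_cont (fun x => meas_psi_Fil X q hs hst x) (fun ω => cont_psi h q s ω), psiC d q s, fun x => psi_sq h q hs x⟩

lemma wt_fld {P : Measure Ω} {X : ℝ → EE d → Ω → ℝ} {L R : ℝ} (h : Setup P X L R) {s t : ℝ} (hs : 0 ≤ s) (hst : s ≤ t) :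
    Fld (Fil X t) P (wt X s) := by
  refine ⟨Fil_le h.meas t, JM_of_cont (fun x => meas_wt_Fil X hs hst x) (fun ω => ?_), _, fun x => wt_sq h hs x⟩
  have := cont_X h s ω
  unfold wt; fun_prop

/-- martingale property -/
lemma ML {P : Measure Ω} {X : ℝ → EE d → Ω → ℝ} {L R : ℝ} (h : Setup P X L R) (q : ℝ)
    {s t : ℝ} (hs : 0 ≤ s) (hst : s ≤ t) (x : EE d) {B : Set Ω} (hB : MeasurableSet[Fil X s] B) :
    ∫ ω in B, psi X q t x ω ∂P = ∫ ω in B, psi X q s x ω ∂P := by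
  have := h.prob
  rcases hst.eq_or_lt with rfl | hst
  · rfl
  have i1 : Integrable (psi X q t x) P := ((psi_fld h q (hs.trans hst.le) le_rfl).memLp x).integrable (by simp)
  have i2 : Integrable (psi X q s x) P := ((psi_fld h q hs le_rfl).memLp x).integrable (by simp)
  have mB := Fil_le h.meas s _ hB
  rw [← sub_eq_zero, ← integral_sub i1.integrableOn i2.integrableOn, ← integral_indicator mB]
  have e : (fun ω => B.indicator (fun ω => psi X q t x ω - psi X q s x ω) ω) = fun ω => HH d (B.indicator (wt X s x) ω) (Yq X q s x ω) (t - s) (X t x ω - X s x ω) := by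
    ext ω; exact ind_psi X q s t x B ω
  have ii : Integrable (fun ω => B.indicator (fun ω => psi X q t x ω - psi X q s x ω) ω) P := (i1.sub i2).indicator mB
  rw [e] at ii ⊢
  refine int_zero h hs hst (Fil_V X q hs x hB) (meas_Inc X s t x) (meas_HH d (t - s)) ii fun v => ?_
  rw [h.law s t hs hst x]
  exact HH_int d v.1 v.2 (sub_pos.2 hst)

/-- orthogonality at distance -/
lemma far_zero {P : Measure Ω} {X : ℝ → EE d → Ω → ℝ} {L R : ℝ} (h : Setup P X L R) (q : ℝ)
    {s t : ℝ} (hs : 0 ≤ s) (hst : s < t) (x y : EE d) {B B' : Set Ω} (hB : MeasurableSet[Fil X s] B) (hB' : MeasurableSet[Fil X s] B')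
    (hxy : R * Real.exp (-s) ≤ ‖x - y‖) :
    ∫ ω, B.indicator (fun ω => psi X q t x ω - psi X q s x ω) ω * B'.indicator (fun ω => psi X q t y ω - psi X q s y ω) ω ∂P = 0 := by
  have := h.prob
  have i1 := fun x => (((psi_fld h q (hs.trans hst.le) le_rfl).memLp x).sub ((psi_fld h q hs le_rfl).memLp x))
  have mB := Fil_le h.meas s _ hB
  have mB' := Fil_le h.meas s _ hB'
  have ii := ((i1 x).indicator mB).integrable_mul ((i1 y).indicator mB')
  have e : (fun ω => B.indicator (fun ω => psi X q t x ω - psi X q s x ω) ω * B'.indicator (fun ω => psi X q t y ω - psi X q s y ω) ω) =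
     fun ω => HH d (B.indicator (wt X s x) ω) (Yq X q s x ω) (t - s) (X t x ω - X s x ω) * HH d (B'.indicator (wt X s y) ω) (Yq X q s y ω) (t - s) (X t y ω - X s y ω) := by
    ext ω; rw [ind_psi X q s t x B ω, ind_psi X q s t y B' ω]
  change Integrable (fun ω => B.indicator (fun ω => psi X q t x ω - psi X q s x ω) ω * B'.indicator (fun ω => psi X q t y ω - psi X q s y ω) ω) P at ii
  rw [e] at ii ⊢
  have mF : Measurable fun p : ((ℝ × ℝ) × (ℝ × ℝ)) × (ℝ × ℝ) => HH d p.1.1.1 p.1.1.2 (t-s) p.2.1 * HH d p.1.2.1 p.1.2.2 (t-s) p.2.2 := by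
    unfold HH; fun_prop
  have mD : ∀ x, Measurable fun ω => X t x ω - X s x ω := fun x => (h.meas _ _).sub (h.meas _ _)
  refine int_zero h hs hst ((Fil_V X q hs x hB).prodMk (Fil_V X q hs y hB')) ((meas_Inc X s t x).prodMk (meas_Inc X s t y)) mF ii fun v => ?_
  rw [(indepFun_iff_map_prod_eq_prod_map_map (mD x).aemeasurable (mD y).aemeasurable).1 (h.far s t hs hst x y hxy), h.law s t hs hst x, h.law s t hs hst y]
  simp only
  rw [integral_prod_mul (fun z => HH d v.1.1 v.1.2 (t-s) z) (fun z => HH d v.2.1 v.2.2 (t-s) z), HH_int d _ _ (sub_pos.2 hst), zero_mul]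

end DM

set_option linter.unusedSectionVars false
set_option linter.unusedVariables false

namespace DM

section flds2

variable {d : ℕ} {Ω : Type*} {m m' : MeasurableSpace Ω} [m0 : MeasurableSpace Ω]

lemma Fld.sq_prod {P : Measure Ω} [IsProbabilityMeasure P] {g : EE d → Ω → ℝ} (h : Fld m P g) {f : EE d → ℝ} (hf : Measurable f)
    (hfi : Integrable f) : Integrable (fun p : Ω × (EE d × EE d) => (f p.2.1 * g p.2.1 p.1) * (f p.2.2 * g p.2.2 p.1)) (P.prod (volume.prod volume)) := by
  obtain ⟨C, hC⟩ := h.bd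
  have mg := h.jm0
  have m1 : Measurable fun p : Ω × (EE d × EE d) => f p.2.1 * g p.2.1 p.1 := by
    have : Measurable fun p : Ω × (EE d × EE d) => g p.2.1 p.1 := mg.comp (measurable_fst.prodMk (measurable_fst.comp measurable_snd))
    exact (hf.comp (measurable_fst.comp measurable_snd)).mul this
  have m2 : Measurable fun p : Ω × (EE d × EE d) => f p.2.2 * g p.2.2 p.1 := by
    have : Measurable fun p : Ω × (EE d × EE d) => g p.2.2 p.1 := mg.comp (measurable_fst.prodMk (measurable_snd.comp measurable_snd))
    exact (hf.comp (measurable_snd.comp measurable_snd)).mul this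
  refine ⟨(m1.mul m2).aestronglyMeasurable, ?_⟩
  have mm : Measurable (fun p : Ω × (EE d × EE d) => ‖(f p.2.1 * g p.2.1 p.1) * (f p.2.2 * g p.2.2 p.1)‖ₑ) := (m1.mul m2).enorm
  rw [HasFiniteIntegral, lintegral_prod_symm' _ mm]
  have : ∀ p : EE d × EE d, ∫⁻ ω, ‖(f p.1 * g p.1 ω) * (f p.2 * g p.2 ω)‖ₑ ∂P ≤ (‖f p.1‖ₑ * ‖f p.2‖ₑ) * (ENNReal.ofReal C + ENNReal.ofReal C) := by
    intro p
    have e : ∀ ω, ‖(f p.1 * g p.1 ω) * (f p.2 * g p.2 ω)‖ₑ = (‖f p.1‖ₑ * ‖f p.2‖ₑ) * ‖g p.1 ω * g p.2 ω‖ₑ := by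
      intro ω; simp only [enorm_mul]; ring
    simp_rw [e]
    rw [lintegral_const_mul' _ _ (ENNReal.mul_ne_top enorm_ne_top enorm_ne_top)]
    gcongr
    calc _ ≤ ∫⁻ ω, (ENNReal.ofReal (g p.1 ω ^ 2) + ENNReal.ofReal (g p.2 ω ^ 2)) ∂P := by
          apply lintegral_mono; intro ω
          simp only
          rw [Real.enorm_eq_ofReal_abs, ← ENNReal.ofReal_add (by positivity) (by positivity)]
          apply ENNReal.ofReal_le_ofReal
          rw [abs_mul, ← sq_abs (g p.1 ω), ← sq_abs (g p.2 ω)]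
          nlinarith [sq_nonneg (|g p.1 ω| - |g p.2 ω|), sq_nonneg |g p.1 ω|, sq_nonneg |g p.2 ω|]
      _ ≤ _ := by
          have := h.mx p.1
          rw [lintegral_add_left (by fun_prop)]
          exact add_le_add (hC _) (hC _)
  refine (lintegral_mono this).trans_lt ?_
  rw [lintegral_mul_const' _ _ (by simp)]
  refine ENNReal.mul_lt_top ?_ (by simp)
  have me : Measurable fun x => ‖f x‖ₑ := hf.enorm
  rw [lintegral_prod_mul me.aemeasurable me.aemeasurable]
  exact ENNReal.mul_lt_top hfi.2 hfi.2

lemma Fi_sq_eq (f : EE d → ℝ) (g : EE d → Ω → ℝ) (ω : Ω) :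
    ∫ p : EE d × EE d, (f p.1 * g p.1 ω) * (f p.2 * g p.2 ω) ∂(volume.prod volume) = Fi f g ω ^ 2 := by
  rw [integral_prod_mul (fun x => f x * g x ω) (fun x => f x * g x ω), sq]; rfl

lemma Fld.Fi_sq_int {P : Measure Ω} [IsProbabilityMeasure P] {g : EE d → Ω → ℝ} (h : Fld m P g) {f : EE d → ℝ} (hf : Measurable f)
    (hfi : Integrable f) : Integrable (fun ω => Fi f g ω ^ 2) P := by
  have := (h.sq_prod hf hfi).integral_prod_left
  simp only [Fi_sq_eq f g] at this
  exact this

lemma Fld.Fi_sq {P : Measure Ω} [IsProbabilityMeasure P] {g : EE d → Ω → ℝ} (h : Fld m P g) {f : EE d → ℝ} (hf : Measurable f)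
    (hfi : Integrable f) : ∫ ω, Fi f g ω ^ 2 ∂P = ∫ p : EE d × EE d, f p.1 * f p.2 * ∫ ω, g p.1 ω * g p.2 ω ∂P ∂(volume.prod volume) := by
  simp_rw [← Fi_sq_eq f g]
  rw [integral_integral_swap (h.sq_prod hf hfi)]
  congr 1; ext p
  rw [← integral_const_mul]
  congr 1; ext ω; ring

/-- second moment with short-range correlations -/
lemma Fld.Fi_sq_le {P : Measure Ω} [IsProbabilityMeasure P] {g : EE d → Ω → ℝ} (h : Fld m P g) {f : EE d → ℝ} (hf : Measurable f)
    (hfi : Integrable f) {F : ℝ} (hF : ∀ x, |f x| ≤ F) {S ρ : ℝ} (hS : 0 ≤ S) (hρ : 0 < ρ) (hg : ∀ x, ∫⁻ ω, ENNReal.ofReal (g x ω ^ 2) ∂P ≤ ENNReal.ofReal S)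
    (hfar : ∀ x y, ρ ≤ ‖x - y‖ → ∫ ω, g x ω * g y ω ∂P = 0) :
    ∫ ω, Fi f g ω ^ 2 ∂P ≤ S * (F * (∫ x, |f x|)) * (ρ ^ d * (volume (Metric.ball (0 : EE d) 1)).toReal) := by
  have F0 : 0 ≤ F := (abs_nonneg _).trans (hF 0)
  have hsq : ∀ x, Integrable (fun ω => g x ω ^ 2) P := fun x => (memLp_two_iff_integrable_sq (h.mx x).aestronglyMeasurable).1 (h.memLp x)
  have hgS : ∀ x, ∫ ω, g x ω ^ 2 ∂P ≤ S := by
    intro x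
    rw [integral_eq_lintegral_of_nonneg_ae (Eventually.of_forall fun ω => sq_nonneg _) (hsq x).1]
    exact ENNReal.toReal_le_of_le_ofReal hS (hg x)
  have hnear : ∀ x y, |∫ ω, g x ω * g y ω ∂P| ≤ S := by
    intro x y
    calc _ ≤ ∫ ω, |g x ω * g y ω| ∂P := abs_integral_le_integral_abs
      _ ≤ ∫ ω, (1/2 * g x ω ^ 2 + 1/2 * g y ω ^ 2) ∂P := by
          apply integral_mono_of_nonneg (Eventually.of_forall fun ω => abs_nonneg _) (((hsq x).const_mul _).add ((hsq y).const_mul _))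
          refine Eventually.of_forall fun ω => ?_
          change |g x ω * g y ω| ≤ 1/2 * g x ω ^2 + 1/2 * g y ω ^2
          rw [abs_mul, ← sq_abs (g x ω), ← sq_abs (g y ω)]
          nlinarith [sq_nonneg (|g x ω| - |g y ω|)]
      _ ≤ S := by
          rw [integral_add ((hsq x).const_mul _) ((hsq y).const_mul _), integral_const_mul, integral_const_mul]
          linarith [hgS x, hgS y]
  rw [h.Fi_sq hf hfi]
  have hb : ∀ p : EE d × EE d, f p.1 * f p.2 * ∫ ω, g p.1 ω * g p.2 ω ∂P ≤ (S * F) * ({p : EE d × EE d | ‖p.1 - p.2‖ < ρ}.indicator (fun p => |f p.1|) p) := by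
    intro p
    by_cases hp : ‖p.1 - p.2‖ < ρ
    · rw [Set.indicator_of_mem (by exact hp)]
      calc _ ≤ |f p.1 * f p.2 * ∫ ω, g p.1 ω * g p.2 ω ∂P| := le_abs_self _
        _ = |f p.1| * |f p.2| * |∫ ω, g p.1 ω * g p.2 ω ∂P| := by rw [abs_mul, abs_mul]
        _ ≤ |f p.1| * F * S := by
            gcongr
            · exact hF _
            · exact hnear _ _
        _ = _ := by ring
    · rw [Set.indicator_of_notMem (by exact hp), hfar _ _ (not_lt.1 hp)]; simp
  have hset : MeasurableSet {p : EE d × EE d | ‖p.1 - p.2‖ < ρ} := by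
    apply measurableSet_lt <;> fun_prop
  have mi : Measurable ({p : EE d × EE d | ‖p.1 - p.2‖ < ρ}.indicator (fun p => |f p.1|)) := Measurable.indicator (by fun_prop) hset
  have hvol : (volume (Metric.ball (0 : EE d) ρ)) = ENNReal.ofReal (ρ ^ d) * volume (Metric.ball (0 : EE d) 1) := by
    rw [Measure.addHaar_ball_of_pos _ _ hρ]; simp
  have key : ∫⁻ p, ENNReal.ofReal ({p : EE d × EE d | ‖p.1 - p.2‖ < ρ}.indicator (fun p => |f p.1|) p) ∂(volume.prod volume) =
      ENNReal.ofReal (∫ x, |f x|) * volume (Metric.ball (0 : EE d) ρ) := by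
    rw [lintegral_prod _ mi.ennreal_ofReal.aemeasurable, ofReal_integral_eq_lintegral_ofReal hfi.abs (Eventually.of_forall fun x => abs_nonneg _),
      ← lintegral_mul_const _ (by fun_prop)]
    congr 1; ext x
    have : ∀ y, ENNReal.ofReal ({p : EE d × EE d | ‖p.1 - p.2‖ < ρ}.indicator (fun p => |f p.1|) (x, y)) =
       (Metric.ball x ρ).indicator (fun _ => ENNReal.ofReal |f x|) y := by
      intro y
      by_cases hy : ‖x - y‖ < ρ
      · rw [Set.indicator_of_mem (by exact hy), Set.indicator_of_mem]
        rw [Metric.mem_ball, dist_comm, dist_eq_norm]; exact hy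
      · rw [Set.indicator_of_notMem (by exact hy), Set.indicator_of_notMem]
        · simp
        rw [Metric.mem_ball, dist_comm, dist_eq_norm]; exact hy
    simp_rw [this]
    rw [lintegral_indicator_const Metric.isOpen_ball.measurableSet, Measure.addHaar_ball_center]
  have hfin : volume (Metric.ball (0 : EE d) ρ) ≠ ⊤ := measure_ball_lt_top.ne
  have iind : Integrable ({p : EE d × EE d | ‖p.1 - p.2‖ < ρ}.indicator (fun p => |f p.1|)) (volume.prod volume) := by
    refine ⟨mi.aestronglyMeasurable, ?_⟩
    rw [hasFiniteIntegral_iff_ofReal (Eventually.of_forall fun p => Set.indicator_nonneg (fun _ _ => abs_nonneg _) _), key]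
    exact ENNReal.mul_lt_top ENNReal.ofReal_lt_top hfin.lt_top
  have hintg : ∫ p, {p : EE d × EE d | ‖p.1 - p.2‖ < ρ}.indicator (fun p => |f p.1|) p ∂(volume.prod volume) =
      (∫ x, |f x|) * (ρ ^ d * (volume (Metric.ball (0 : EE d) 1)).toReal) := by
    rw [integral_eq_lintegral_of_nonneg_ae (Eventually.of_forall fun p => Set.indicator_nonneg (fun _ _ => abs_nonneg _) _) mi.aestronglyMeasurable, key, hvol,
      ENNReal.toReal_mul, ENNReal.toReal_mul, ENNReal.toReal_ofReal (integral_nonneg fun x => abs_nonneg _), ENNReal.toReal_ofReal (by positivity : 0 ≤ ρ^d)]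
  calc _ ≤ ∫ p, (S * F) * ({p : EE d × EE d | ‖p.1 - p.2‖ < ρ}.indicator (fun p => |f p.1|) p) ∂(volume.prod volume) := by
        apply integral_mono _ (iind.const_mul _) hb
        have := (h.sq_prod hf hfi).integral_prod_right
        refine this.congr (Eventually.of_forall fun p => ?_)
        simp only
        rw [← integral_const_mul]
        congr 1; ext ω; ring
    _ = _ := by
        rw [integral_const_mul, hintg]; ring

end flds2

end DM

set_option linter.unusedSectionVars false
set_option linter.unusedVariables false

namespace DM

variable {d : ℕ} {Ω : Type*} [m0 : MeasurableSpace Ω]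

lemma HH_sq {κ : ℝ} (hκ : 0 < κ) (w : ℝ) {y τ : ℝ} (hy : 0 ≤ y) (hτ : 0 ≤ τ) (z : ℝ) :
    HH d w y τ z ^ 2 ≤ w ^ 2 * Real.exp (2 * κ * y) * (4 * κ⁻¹ ^ 2 * Real.exp (2 * κ * gam d * τ)) * Real.exp (2 * (κ + gam d) * |z|) := by
  have g0 := gam_nonneg d
  have z0 := abs_nonneg z
  have k0 : 0 < κ⁻¹ := inv_pos.2 hκ
  have hu : ∀ u : ℝ, u ≤ κ⁻¹ * Real.exp (κ * u) := by
    intro u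
    have := Real.add_one_le_exp (κ * u)
    rw [inv_mul_eq_div, le_div_iff₀ hκ]; linarith
  have hgt : 0 ≤ gam d * τ := by positivity
  set E := κ⁻¹ * Real.exp (κ * (y + gam d * τ + |z|) + gam d * |z|) with hE
  have h1 : |(y + gam d * τ - z) * Real.exp (gam d * z - d * τ)| ≤ E := by
    rw [abs_mul, abs_of_pos (Real.exp_pos _), hE, Real.exp_add, ← mul_assoc]
    gcongr
    · refine le_trans ?_ (hu _)
      rw [abs_le]; constructor <;> linarith [neg_abs_le z, le_abs_self z]
    · have : 0 ≤ (d:ℝ) * τ := by positivity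
      nlinarith [le_abs_self z]
  have h2 : |y| ≤ E := by
    rw [abs_of_nonneg hy, hE]
    refine (hu y).trans ?_
    gcongr
    have : 0 ≤ κ * (gam d * τ) + κ * |z| + gam d * |z| := by positivity
    linarith
  have h3 : |(y + gam d * τ - z) * Real.exp (gam d * z - d * τ) - y| ≤ 2 * E := by
    refine (abs_sub _ _).trans ?_; linarith
  have hEE : (2 * E) ^ 2 = Real.exp (2 * κ * y) * (4 * κ⁻¹ ^ 2 * Real.exp (2 * κ * gam d * τ)) * Real.exp (2 * (κ + gam d) * |z|) := by
    have : Real.exp (2 * κ * y) * (4 * κ⁻¹ ^ 2 * Real.exp (2 * κ * gam d * τ)) * Real.exp (2 * (κ + gam d) * |z|) =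
      4 * κ⁻¹ ^ 2 * (Real.exp (2 * κ * y) * Real.exp (2 * κ * gam d * τ) * Real.exp (2 * (κ + gam d) * |z|)) := by ring
    rw [this, ← Real.exp_add, ← Real.exp_add, hE, mul_pow, mul_pow, ← Real.exp_nat_mul]
    have e : (↑(2:ℕ) : ℝ) * (κ * (y + gam d * τ + |z|) + gam d * |z|) = 2 * κ * y + 2 * κ * gam d * τ + 2 * (κ + gam d) * |z| := by push_cast; ring
    rw [e]; ring
  unfold HH
  rw [mul_pow, mul_assoc (w^2), mul_assoc (w^2), ← hEE]
  exact mul_le_mul_of_nonneg_left (sq_le_sq' (abs_le.1 h3).1 (abs_le.1 h3).2) (sq_nonneg _)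

lemma gauss_abs {v : NNReal} (hv : v ≠ 0) (c : ℝ) :
    ∫⁻ z, ENNReal.ofReal (Real.exp (c * |z|)) ∂(gaussianReal 0 v) ≤ ENNReal.ofReal (2 * Real.exp (c ^ 2 * v / 2)) := by
  calc _ ≤ ∫⁻ z, (ENNReal.ofReal (Real.exp (c * z)) + ENNReal.ofReal (Real.exp ((-c) * z))) ∂(gaussianReal 0 v) := by
        apply lintegral_mono; intro z
        simp only
        rcases abs_choice z with e | e <;> rw [e]
        · exact le_self_add
        · rw [show c * -z = -c * z by ring]; exact le_add_self
    _ = _ := by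
        rw [lintegral_add_left (by fun_prop), gauss_exp hv, gauss_exp hv, ← ENNReal.ofReal_add (by positivity) (by positivity)]
        congr 1
        rw [neg_sq]; ring

/-- survival-truncated increment -/
def hh (X : ℝ → EE d → Ω → ℝ) (q : ℝ) (n : ℕ) (t : ℝ) (x : EE d) (ω : Ω) : ℝ :=
  (surv X q n x).indicator (fun ω => psi X q t x ω - psi X q (tt n) x ω) ω

/-- survival-truncated negative part -/
def nn (X : ℝ → EE d → Ω → ℝ) (q : ℝ) (n : ℕ) (t : ℝ) (x : EE d) (ω : Ω) : ℝ :=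
  (surv X q n x).indicator (fun ω => max (-(psi X q t x ω)) 0) ω

def Cs (d : ℕ) (q : ℝ) : ℝ := Real.exp (gam d * q) * (4 * (gam d / 4)⁻¹ ^ 2 * Real.exp (2 * (gam d / 4) * gam d * Real.log 2)) *
  (2 * Real.exp ((2 * (gam d / 4 + gam d)) ^ 2 * Real.log 2 / 2))

lemma Cs_nonneg (d : ℕ) (q : ℝ) : 0 ≤ Cs d q := by unfold Cs; positivity

lemma wt_sq_eq (X : ℝ → EE d → Ω → ℝ) (q t : ℝ) (x : EE d) (ω : Ω) :
    wt X t x ω ^ 2 * Real.exp (2 * (gam d / 4) * Yq X q t x ω) =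
      Real.exp (gam d * q) * Real.exp (d * t) * (wt X t x ω * Real.exp (-(gam d / 2) * Yq X q t x ω)) := by
  unfold wt Yq
  rw [← Real.exp_nat_mul, ← Real.exp_add, ← Real.exp_add, ← Real.exp_add, ← Real.exp_add]
  congr 1
  have := gam_sq d
  push_cast
  linear_combination t * this

lemma ell_nn : (Real.log 2).toNNReal ≠ 0 := by simpa using ell_pos
lemma ell_coe : ((Real.log 2).toNNReal : ℝ) = Real.log 2 := Real.coe_toNNReal _ ell_pos.le

lemma hh_sq {P : Measure Ω} {X : ℝ → EE d → Ω → ℝ} {L R : ℝ} (h : Setup P X L R) (hd : 1 ≤ d) (q : ℝ) (n : ℕ) (x : EE d) :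
    ∫⁻ ω, ENNReal.ofReal (hh X q n (tt (n+1)) x ω ^ 2) ∂P ≤ ENNReal.ofReal (Cs d q * Real.exp (d * tt n) * gg P X q (gam d / 2) n 0) := by
  have gp := gam_pos hd
  have hB := meas_surv_Fil X q n le_rfl x
  have hB0 := meas_surv h q n x
  have hτ : tt (n+1) - tt n = Real.log 2 := by rw [tt_succ]; ring
  have mH : Measurable fun p : (ℝ × ℝ) × ℝ => ENNReal.ofReal (HH d p.1.1 p.1.2 (tt (n+1) - tt n) p.2 ^ 2) :=
    ((meas_HH d (tt (n+1) - tt n)).pow_const 2).ennreal_ofReal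
  have e0 : ∀ ω, hh X q n (tt (n+1)) x ω = HH d ((surv X q n x).indicator (wt X (tt n) x) ω) (Yq X q (tt n) x ω) (tt (n+1) - tt n) (X (tt (n+1)) x ω - X (tt n) x ω) :=
    fun ω => ind_psi X q (tt n) (tt (n+1)) x _ ω
  simp_rw [e0]
  rw [step0 h (tt_nonneg n) (tt_lt_succ n) x (Fil_V X q (tt_nonneg n) x hB) mH, hτ]
  set A := 4 * (gam d / 4)⁻¹ ^ 2 * Real.exp (2 * (gam d / 4) * gam d * Real.log 2) with hA
  have hA0 : 0 ≤ A := by positivity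
  set G := 2 * Real.exp ((2 * (gam d / 4 + gam d)) ^ 2 * Real.log 2 / 2) with hG
  have key : ∀ ω, ∫⁻ z, ENNReal.ofReal (HH d ((surv X q n x).indicator (wt X (tt n) x) ω) (Yq X q (tt n) x ω) (Real.log 2) z ^ 2) ∂(gaussianReal 0 (Real.log 2).toNNReal) ≤
      (surv X q n x).indicator (fun ω => ENNReal.ofReal (Cs d q * Real.exp (d * tt n)) * (ENNReal.ofReal (wt X (tt n) x ω) * ENNReal.ofReal (Real.exp (-(gam d / 2) * Yq X q (tt n) x ω)))) ω := by
    intro ω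
    by_cases hω : ω ∈ surv X q n x
    · rw [Set.indicator_of_mem hω, Set.indicator_of_mem hω]
      have y0 : 0 ≤ Yq X q (tt n) x ω := hω n le_rfl
      calc _ ≤ ∫⁻ z, ENNReal.ofReal (wt X (tt n) x ω ^ 2 * Real.exp (2 * (gam d / 4) * Yq X q (tt n) x ω) * A) * ENNReal.ofReal (Real.exp (2 * (gam d / 4 + gam d) * |z|)) ∂(gaussianReal 0 (Real.log 2).toNNReal) := by
            apply lintegral_mono; intro z
            simp only
            rw [← ENNReal.ofReal_mul (by positivity)]
            exact ENNReal.ofReal_le_ofReal (HH_sq (by positivity) _ y0 ell_pos.le z)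
        _ ≤ ENNReal.ofReal (wt X (tt n) x ω ^ 2 * Real.exp (2 * (gam d / 4) * Yq X q (tt n) x ω) * A) * ENNReal.ofReal G := by
            rw [lintegral_const_mul _ (by fun_prop)]
            gcongr
            have := gauss_abs ell_nn (2 * (gam d / 4 + gam d))
            rwa [ell_coe] at this
        _ = _ := by
            have w0 := wt_pos X (tt n) x ω
            rw [wt_sq_eq, ← ENNReal.ofReal_mul (by positivity), ← ENNReal.ofReal_mul w0.le, ← ENNReal.ofReal_mul (by have := Cs_nonneg d q; positivity)]
            congr 1
            unfold Cs; rw [hA, hG]; ring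
    · rw [Set.indicator_of_notMem hω, Set.indicator_of_notMem hω]
      simp [HH]
  refine (lintegral_mono key).trans ?_
  rw [lintegral_indicator hB0, lintegral_const_mul' _ _ ENNReal.ofReal_ne_top,
    ENNReal.ofReal_mul (p := Cs d q * Real.exp (d * tt n)) (by have := Cs_nonneg d q; positivity)]
  refine le_of_eq (congrArg _ ?_)
  unfold gg
  rw [ENNReal.ofReal_toReal (ggE_ne_top h q (by positivity) n 0), ← ggE_const h q _ n x]
  rfl

def Cn (d : ℕ) : ℝ := (gam d / 2)⁻¹ * Real.exp ((gam d / 2) ^ 2 * Real.log 2 / 2)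

lemma Cn_nonneg (d : ℕ) : 0 ≤ Cn d := by unfold Cn; have := gam_nonneg d; positivity

lemma nn_le {P : Measure Ω} {X : ℝ → EE d → Ω → ℝ} {L R : ℝ} (h : Setup P X L R) (hd : 1 ≤ d) (q : ℝ) (n : ℕ) (x : EE d) :
    ∫⁻ ω, ENNReal.ofReal (nn X q n (tt (n+1)) x ω) ∂P ≤ ENNReal.ofReal (Cn d * gg P X q (gam d / 2) n 0) := by
  have gp := gam_pos hd
  have hB := meas_surv_Fil X q n le_rfl x
  have hB0 := meas_surv h q n x
  have hτ : tt (n+1) - tt n = Real.log 2 := by rw [tt_succ]; ring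
  have e0 : ∀ ω, ENNReal.ofReal (nn X q n (tt (n+1)) x ω) = (surv X q n x).indicator (fun ω => ENNReal.ofReal (wt X (tt (n+1)) x ω) * ENNReal.ofReal (max (-(Yq X q (tt (n+1)) x ω)) 0)) ω := by
    intro ω
    unfold nn
    by_cases hω : ω ∈ surv X q n x
    · rw [Set.indicator_of_mem hω, Set.indicator_of_mem hω]
      have w0 := wt_pos X (tt (n+1)) x ω
      rw [← ENNReal.ofReal_mul w0.le, mul_max_of_nonneg _ _ w0.le, mul_zero]
      unfold psi
      congr 2; ring
    · rw [Set.indicator_of_notMem hω, Set.indicator_of_notMem hω]; simp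
  simp_rw [e0]
  rw [lintegral_indicator hB0, step1 h q (tt_nonneg n) (tt_lt_succ n) x hB (F := fun u => ENNReal.ofReal (max (-u) 0)) (by fun_prop), hτ]
  have key : ∀ y : ℝ, ∫⁻ z, ENNReal.ofReal (max (-(y + z)) 0) ∂(gaussianReal 0 (Real.log 2).toNNReal) ≤
      ENNReal.ofReal (Cn d) * ENNReal.ofReal (Real.exp (-(gam d / 2) * y)) := by
    intro y
    set θ := gam d / 2 with hθ
    have t0 : 0 < θ := by positivity
    calc _ ≤ ∫⁻ z, ENNReal.ofReal (θ⁻¹ * Real.exp (-θ * y)) * ENNReal.ofReal (Real.exp (-θ * z)) ∂(gaussianReal 0 (Real.log 2).toNNReal) := by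
          apply lintegral_mono; intro z
          simp only
          rw [← ENNReal.ofReal_mul (by positivity)]
          apply ENNReal.ofReal_le_ofReal
          rw [mul_assoc, ← Real.exp_add]
          apply max_le _ (by positivity)
          have := Real.add_one_le_exp (-θ * y + -θ * z)
          rw [inv_mul_eq_div, le_div_iff₀ t0]; linarith
      _ = _ := by
          rw [lintegral_const_mul _ (by fun_prop), gauss_exp ell_nn, ell_coe, ← ENNReal.ofReal_mul (by positivity), ← ENNReal.ofReal_mul (Cn_nonneg d)]
          congr 1
          unfold Cn; rw [← hθ, neg_sq]; ring
  calc _ ≤ ∫⁻ ω in surv X q n x, ENNReal.ofReal (Cn d) * (ENNReal.ofReal (wt X (tt n) x ω) * ENNReal.ofReal (Real.exp (-(gam d / 2) * Yq X q (tt n) x ω))) ∂P := by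
        apply lintegral_mono; intro ω
        simp only
        rw [mul_left_comm]
        gcongr
        exact key _
    _ = _ := by
        rw [lintegral_const_mul' _ _ ENNReal.ofReal_ne_top, ENNReal.ofReal_mul (Cn_nonneg d)]
        congr 1
        unfold gg
        rw [ENNReal.ofReal_toReal (ggE_ne_top h q (by positivity) n 0), ← ggE_const h q _ n x]
        rfl

section jm
lemma JM_ind' {Ω' : Type*} [MeasurableSpace Ω'] {X : ℝ → EE d → Ω' → ℝ} {q : ℝ} {n : ℕ} {g : EE d → Ω' → ℝ}
    (hY : ∀ i ≤ n, Measurable (fun p : Ω' × EE d => Yq X q (tt i) p.2 p.1))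
    (hg : Measurable (fun p : Ω' × EE d => g p.2 p.1)) :
    Measurable (fun p : Ω' × EE d => (surv X q n p.2).indicator (g p.2) p.1) := by
  have hs : MeasurableSet {p : Ω' × EE d | ∀ i ≤ n, 0 ≤ Yq X q (tt i) p.2 p.1} := by
    have : {p : Ω' × EE d | ∀ i ≤ n, 0 ≤ Yq X q (tt i) p.2 p.1} = ⋂ i ∈ Set.Iic n, {p : Ω' × EE d | 0 ≤ Yq X q (tt i) p.2 p.1} := by
      ext p; simp
    rw [this]
    exact MeasurableSet.biInter (Set.to_countable _) fun i hi => measurableSet_le measurable_const (hY i hi)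
  have := hg.indicator hs
  exact this

lemma JM_ind {m : MeasurableSpace Ω} {X : ℝ → EE d → Ω → ℝ} {q : ℝ} {n : ℕ} {g : EE d → Ω → ℝ}
    (hY : ∀ i ≤ n, JM m (Yq X q (tt i))) (hg : JM m g) : JM m (fun x ω => (surv X q n x).indicator (g x) ω) :=
  @JM_ind' d Ω m X q n g hY hg

lemma JM_max' {Ω' : Type*} [MeasurableSpace Ω'] {g : EE d → Ω' → ℝ}
    (hg : Measurable (fun p : Ω' × EE d => g p.2 p.1)) : Measurable (fun p : Ω' × EE d => max (-(g p.2 p.1)) 0) :=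
  hg.neg.max measurable_const
lemma JM_max {m : MeasurableSpace Ω} {g : EE d → Ω → ℝ} (hg : JM m g) : JM m (fun x ω => max (-(g x ω)) 0) :=
  @JM_max' d Ω m g hg
end jm

lemma JM_Yq {P : Measure Ω} {X : ℝ → EE d → Ω → ℝ} {L R : ℝ} (h : Setup P X L R) (q : ℝ) {n : ℕ} {t : ℝ} (ht : tt n ≤ t) :
    ∀ i ≤ n, JM (Fil X t) (Yq X q (tt i)) := by
  intro i hi
  refine JM_of_cont (fun x => meas_Yq_Fil X q (tt_nonneg i) ((tt_mono hi).trans ht) x) fun ω => ?_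
  have := cont_X h (tt i) ω
  unfold Yq; fun_prop

lemma hh_fld {P : Measure Ω} {X : ℝ → EE d → Ω → ℝ} {L R : ℝ} (h : Setup P X L R) (q : ℝ) (n : ℕ) {t u : ℝ} (ht : tt n ≤ t) (hu : t ≤ u) :
    Fld (Fil X u) P (hh X q n t) := by
  have t0 := (tt_nonneg n).trans ht
  have f1 := (psi_fld h q t0 hu).sub (psi_fld h q (tt_nonneg n) (ht.trans hu))
  refine f1.of_le le_rfl (Fil_le h.meas u) (JM_ind (JM_Yq h q (ht.trans hu)) f1.jm) fun x ω => ?_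
  unfold hh Set.indicator; split_ifs <;> simp

lemma nn_fld {P : Measure Ω} {X : ℝ → EE d → Ω → ℝ} {L R : ℝ} (h : Setup P X L R) (q : ℝ) (n : ℕ) {t u : ℝ} (ht : tt n ≤ t) (hu : t ≤ u) :
    Fld (Fil X u) P (nn X q n t) := by
  have t0 := (tt_nonneg n).trans ht
  have f1 := psi_fld h q t0 hu
  refine f1.of_le le_rfl (Fil_le h.meas u) (JM_ind (JM_Yq h q (ht.trans hu)) (JM_max f1.jm)) fun x ω => ?_
  unfold nn Set.indicator; split_ifs
  · rw [abs_of_nonneg (le_max_right _ _)]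
    exact max_le (neg_le_abs _) (abs_nonneg _)
  · simp

/-- final second moment bound for the truncated increments -/
lemma xi_sq {P : Measure Ω} {X : ℝ → EE d → Ω → ℝ} {L R : ℝ} (h : Setup P X L R) (hd : 1 ≤ d) (q : ℝ) {f : EE d → ℝ} (hf : Measurable f)
    (hfi : Integrable f) {F : ℝ} (hF : ∀ x, |f x| ≤ F) : ∃ C, 0 ≤ C ∧ ∀ n : ℕ, ∫ ω, Fi f (hh X q n (tt (n+1))) ω ^ 2 ∂P ≤ C * gg P X q (gam d / 2) n 0 := by
  have := h.prob
  have F0 : 0 ≤ F := (abs_nonneg _).trans (hF 0)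
  refine ⟨Cs d q * (F * (∫ x, |f x|)) * (R ^ d * (volume (Metric.ball (0 : EE d) 1)).toReal), ?_, fun n => ?_⟩
  · have := Cs_nonneg d q
    have := h.Rpos
    have : 0 ≤ ∫ x, |f x| := integral_nonneg fun x => abs_nonneg _
    positivity
  have g0 := gg_nonneg P X q (gam d / 2) n 0
  have C0 := Cs_nonneg d q
  have fl := hh_fld h q n (tt_lt_succ n).le (le_refl (tt (n+1)))
  refine (fl.Fi_sq_le hf hfi hF (S := Cs d q * Real.exp (d * tt n) * gg P X q (gam d / 2) n 0) (ρ := R * Real.exp (-tt n)) (by positivity) (mul_pos h.Rpos (Real.exp_pos _))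
    (hh_sq h hd q n) (fun x y hxy => far_zero h q (tt_nonneg n) (tt_lt_succ n) x y (meas_surv_Fil X q n le_rfl x) (meas_surv_Fil X q n le_rfl y) hxy)).trans (le_of_eq ?_)
  rw [mul_pow, ← Real.exp_nat_mul]
  have : Real.exp (d * tt n) * Real.exp (d * -tt n) = 1 := by rw [← Real.exp_add]; simp
  linear_combination (Cs d q * (gg P X q (gam d / 2) n 0) * (F * (∫ x, |f x|)) * (R ^ d * (volume (Metric.ball (0 : EE d) 1)).toReal)) * this

lemma nu_int {P : Measure Ω} {X : ℝ → EE d → Ω → ℝ} {L R : ℝ} (h : Setup P X L R) (hd : 1 ≤ d) (q : ℝ) {f : EE d → ℝ} (hf : Measurable f)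
    (hfi : Integrable f) (hf0 : ∀ x, 0 ≤ f x) : ∃ C, 0 ≤ C ∧ ∀ n : ℕ, ∫ ω, Fi f (nn X q n (tt (n+1))) ω ∂P ≤ C * gg P X q (gam d / 2) n 0 := by
  have := h.prob
  refine ⟨(∫ x, f x) * Cn d, mul_nonneg (integral_nonneg hf0) (Cn_nonneg d), fun n => ?_⟩
  have fl := nn_fld h q n (tt_lt_succ n).le (le_refl (tt (n+1)))
  have e := fl.set_int hf hfi (MeasurableSet.univ)
  simp only [Measure.restrict_univ] at e
  rw [e, mul_assoc, ← integral_mul_const]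
  have n0 : ∀ x ω, 0 ≤ nn X q n (tt (n+1)) x ω := fun x ω => Set.indicator_nonneg (fun _ _ => le_max_right _ _) _
  apply integral_mono_of_nonneg
  · exact Eventually.of_forall fun x => mul_nonneg (hf0 x) (integral_nonneg (n0 x))
  · exact hfi.mul_const _
  · refine Eventually.of_forall fun x => mul_le_mul_of_nonneg_left ?_ (hf0 x)
    rw [integral_eq_lintegral_of_nonneg_ae (Eventually.of_forall (n0 x)) (fl.mx x).aestronglyMeasurable]
    exact ENNReal.toReal_le_of_le_ofReal (mul_nonneg (Cn_nonneg d) (gg_nonneg _ _ _ _ _ _)) (nn_le h hd q n x)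

end DM

set_option linter.unusedSectionVars false
set_option linter.unusedVariables false

namespace DM

section generic
variable {Ω : Type*} {m m' : MeasurableSpace Ω} [m0 : MeasurableSpace Ω]

lemma orth {P : Measure Ω} [IsProbabilityMeasure P] (hm : m ≤ m0) {U V : Ω → ℝ} (hU : StronglyMeasurable[m] U)
    (hU2 : MemLp U 2 P) (hV2 : MemLp V 2 P) (h0 : ∀ B, MeasurableSet[m] B → ∫ ω in B, V ω ∂P = 0) :
    ∫ ω, U ω * V ω ∂P = 0 := by
  have hV : Integrable V P := hV2.integrable one_le_two
  have hUV : Integrable (U * V) P := hU2.integrable_mul hV2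
  have hc : (fun _ => (0:ℝ)) =ᵐ[P] P[V | m] := by
    refine ae_eq_condExp_of_forall_setIntegral_eq hm hV (fun s _ _ => integrableOn_zero) (fun s hs _ => ?_) (stronglyMeasurable_const.aestronglyMeasurable)
    rw [h0 s hs]; simp
  have h1 := condExp_mul_of_stronglyMeasurable_left hU hUV hV
  have : ∫ ω, (U * V) ω ∂P = 0 := by
    rw [← integral_condExp hm]
    rw [integral_congr_ae (g := fun _ => (0:ℝ))]
    · simp
    filter_upwards [h1, hc] with ω e1 e2
    rw [e1, Pi.mul_apply, ← e2, mul_zero]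
  exact this

lemma maxdy {P : Measure Ω} [IsProbabilityMeasure P] {F : ℝ → MeasurableSpace Ω} (hF : Monotone F) (hle : ∀ t, F t ≤ m0)
    {a b : ℝ} (hab : a < b) {Z : ℝ → Ω → ℝ} (hm : ∀ t, a ≤ t → StronglyMeasurable[F t] (Z t))
    (hi : ∀ t, a ≤ t → Integrable (Z t) P) (h0 : ∀ t ω, 0 ≤ Z t ω)
    (hsub : ∀ s t, a ≤ s → s ≤ t → ∀ B, MeasurableSet[F s] B → ∫ ω in B, Z s ω ∂P ≤ ∫ ω in B, Z t ω ∂P) {ε : ℝ} (hε : 0 < ε) :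
    P {ω | ∃ k j : ℕ, j ≤ 2 ^ k ∧ ε ≤ Z (a + j * ((b - a) / 2 ^ k)) ω} ≤ ENNReal.ofReal ((∫ ω, Z b ω ∂P) / ε) := by
  set A : ℕ → Set Ω := fun k => {ω | ∃ j : ℕ, j ≤ 2 ^ k ∧ ε ≤ Z (a + j * ((b - a) / 2 ^ k)) ω} with hA
  have e1 : {ω | ∃ k j : ℕ, j ≤ 2 ^ k ∧ ε ≤ Z (a + j * ((b - a) / 2 ^ k)) ω} = ⋃ k, A k := by
    ext ω; simp [hA]
  have hmono : Monotone A := by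
    refine monotone_nat_of_le_succ fun k ω => ?_
    rintro ⟨j, hj, hz⟩
    refine ⟨2 * j, by rw [pow_succ]; omega, ?_⟩
    convert hz using 3
    push_cast
    rw [pow_succ]; field_simp
  rw [e1, hmono.measure_iUnion]
  refine iSup_le fun k => ?_
  set τ : ℕ → ℝ := fun j => a + j * ((b - a) / 2 ^ k) with hτ
  have hδ : 0 ≤ (b - a) / 2 ^ k := div_nonneg (by linarith) (by positivity)
  have τm : Monotone τ := by
    intro i j hij
    simp only [hτ]
    gcongr
  have τa : ∀ j, a ≤ τ j := fun j => by simp only [hτ]; have : 0 ≤ (j:ℝ) * ((b - a) / 2 ^ k) := by positivity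
                                        linarith
  have τb : τ (2 ^ k) = b := by simp only [hτ]; push_cast; field_simp; ring
  let 𝒢 : Filtration ℕ m0 := ⟨fun j => F (τ j), fun i j hij => hF (τm hij), fun j => hle _⟩
  have sub : Submartingale (fun j => Z (τ j)) 𝒢 P :=
    submartingale_of_setIntegral_le_succ (fun j => hm _ (τa j)) (fun j => hi _ (τa j))
      (fun j B hB => hsub _ _ (τa j) (τm (Nat.le_succ j)) B hB)
  have mi := maximal_ineq sub (fun j ω => h0 _ _) (ε := ε.toNNReal) (2 ^ k)
  have hsubset : A k ⊆ {ω | ((ε.toNNReal : NNReal) : ℝ) ≤ (Finset.range (2 ^ k + 1)).sup' Finset.nonempty_range_add_one fun j => Z (τ j) ω} := by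
    rintro ω ⟨j, hj, hz⟩
    simp only [Set.mem_setOf_eq, Real.coe_toNNReal _ hε.le]
    exact le_trans hz (Finset.le_sup' (fun j => Z (τ j) ω) (Finset.mem_range.2 (by omega)))
  have h2 : ENNReal.ofReal ε * P (A k) ≤ ENNReal.ofReal (∫ ω, Z b ω ∂P) := by
    calc _ ≤ ENNReal.ofReal ε * P {ω | ((ε.toNNReal : NNReal) : ℝ) ≤ (Finset.range (2 ^ k + 1)).sup' Finset.nonempty_range_add_one fun j => Z (τ j) ω} := by
          exact mul_le_mul_right (measure_mono hsubset) _
      _ ≤ _ := mi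
      _ ≤ _ := by
          apply ENNReal.ofReal_le_ofReal
          rw [τb]
          exact setIntegral_le_integral (hi b hab.le) (Eventually.of_forall fun ω => h0 _ _)
  rw [ENNReal.ofReal_div_of_pos hε, ENNReal.le_div_iff_mul_le (Or.inl (by simpa using hε)) (Or.inl ENNReal.ofReal_ne_top), mul_comm]
  exact h2

/-- extension from dyadic times by continuity -/
lemma dy_dense {a b : ℝ} (hab : a < b) {Z : ℝ → ℝ} (hc : Continuous Z) {ε : ℝ} (hz : ∀ k j : ℕ, j ≤ 2 ^ k → Z (a + j * ((b - a) / 2 ^ k)) < ε) :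
    ∀ t ∈ Set.Icc a b, Z t ≤ ε := by
  intro t ht
  have hpos : 0 < b - a := by linarith
  set r := (t - a) / (b - a) with hr
  have r0 : 0 ≤ r := div_nonneg (by linarith [ht.1]) hpos.le
  have r1 : r ≤ 1 := by rw [hr, div_le_one hpos]; linarith [ht.2]
  set τ : ℕ → ℝ := fun k => a + (⌊r * 2 ^ k⌋₊ : ℝ) * ((b - a) / 2 ^ k) with hτ
  have lim : Tendsto τ atTop (nhds t) := by
    have h1 : Tendsto (fun k : ℕ => (⌊r * (2:ℝ) ^ k⌋₊ : ℝ) / (2:ℝ) ^ k) atTop (nhds r) :=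
      (tendsto_nat_floor_mul_div_atTop r0).comp (tendsto_pow_atTop_atTop_of_one_lt (by norm_num : (1:ℝ) < 2))
    have h2 := (h1.mul_const (b - a)).const_add a
    have e : a + r * (b - a) = t := by rw [hr]; field_simp; ring
    rw [e] at h2
    refine h2.congr fun k => ?_
    simp only [hτ]; ring
  refine le_of_tendsto ((hc.tendsto t).comp lim) (Eventually.of_forall fun k => (hz k _ ?_).le)
  refine Nat.floor_le_of_le ?_
  push_cast
  have : (0:ℝ) < 2 ^ k := by positivity
  nlinarith

lemma Fld.setint_int {d : ℕ} {P : Measure Ω} [IsProbabilityMeasure P] {g : EE d → Ω → ℝ} (fl : Fld m P g) {f : EE d → ℝ} (hf : Measurable f)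
    (hfi : Integrable f) {B : Set Ω} : Integrable (fun x => f x * ∫ ω in B, g x ω ∂P) := by
  have h1 : Integrable (fun p : Ω × EE d => f p.2 * g p.2 p.1) ((P.restrict B).prod volume) := by
    have e : (P.restrict B).prod (volume : Measure (EE d)) = (P.prod volume).restrict (B ×ˢ Set.univ) := by
      rw [← Measure.prod_restrict, Measure.restrict_univ]
    rw [e]; exact (fl.int_prod hf hfi).integrableOn
  have := h1.integral_prod_right
  refine this.congr (Eventually.of_forall fun x => ?_)
  simp only
  rw [← integral_const_mul]

end generic

variable {d : ℕ} {Ω : Type*} [m0 : MeasurableSpace Ω]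

lemma gg_summable {P : Measure Ω} {X : ℝ → EE d → Ω → ℝ} {L R : ℝ} (h : Setup P X L R) (hd : 1 ≤ d) (q : ℝ) :
    Summable fun n => gg P X q (gam d / 2) n 0 :=
  summable_of_sum_range_le (fun n => gg_nonneg _ _ _ _ _ _) fun N => green h q (by have := gam_pos hd; positivity) 0 N

lemma psi_int {P : Measure Ω} {X : ℝ → EE d → Ω → ℝ} {L R : ℝ} (h : Setup P X L R) (q : ℝ) {t : ℝ} (ht : 0 ≤ t) (x : EE d) : Integrable (psi X q t x) P := by
  have := h.prob
  exact ((psi_fld h q ht le_rfl).memLp x).integrable one_le_two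

lemma hh_ML {P : Measure Ω} {X : ℝ → EE d → Ω → ℝ} {L R : ℝ} (h : Setup P X L R) (q : ℝ) (n : ℕ) {s t : ℝ} (hs : tt n ≤ s) (hst : s ≤ t) (x : EE d)
    {B : Set Ω} (hB : MeasurableSet[Fil X s] B) : ∫ ω in B, hh X q n t x ω ∂P = ∫ ω in B, hh X q n s x ω ∂P := by
  have s0 := (tt_nonneg n).trans hs
  have hS := meas_surv h q n x
  have hBS : MeasurableSet[Fil X s] (B ∩ surv X q n x) := hB.inter (meas_surv_Fil X q n hs x)
  unfold hh
  rw [setIntegral_indicator hS, setIntegral_indicator hS,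
    integral_sub (psi_int h q (s0.trans hst) x).integrableOn (psi_int h q (tt_nonneg n) x).integrableOn,
    integral_sub (psi_int h q s0 x).integrableOn (psi_int h q (tt_nonneg n) x).integrableOn, ML h q s0 hst x hBS]

lemma hh_zero (X : ℝ → EE d → Ω → ℝ) (q : ℝ) (n : ℕ) (x : EE d) (ω : Ω) : hh X q n (tt n) x ω = 0 := by
  unfold hh; simp [Set.indicator]

lemma xi_ML {P : Measure Ω} {X : ℝ → EE d → Ω → ℝ} {L R : ℝ} (h : Setup P X L R) (q : ℝ) (n : ℕ) {s t : ℝ} (hs : tt n ≤ s) (hst : s ≤ t) {f : EE d → ℝ} (hf : Measurable f)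
    (hfi : Integrable f) {B : Set Ω} (hB : MeasurableSet[Fil X s] B) : ∫ ω in B, Fi f (hh X q n t) ω ∂P = ∫ ω in B, Fi f (hh X q n s) ω ∂P := by
  have := h.prob
  have hB0 := Fil_le h.meas s _ hB
  rw [(hh_fld h q n (hs.trans hst) le_rfl).set_int hf hfi hB0, (hh_fld h q n hs le_rfl).set_int hf hfi hB0]
  simp_rw [hh_ML h q n hs hst _ hB]

lemma nn_ML {P : Measure Ω} {X : ℝ → EE d → Ω → ℝ} {L R : ℝ} (h : Setup P X L R) (q : ℝ) (n : ℕ) {s t : ℝ} (hs : tt n ≤ s) (hst : s ≤ t) (x : EE d)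
    {B : Set Ω} (hB : MeasurableSet[Fil X s] B) : ∫ ω in B, nn X q n s x ω ∂P ≤ ∫ ω in B, nn X q n t x ω ∂P := by
  have := h.prob
  have s0 := (tt_nonneg n).trans hs
  have hS := meas_surv h q n x
  have hN : MeasurableSet[Fil X s] {ω | psi X q s x ω < 0} := by
    have := meas_psi_Fil X q s0 le_rfl x
    exact measurableSet_lt this measurable_const
  have hN0 := Fil_le h.meas s _ hN
  have hBS : MeasurableSet[Fil X s] (B ∩ surv X q n x ∩ {ω | psi X q s x ω < 0}) := (hB.inter (meas_surv_Fil X q n hs x)).inter hN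
  have i1 := psi_int h q s0 x
  have i2 := psi_int h q (s0.trans hst) x
  have j2 : Integrable (fun ω => max (-(psi X q t x ω)) 0) P := i2.neg.sup (integrable_zero _ _ _)
  unfold nn
  rw [setIntegral_indicator hS, setIntegral_indicator hS]
  have e1 : ∀ ω, max (-(psi X q s x ω)) 0 = {ω | psi X q s x ω < 0}.indicator (fun ω => -(psi X q s x ω)) ω := by
    intro ω
    by_cases hω : psi X q s x ω < 0
    · rw [Set.indicator_of_mem (by exact hω), max_eq_left (by linarith)]
    · rw [Set.indicator_of_notMem (by exact hω), max_eq_right (by linarith)]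
  simp_rw [e1]
  rw [setIntegral_indicator hN0, integral_neg, ← ML h q s0 hst x hBS, ← integral_neg]
  calc _ ≤ ∫ ω in B ∩ surv X q n x ∩ {ω | psi X q s x ω < 0}, max (-(psi X q t x ω)) 0 ∂P :=
        integral_mono i2.neg.integrableOn j2.integrableOn (fun ω => le_max_left _ _)
    _ ≤ _ := setIntegral_mono_set j2.integrableOn (Eventually.of_forall fun ω => le_max_right _ _) (Set.inter_subset_left.eventuallyLE)

lemma nu_ML {P : Measure Ω} {X : ℝ → EE d → Ω → ℝ} {L R : ℝ} (h : Setup P X L R) (q : ℝ) (n : ℕ) {s t : ℝ} (hs : tt n ≤ s) (hst : s ≤ t) {f : EE d → ℝ} (hf : Measurable f)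
    (hfi : Integrable f) (hf0 : ∀ x, 0 ≤ f x) {B : Set Ω} (hB : MeasurableSet[Fil X s] B) : ∫ ω in B, Fi f (nn X q n s) ω ∂P ≤ ∫ ω in B, Fi f (nn X q n t) ω ∂P := by
  have := h.prob
  have hB0 := Fil_le h.meas s _ hB
  have f1 := nn_fld h q n hs le_rfl
  have f2 := nn_fld h q n (hs.trans hst) (le_refl t)
  rw [f2.set_int hf hfi hB0, f1.set_int hf hfi hB0]
  apply integral_mono (f1.setint_int hf hfi) (f2.setint_int hf hfi)
  intro x
  exact mul_le_mul_of_nonneg_left (nn_ML h q n hs hst x hB) (hf0 x)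

lemma xi_memLp {P : Measure Ω} {X : ℝ → EE d → Ω → ℝ} {L R : ℝ} (h : Setup P X L R) (q : ℝ) (n : ℕ) {t : ℝ} (ht : tt n ≤ t) {f : EE d → ℝ} (hf : Measurable f)
    (hfi : Integrable f) : MemLp (Fi f (hh X q n t)) 2 P := by
  have := h.prob
  have fl := hh_fld h q n ht le_rfl
  exact (memLp_two_iff_integrable_sq (((Fi_sm fl.jm hf).mono fl.le).aestronglyMeasurable)).2 (fl.Fi_sq_int hf hfi)

lemma xi_sq_sub {P : Measure Ω} {X : ℝ → EE d → Ω → ℝ} {L R : ℝ} (h : Setup P X L R) (q : ℝ) (n : ℕ) {s t : ℝ} (hs : tt n ≤ s) (hst : s ≤ t) {f : EE d → ℝ} (hf : Measurable f)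
    (hfi : Integrable f) {B : Set Ω} (hB : MeasurableSet[Fil X s] B) : ∫ ω in B, Fi f (hh X q n s) ω ^ 2 ∂P ≤ ∫ ω in B, Fi f (hh X q n t) ω ^ 2 ∂P := by
  have := h.prob
  have hB0 := Fil_le h.meas s _ hB
  have l1 := xi_memLp h q n hs hf hfi
  have l2 := xi_memLp h q n (hs.trans hst) hf hfi
  set U := Fi f (hh X q n s) with hU
  set V := Fi f (hh X q n t) with hV
  have sm : StronglyMeasurable[Fil X s] U := Fi_sm (hh_fld h q n hs le_rfl).jm hf
  have o := orth (Fil_le h.meas s) (U := B.indicator U) (V := V - U) (sm.indicator hB) (l1.indicator hB0) (l2.sub l1) (by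
    intro B' hB'
    have : ∫ ω in B', (V - U) ω ∂P = ∫ ω in B', V ω ∂P - ∫ ω in B', U ω ∂P :=
      integral_sub (l2.integrable one_le_two).integrableOn (l1.integrable one_le_two).integrableOn
    rw [this, hU, hV, xi_ML h q n hs hst hf hfi hB', sub_self])
  have o' : ∫ ω in B, U ω * (V ω - U ω) ∂P = 0 := by
    rw [← integral_indicator hB0, ← o]
    congr 1; ext ω
    by_cases hω : ω ∈ B
    · simp [hω]
    · simp [hω]
  have iU := l1.integrable_sq
  have iV := l2.integrable_sq
  have iUV : Integrable (fun ω => U ω * (V ω - U ω)) P := l1.integrable_mul (l2.sub l1)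
  have : ∫ ω in B, (U ω ^ 2 + 2 * (U ω * (V ω - U ω))) ∂P ≤ ∫ ω in B, V ω ^ 2 ∂P := by
    apply integral_mono (iU.add (iUV.const_mul 2)).integrableOn iV.integrableOn
    intro ω
    change U ω ^ 2 + 2 * (U ω * (V ω - U ω)) ≤ V ω ^ 2
    nlinarith [sq_nonneg (V ω - U ω)]
  rwa [integral_add iU.integrableOn (iUV.const_mul 2).integrableOn, integral_const_mul, o', mul_zero, add_zero] at this

end DM

set_option linter.unusedSectionVars false
set_option linter.unusedVariables false

namespace DM

variable {d : ℕ} {Ω : Type*} [m0 : MeasurableSpace Ω]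

/-- test functions -/
structure TF (f : EE d → ℝ) (N : ℕ) : Prop where
  cont : Continuous f
  supp : ∀ x, x ∉ Metric.closedBall (0 : EE d) N → f x = 0

lemma TF.cs {f : EE d → ℝ} {N : ℕ} (hf : TF f N) : HasCompactSupport f :=
  HasCompactSupport.intro (isCompact_closedBall 0 (N:ℝ)) hf.supp
lemma TF.meas {f : EE d → ℝ} {N : ℕ} (hf : TF f N) : Measurable f := hf.cont.measurable
lemma TF.int {f : EE d → ℝ} {N : ℕ} (hf : TF f N) : Integrable f := hf.cont.integrable_of_hasCompactSupport hf.cs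
lemma TF.bdd {f : EE d → ℝ} {N : ℕ} (hf : TF f N) : ∃ F, ∀ x, |f x| ≤ F := by
  obtain ⟨C, hC⟩ := hf.cs.exists_bound_of_continuous hf.cont
  exact ⟨C, hC⟩
lemma TF.int_mul {f : EE d → ℝ} {N : ℕ} (hf : TF f N) {g : EE d → ℝ} (hg : Continuous g) : Integrable fun x => f x * g x :=
  (hf.cont.mul hg).integrable_of_hasCompactSupport hf.cs.mul_right

lemma cont_Fi {f : EE d → ℝ} {N : ℕ} (hf : TF f N) {g : ℝ → EE d → ℝ} (hg : Continuous fun p : ℝ × EE d => g p.1 p.2) :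
    Continuous fun t => ∫ x, f x * g t x := by
  have e : ∀ t, ∫ x, f x * g t x = ∫ x in Metric.closedBall (0 : EE d) N, f x * g t x := by
    intro t
    rw [setIntegral_eq_integral_of_forall_compl_eq_zero]
    intro x hx; rw [hf.supp x hx, zero_mul]
  simp_rw [e]
  have hc := hf.cont
  exact continuous_parametric_integral_of_continuous (f := fun t x => f x * g t x) ((hc.comp continuous_snd).mul hg) (isCompact_closedBall 0 (N:ℝ))

lemma cont_psi2 {P : Measure Ω} {X : ℝ → EE d → Ω → ℝ} {L R : ℝ} (h : Setup P X L R) (q : ℝ) (ω : Ω) :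
    Continuous fun p : ℝ × EE d => psi X q p.1 p.2 ω := by
  have := h.cont ω
  unfold psi Yq wt; fun_prop

lemma cont_wt2 {P : Measure Ω} {X : ℝ → EE d → Ω → ℝ} {L R : ℝ} (h : Setup P X L R) (ω : Ω) :
    Continuous fun p : ℝ × EE d => wt X p.1 p.2 ω := by
  have := h.cont ω
  unfold wt; fun_prop

lemma grid_ev {p : ℝ → Prop} (h : ∀ᶠ n : ℕ in atTop, ∀ t ∈ Set.Icc (tt n) (tt (n+1)), p t) : ∀ᶠ t in atTop, p t := by
  obtain ⟨n0, h0⟩ := eventually_atTop.1 h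
  refine eventually_atTop.2 ⟨tt n0, fun t ht => ?_⟩
  have t0 := (tt_nonneg n0).trans ht
  have hl := ell_pos
  have hn : n0 ≤ ⌊t / Real.log 2⌋₊ := Nat.le_floor (by rw [le_div_iff₀ hl]; exact ht)
  refine h0 _ hn t ⟨?_, ?_⟩
  · have := Nat.floor_le (div_nonneg t0 hl.le)
    rw [le_div_iff₀ hl] at this; exact this
  · have := (Nat.lt_floor_add_one (t / Real.log 2)).le
    rw [div_le_iff₀ hl] at this
    unfold tt; push_cast; exact this

lemma grid_tendsto {φ : ℝ → ℝ} {l : ℝ} (h1 : Tendsto (fun n => φ (tt n)) atTop (nhds l))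
    (h2 : ∀ ε > 0, ∀ᶠ n : ℕ in atTop, ∀ t ∈ Set.Icc (tt n) (tt (n+1)), |φ t - φ (tt n)| ≤ ε) : Tendsto φ atTop (nhds l) := by
  rw [Metric.tendsto_nhds] at *
  intro ε hε
  apply grid_ev
  filter_upwards [h1 (ε/2) (by positivity), h2 (ε/3) (by positivity)] with n e1 e2 t ht
  have := e2 t ht
  rw [Real.dist_eq] at *
  calc |φ t - l| = |(φ t - φ (tt n)) + (φ (tt n) - l)| := by ring_nf
    _ ≤ _ := abs_add_le _ _
    _ < ε := by linarith

def GG (X : ℝ → EE d → Ω → ℝ) (q : ℝ) (N : ℕ) (ω : Ω) : Prop := ∀ j, ∀ x ∈ Metric.closedBall (0 : EE d) N, 0 ≤ Yq X q (tt j) x ω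

def LL (X : ℝ → EE d → Ω → ℝ) (q : ℝ) (f : EE d → ℝ) (n : ℕ) (ω : Ω) : ℝ :=
  Fi f (psi X q 0) ω + ∑ i ∈ Finset.range n, Fi f (hh X q i (tt (i+1))) ω

lemma LL_succ (X : ℝ → EE d → Ω → ℝ) (q : ℝ) (f : EE d → ℝ) (n : ℕ) (ω : Ω) :
    LL X q f (n+1) ω = LL X q f n ω + Fi f (hh X q n (tt (n+1))) ω := by
  unfold LL; rw [Finset.sum_range_succ]; ring

section good
variable {P : Measure Ω} {X : ℝ → EE d → Ω → ℝ} {L R : ℝ} {f : EE d → ℝ} {N : ℕ}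

lemma good_hh (h : Setup P X L R) {q : ℝ} (hf : TF f N) {ω : Ω} (hω : GG X q N ω) (n : ℕ) (t : ℝ) :
    Fi f (hh X q n t) ω = Fi f (psi X q t) ω - Fi f (psi X q (tt n)) ω := by
  unfold Fi
  rw [← integral_sub (hf.int_mul (cont_psi h q t ω)) (hf.int_mul (cont_psi h q (tt n) ω))]
  congr 1; ext x
  by_cases hx : x ∈ Metric.closedBall (0 : EE d) N
  · unfold hh
    rw [Set.indicator_of_mem]
    · ring
    · exact fun i _ => hω i x hx
  · rw [hf.supp x hx]; ring

lemma good_nn {q : ℝ} (hf : TF f N) {ω : Ω} (hω : GG X q N ω) (n : ℕ) (t : ℝ) :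
    Fi f (nn X q n t) ω = ∫ x, f x * max (-(psi X q t x ω)) 0 := by
  unfold Fi
  congr 1; ext x
  by_cases hx : x ∈ Metric.closedBall (0 : EE d) N
  · unfold nn
    rw [Set.indicator_of_mem]
    exact fun i _ => hω i x hx
  · rw [hf.supp x hx]; ring

lemma good_LL (h : Setup P X L R) {q : ℝ} (hf : TF f N) {ω : Ω} (hω : GG X q N ω) (n : ℕ) :
    LL X q f n ω = Fi f (psi X q (tt n)) ω := by
  induction n with
  | zero => simp [LL, tt_zero]
  | succ n ih => rw [LL_succ, ih, good_hh h hf hω]; ring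
end good

section mart
variable {P : Measure Ω} {X : ℝ → EE d → Ω → ℝ} {L R : ℝ} {f : EE d → ℝ} {N : ℕ}

lemma LL_sm (h : Setup P X L R) (q : ℝ) (hf : Measurable f) (n : ℕ) : StronglyMeasurable[Fil X (tt n)] (LL X q f n) := by
  induction n with
  | zero =>
    have := Fi_sm (psi_fld h q le_rfl (tt_nonneg 0)).jm hf
    have e : LL X q f 0 = Fi f (psi X q 0) := by ext ω; simp [LL]
    rw [e]; exact this
  | succ n ih =>
    have e : LL X q f (n+1) = LL X q f n + Fi f (hh X q n (tt (n+1))) := by ext ω; simp [LL_succ]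
    rw [e]
    exact (ih.mono (Fil_mono X (tt_lt_succ n).le)).add (Fi_sm (hh_fld h q n (tt_lt_succ n).le le_rfl).jm hf)

lemma LL_memLp (h : Setup P X L R) (q : ℝ) (hf : Measurable f) (hfi : Integrable f) (n : ℕ) : MemLp (LL X q f n) 2 P := by
  have := h.prob
  induction n with
  | zero =>
    have fl := psi_fld h q (le_refl 0) (le_refl 0)
    have e : LL X q f 0 = Fi f (psi X q 0) := by ext ω; simp [LL]
    rw [e]
    exact (memLp_two_iff_integrable_sq (((Fi_sm fl.jm hf).mono fl.le).aestronglyMeasurable)).2 (fl.Fi_sq_int hf hfi)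
  | succ n ih =>
    have e : LL X q f (n+1) = LL X q f n + Fi f (hh X q n (tt (n+1))) := by ext ω; simp [LL_succ]
    rw [e]
    exact ih.add (xi_memLp h q n (tt_lt_succ n).le hf hfi)

lemma xi_zero (h : Setup P X L R) (q : ℝ) (n : ℕ) (hf : Measurable f) (hfi : Integrable f) {B : Set Ω} (hB : MeasurableSet[Fil X (tt n)] B) :
    ∫ ω in B, Fi f (hh X q n (tt (n+1))) ω ∂P = 0 := by
  rw [xi_ML h q n le_rfl (tt_lt_succ n).le hf hfi hB]
  simp [Fi, hh_zero]

lemma LL_mean (h : Setup P X L R) (q : ℝ) (hf : Measurable f) (hfi : Integrable f) (n : ℕ) : ∫ ω, LL X q f n ω ∂P = ∫ ω, Fi f (psi X q 0) ω ∂P := by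
  have := h.prob
  induction n with
  | zero => simp [LL]
  | succ n ih =>
    simp_rw [LL_succ]
    rw [integral_add ((LL_memLp h q hf hfi n).integrable one_le_two) ((xi_memLp h q n (tt_lt_succ n).le hf hfi).integrable one_le_two), ih]
    have := xi_zero h q n hf hfi (MeasurableSet.univ)
    rw [Measure.restrict_univ] at this
    rw [this, add_zero]

lemma LL_sq (h : Setup P X L R) (hd : 1 ≤ d) (q : ℝ) (hf : Measurable f) (hfi : Integrable f) {F : ℝ} (hF : ∀ x, |f x| ≤ F) :
    ∃ C, ∀ n, ∫ ω, LL X q f n ω ^ 2 ∂P ≤ C := by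
  have := h.prob
  obtain ⟨C, C0, hC⟩ := xi_sq h hd q hf hfi hF
  have key : ∀ n, ∫ ω, LL X q f n ω ^ 2 ∂P ≤ ∫ ω, LL X q f 0 ω ^ 2 ∂P + C * ∑ i ∈ Finset.range n, gg P X q (gam d / 2) i 0 := by
    intro n
    induction n with
    | zero => simp
    | succ n ih =>
      have l1 := LL_memLp h q hf hfi n
      have l2 := xi_memLp h q n (tt_lt_succ n).le hf hfi
      have o := orth (Fil_le h.meas (tt n)) (LL_sm h q hf n) l1 l2 (fun B hB => xi_zero h q n hf hfi hB)
      have iUV : Integrable (fun ω => LL X q f n ω * Fi f (hh X q n (tt (n+1))) ω) P := l1.integrable_mul l2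
      have e : ∀ ω, LL X q f (n+1) ω ^ 2 = (LL X q f n ω ^ 2 + 2 * (LL X q f n ω * Fi f (hh X q n (tt (n+1))) ω)) + Fi f (hh X q n (tt (n+1))) ω ^ 2 := by
        intro ω; rw [LL_succ]; ring
      simp_rw [e]
      have i1 := l1.integrable_sq
      have i2 := l2.integrable_sq
      have i12 : Integrable (fun ω => LL X q f n ω ^ 2 + 2 * (LL X q f n ω * Fi f (hh X q n (tt (n+1))) ω)) P := i1.add (iUV.const_mul 2)
      rw [integral_add i12 i2, integral_add i1 (iUV.const_mul 2), integral_const_mul, o, Finset.sum_range_succ]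
      linarith [hC n]
  refine ⟨∫ ω, LL X q f 0 ω ^ 2 ∂P + C * greenC (gam d / 2), fun n => (key n).trans ?_⟩
  gcongr
  exact green h q (by have := gam_pos hd; positivity) 0 n

lemma LL_conv (h : Setup P X L R) (hd : 1 ≤ d) (q : ℝ) (hf : Measurable f) (hfi : Integrable f) {F : ℝ} (hF : ∀ x, |f x| ≤ F) :
    ∀ᵐ ω ∂P, ∃ l, Tendsto (fun n => LL X q f n ω) atTop (nhds l) := by
  have := h.prob
  obtain ⟨C, hC⟩ := LL_sq h hd q hf hfi hF
  let 𝒢 : Filtration ℕ m0 := ⟨fun n => Fil X (tt n), fun i j hij => Fil_mono X (tt_mono hij), fun j => Fil_le h.meas _⟩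
  have mart : Martingale (LL X q f) 𝒢 P := by
    refine martingale_of_setIntegral_eq_succ (fun n => LL_sm h q hf n) (fun n => (LL_memLp h q hf hfi n).integrable one_le_two) (fun n B hB => ?_)
    simp_rw [LL_succ]
    rw [integral_add ((LL_memLp h q hf hfi n).integrable one_le_two).integrableOn ((xi_memLp h q n (tt_lt_succ n).le hf hfi).integrable one_le_two).integrableOn,
      xi_zero h q n hf hfi hB, add_zero]
  have bd : ∀ n, eLpNorm (LL X q f n) 1 P ≤ (1 + C).toNNReal := by
    intro n
    have l1 := LL_memLp h q hf hfi n
    rw [eLpNorm_one_eq_lintegral_enorm]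
    have : ∫⁻ ω, ‖LL X q f n ω‖ₑ ∂P = ENNReal.ofReal (∫ ω, |LL X q f n ω| ∂P) := by
      rw [ofReal_integral_eq_lintegral_ofReal (l1.integrable one_le_two).abs (Eventually.of_forall fun ω => abs_nonneg _)]
      simp_rw [Real.enorm_eq_ofReal_abs]
    rw [this]
    change _ ≤ ENNReal.ofReal (1 + C)
    apply ENNReal.ofReal_le_ofReal
    calc _ ≤ ∫ ω, (1 + LL X q f n ω ^ 2) ∂P := by
          apply integral_mono (l1.integrable one_le_two).abs ((integrable_const 1).add l1.integrable_sq)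
          intro ω
          change |LL X q f n ω| ≤ 1 + LL X q f n ω ^ 2
          rw [← sq_abs]
          nlinarith [sq_nonneg (|LL X q f n ω| - 1), abs_nonneg (LL X q f n ω)]
      _ ≤ _ := by
          rw [integral_add (integrable_const 1) l1.integrable_sq]
          simpa using hC n
  exact mart.submartingale.exists_ae_tendsto_of_bdd bd

lemma bc_gen (h : Setup P X L R) {Z : ℕ → ℝ → Ω → ℝ} (hm : ∀ n t, tt n ≤ t → StronglyMeasurable[Fil X t] (Z n t))
    (hi : ∀ n t, tt n ≤ t → Integrable (Z n t) P) (h0 : ∀ n t ω, 0 ≤ Z n t ω)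
    (hsub : ∀ n s t, tt n ≤ s → s ≤ t → ∀ B, MeasurableSet[Fil X s] B → ∫ ω in B, Z n s ω ∂P ≤ ∫ ω in B, Z n t ω ∂P)
    (hs : Summable fun n => ∫ ω, Z n (tt (n+1)) ω ∂P) :
    ∀ᵐ ω ∂P, ∀ ε > 0, ∀ᶠ n : ℕ in atTop, ∀ k j : ℕ, j ≤ 2 ^ k → Z n (tt n + j * ((tt (n+1) - tt n) / 2 ^ k)) ω < ε := by
  have := h.prob
  have key : ∀ M : ℕ, ∀ᵐ ω ∂P, ∀ᶠ n : ℕ in atTop, ∀ k j : ℕ, j ≤ 2 ^ k → Z n (tt n + j * ((tt (n+1) - tt n) / 2 ^ k)) ω < 1 / ((M:ℝ) + 1) := by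
    intro M
    have εp : 0 < 1 / ((M:ℝ) + 1) := by positivity
    have sum : ∑' n, P {ω | ∃ k j : ℕ, j ≤ 2 ^ k ∧ 1 / ((M:ℝ) + 1) ≤ Z n (tt n + j * ((tt (n+1) - tt n) / 2 ^ k)) ω} ≠ ⊤ := by
      have i0 : ∀ n, 0 ≤ (∫ ω, Z n (tt (n+1)) ω ∂P) / (1 / ((M:ℝ) + 1)) := fun n => div_nonneg (integral_nonneg (h0 _ _)) εp.le
      refine ne_top_of_le_ne_top ?_ (ENNReal.tsum_le_tsum fun n => maxdy (fun s t hst => Fil_mono X hst) (Fil_le h.meas) (tt_lt_succ n) (hm n) (hi n) (h0 n) (hsub n) εp)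
      rw [← ENNReal.ofReal_tsum_of_nonneg i0 (hs.div_const _)]
      exact ENNReal.ofReal_ne_top
    have := measure_setOf_frequently_eq_zero (p := fun n ω => ∃ k j : ℕ, j ≤ 2 ^ k ∧ 1 / ((M:ℝ) + 1) ≤ Z n (tt n + j * ((tt (n+1) - tt n) / 2 ^ k)) ω) sum
    have h2 : ∀ᵐ ω ∂P, ¬ ∃ᶠ n in atTop, ∃ k j : ℕ, j ≤ 2 ^ k ∧ 1 / ((M:ℝ) + 1) ≤ Z n (tt n + j * ((tt (n+1) - tt n) / 2 ^ k)) ω := by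
      rw [ae_iff]; simp only [not_not]; exact this
    filter_upwards [h2] with ω hω
    rw [not_frequently] at hω
    filter_upwards [hω] with n hn k j hj
    by_contra hc
    exact hn ⟨k, j, hj, not_lt.1 hc⟩
  filter_upwards [ae_all_iff.2 key] with ω hω ε hε
  obtain ⟨M, hM⟩ := exists_nat_one_div_lt hε
  filter_upwards [hω M] with n hn k j hj
  exact (hn k j hj).trans hM

theorem psi_conv (h : Setup P X L R) (hd : 1 ≤ d) (q : ℝ) (hf : TF f N) :
    ∀ᵐ ω ∂P, GG X q N ω → ∃ l, Tendsto (fun n => LL X q f n ω) atTop (nhds l) ∧ Tendsto (fun t => Fi f (psi X q t) ω) atTop (nhds l) := by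
  have := h.prob
  obtain ⟨F, hF⟩ := hf.bdd
  obtain ⟨C, C0, hC⟩ := xi_sq h hd q hf.meas hf.int hF
  have hs : Summable fun n => ∫ ω, Fi f (hh X q n (tt (n+1))) ω ^ 2 ∂P :=
    Summable.of_nonneg_of_le (fun n => integral_nonneg fun ω => sq_nonneg _) hC ((gg_summable h hd q).mul_left C)
  have bc := bc_gen h (Z := fun n t ω => Fi f (hh X q n t) ω ^ 2) (fun n t ht => (Fi_sm (hh_fld h q n ht le_rfl).jm hf.meas).pow 2)
    (fun n t ht => (xi_memLp h q n ht hf.meas hf.int).integrable_sq) (fun n t ω => sq_nonneg _)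
    (fun n s t hs hst B hB => xi_sq_sub h q n hs hst hf.meas hf.int hB) hs
  filter_upwards [bc, LL_conv h hd q hf.meas hf.int hF] with ω hb hl hω
  obtain ⟨l, hl⟩ := hl
  refine ⟨l, hl, grid_tendsto (φ := fun t => Fi f (psi X q t) ω) (by simpa only [good_LL h hf hω] using hl) fun ε hε => ?_⟩
  filter_upwards [hb (ε ^ 2) (by positivity)] with n hn t ht
  have hc : Continuous fun t => Fi f (hh X q n t) ω ^ 2 := by
    simp_rw [good_hh h hf hω]
    exact ((cont_Fi hf (cont_psi2 h q ω)).sub continuous_const).pow 2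
  have := dy_dense (tt_lt_succ n) hc hn t ht
  rw [good_hh h hf hω] at this
  exact abs_le_of_sq_le_sq this hε.le

theorem neg_conv (h : Setup P X L R) (hd : 1 ≤ d) (q : ℝ) (hf : TF f N) (hf0 : ∀ x, 0 ≤ f x) :
    ∀ᵐ ω ∂P, GG X q N ω → Tendsto (fun t => ∫ x, f x * max (-(psi X q t x ω)) 0) atTop (nhds 0) := by
  have := h.prob
  obtain ⟨C, C0, hC⟩ := nu_int h hd q hf.meas hf.int hf0
  have n0 : ∀ n t ω, 0 ≤ Fi f (nn X q n t) ω := fun n t ω => integral_nonneg fun x => mul_nonneg (hf0 x) (Set.indicator_nonneg (fun _ _ => le_max_right _ _) _)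
  have hs : Summable fun n => ∫ ω, Fi f (nn X q n (tt (n+1))) ω ∂P :=
    Summable.of_nonneg_of_le (fun n => integral_nonneg fun ω => n0 _ _ _) hC ((gg_summable h hd q).mul_left C)
  have bc := bc_gen h (Z := fun n t ω => Fi f (nn X q n t) ω) (fun n t ht => (Fi_sm (nn_fld h q n ht le_rfl).jm hf.meas))
    (fun n t ht => (nn_fld h q n ht le_rfl).Fi_int hf.meas hf.int) n0
    (fun n s t hs hst B hB => nu_ML h q n hs hst hf.meas hf.int hf0 hB) hs
  filter_upwards [bc] with ω hb hω
  have p0 : ∀ t, 0 ≤ ∫ x, f x * max (-(psi X q t x ω)) 0 := fun t => integral_nonneg fun x => mul_nonneg (hf0 x) (le_max_right _ _)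
  rw [Metric.tendsto_nhds]
  intro ε hε
  apply grid_ev
  filter_upwards [hb (ε/2) (by positivity)] with n hn t ht
  have hc : Continuous fun t => Fi f (nn X q n t) ω := by
    simp_rw [good_nn hf hω]
    have := cont_psi2 h q ω
    exact cont_Fi hf (g := fun t x => max (-(psi X q t x ω)) 0) (by fun_prop)
  have := dy_dense (tt_lt_succ n) hc hn t ht
  rw [good_nn hf hω] at this
  rw [Real.dist_eq, sub_zero, abs_of_nonneg (p0 t)]
  linarith

end mart

end DM

set_option linter.unusedSectionVars false
set_option linter.unusedVariables false

namespace DM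

variable {d : ℕ} {Ω : Type*} [m0 : MeasurableSpace Ω]

lemma ae_tendsto_zero {P : Measure Ω} {Z : ℕ → Ω → ℝ} (h0 : ∀ n ω, 0 ≤ Z n ω) (hi : ∀ n, Integrable (Z n) P)
    (hs : Summable fun n => ∫ ω, Z n ω ∂P) : ∀ᵐ ω ∂P, Tendsto (fun n => Z n ω) atTop (nhds 0) := by
  have e : ∫⁻ ω, ∑' n, ENNReal.ofReal (Z n ω) ∂P ≠ ⊤ := by
    rw [lintegral_tsum fun n => (hi n).1.aemeasurable.ennreal_ofReal]
    have : ∀ n, ∫⁻ ω, ENNReal.ofReal (Z n ω) ∂P = ENNReal.ofReal (∫ ω, Z n ω ∂P) := fun n =>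
      (ofReal_integral_eq_lintegral_ofReal (hi n) (Eventually.of_forall (h0 n))).symm
    simp_rw [this]
    rw [← ENNReal.ofReal_tsum_of_nonneg (fun n => integral_nonneg (h0 n)) hs]
    exact ENNReal.ofReal_ne_top
  have m : AEMeasurable (fun ω => ∑' n, ENNReal.ofReal (Z n ω)) P := AEMeasurable.ennreal_tsum fun n => (hi n).1.aemeasurable.ennreal_ofReal
  filter_upwards [ae_lt_top' m e] with ω hω
  have := ENNReal.tendsto_atTop_zero_of_tsum_ne_top hω.ne
  have h2 := (ENNReal.tendsto_toReal ENNReal.zero_ne_top).comp this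
  simp only [ENNReal.toReal_zero] at h2
  refine h2.congr fun n => ?_
  simp only [Function.comp]
  exact ENNReal.toReal_ofReal (h0 n ω)

/-- truncated green weight -/
def vw (X : ℝ → EE d → Ω → ℝ) (q : ℝ) (n : ℕ) (x : EE d) (ω : Ω) : ℝ :=
  (surv X q n x).indicator (fun ω => wt X (tt n) x ω * Real.exp (-(gam d / 2) * Yq X q (tt n) x ω)) ω

lemma vw_nonneg (X : ℝ → EE d → Ω → ℝ) (q : ℝ) (n : ℕ) (x : EE d) (ω : Ω) : 0 ≤ vw X q n x ω :=
  Set.indicator_nonneg (fun ω _ => mul_nonneg (wt_pos _ _ _ _).le (Real.exp_pos _).le) _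

section
variable {P : Measure Ω} {X : ℝ → EE d → Ω → ℝ} {L R : ℝ} {f : EE d → ℝ} {N : ℕ}

lemma cont_wt (h : Setup P X L R) (t : ℝ) (ω : Ω) : Continuous fun x => wt X t x ω := by
  have := cont_X h t ω
  unfold wt; fun_prop

lemma cont_Yq (h : Setup P X L R) (q t : ℝ) (ω : Ω) : Continuous fun x => Yq X q t x ω := by
  have := cont_X h t ω
  unfold Yq; fun_prop

lemma vw_fld (h : Setup P X L R) (q : ℝ) (n : ℕ) : Fld (Fil X (tt n)) P (vw X q n) := by
  refine (wt_fld h (tt_nonneg n) le_rfl).of_le le_rfl (Fil_le h.meas _) (JM_ind (JM_Yq h q le_rfl) (JM_of_cont (fun x => ?_) (fun ω => ?_))) (fun x ω => ?_)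
  · have m1 := meas_wt_Fil X (tt_nonneg n) le_rfl x
    have m2 := meas_Yq_Fil X q (tt_nonneg n) le_rfl x
    exact m1.mul ((m2.const_mul _).exp)
  · have := cont_wt h (tt n) ω
    have := cont_Yq h q (tt n) ω
    fun_prop
  · rw [abs_of_nonneg (vw_nonneg X q n x ω), abs_of_pos (wt_pos _ _ _ _)]
    unfold vw
    by_cases hω : ω ∈ surv X q n x
    · rw [Set.indicator_of_mem hω]
      have y0 : 0 ≤ Yq X q (tt n) x ω := hω n le_rfl
      refine mul_le_of_le_one_right (wt_pos _ _ _ _).le (Real.exp_le_one_iff.2 ?_)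
      have := gam_nonneg d
      nlinarith
    · rw [Set.indicator_of_notMem hω]; exact (wt_pos _ _ _ _).le

lemma vw_int (h : Setup P X L R) (q : ℝ) (n : ℕ) (x : EE d) : ∫ ω, vw X q n x ω ∂P = gg P X q (gam d / 2) n 0 := by
  rw [integral_eq_lintegral_of_nonneg_ae (Eventually.of_forall (vw_nonneg X q n x)) ((vw_fld h q n).mx x).aestronglyMeasurable, ← gg_const h q _ n x]
  unfold gg ggE
  congr 1
  rw [← lintegral_indicator (meas_surv h q n x)]
  congr 1; ext ω
  unfold vw
  by_cases hω : ω ∈ surv X q n x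
  · rw [Set.indicator_of_mem hω, Set.indicator_of_mem hω, ENNReal.ofReal_mul (wt_pos _ _ _ _).le]
  · rw [Set.indicator_of_notMem hω, Set.indicator_of_notMem hω]; simp

lemma vw_conv (h : Setup P X L R) (hd : 1 ≤ d) (q : ℝ) (hf : TF f N) (hf0 : ∀ x, 0 ≤ f x) :
    ∀ᵐ ω ∂P, Tendsto (fun n => Fi f (vw X q n) ω) atTop (nhds 0) := by
  have := h.prob
  refine ae_tendsto_zero (fun n ω => integral_nonneg fun x => mul_nonneg (hf0 x) (vw_nonneg _ _ _ _ _)) (fun n => (vw_fld h q n).Fi_int hf.meas hf.int) ?_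
  have e : ∀ n, ∫ ω, Fi f (vw X q n) ω ∂P = (∫ x, f x) * gg P X q (gam d / 2) n 0 := by
    intro n
    have := (vw_fld h q n).set_int hf.meas hf.int MeasurableSet.univ
    simp only [Measure.restrict_univ] at this
    rw [this]
    simp_rw [vw_int h]
    rw [integral_mul_const]
  simp_rw [e]
  exact (gg_summable h hd q).mul_left _

lemma GG_mono {q q' : ℝ} (hq : q ≤ q') {ω : Ω} (hω : GG X q N ω) : GG X q' N ω := by
  intro j x hx
  have := hω j x hx
  unfold Yq at *; linarith

lemma GG_ball {q : ℝ} {N' : ℕ} (hN : N ≤ N') {ω : Ω} (hω : GG X q N' ω) : GG X q N ω := by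
  intro j x hx
  exact hω j x (Metric.closedBall_subset_closedBall (by exact_mod_cast hN) hx)

lemma psi_add (X : ℝ → EE d → Ω → ℝ) (q r t : ℝ) (x : EE d) (ω : Ω) : psi X (q + r) t x ω = psi X q t x ω + r * wt X t x ω := by
  unfold psi Yq; ring

lemma Fi_psi_add (h : Setup P X L R) (q r t : ℝ) (hf : TF f N) (ω : Ω) : Fi f (psi X (q + r) t) ω = Fi f (psi X q t) ω + r * Fi f (wt X t) ω := by
  unfold Fi
  rw [← integral_const_mul, ← integral_add (hf.int_mul (cont_psi h q t ω)) ((hf.int_mul (cont_wt h t ω)).const_mul r)]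
  congr 1; ext x; rw [psi_add]; ring

theorem wt_conv (h : Setup P X L R) (hd : 1 ≤ d) (q : ℝ) (hf : TF f N) (hf0 : ∀ x, 0 ≤ f x) :
    ∀ᵐ ω ∂P, GG X q N ω → Tendsto (fun t => Fi f (wt X t) ω) atTop (nhds 0) := by
  filter_upwards [psi_conv h hd q hf, psi_conv h hd (q+1) hf, vw_conv h hd q hf hf0] with ω h1 h2 h3 hω
  obtain ⟨l1, -, h1⟩ := h1 hω
  obtain ⟨l2, -, h2⟩ := h2 (GG_mono (by linarith) hω)
  have hlim : Tendsto (fun t => Fi f (wt X t) ω) atTop (nhds (l2 - l1)) := by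
    refine (h2.sub h1).congr fun t => ?_
    rw [Fi_psi_add h q 1 t hf]; ring
  have htt : Tendsto tt atTop atTop := by
    unfold tt; exact tendsto_natCast_atTop_atTop.atTop_mul_const ell_pos
  have l0 : 0 ≤ l2 - l1 := ge_of_tendsto hlim (Eventually.of_forall fun t => integral_nonneg fun x => mul_nonneg (hf0 x) (wt_pos _ _ _ _).le)
  have key : ∀ M : ℝ, 0 < M → l2 - l1 ≤ M⁻¹ * l1 := by
    intro M hM
    have hr : Tendsto (fun n => Real.exp (gam d / 2 * M) * Fi f (vw X q n) ω + M⁻¹ * Fi f (psi X q (tt n)) ω) atTop (nhds (Real.exp (gam d / 2 * M) * 0 + M⁻¹ * l1)) :=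
      (h3.const_mul _).add ((h1.comp htt).const_mul _)
    rw [mul_zero, zero_add] at hr
    refine le_of_tendsto_of_tendsto (hlim.comp htt) hr (Eventually.of_forall fun n => ?_)
    simp only [Function.comp]
    unfold Fi
    have cw := cont_wt h (tt n) ω
    have cy := cont_Yq h q (tt n) ω
    have ev : ∀ x, f x * vw X q n x ω = f x * (wt X (tt n) x ω * Real.exp (-(gam d / 2) * Yq X q (tt n) x ω)) := by
      intro x
      by_cases hx : x ∈ Metric.closedBall (0 : EE d) N
      · unfold vw
        rw [Set.indicator_of_mem]
        exact fun i _ => hω i x hx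
      · rw [hf.supp x hx]; ring
    simp_rw [ev]
    have i1 : Integrable fun x => f x * (wt X (tt n) x ω * Real.exp (-(gam d / 2) * Yq X q (tt n) x ω)) := hf.int_mul (by fun_prop)
    have i2 := hf.int_mul (cont_psi h q (tt n) ω)
    rw [← integral_const_mul, ← integral_const_mul, ← integral_add (i1.const_mul _) (i2.const_mul _)]
    apply integral_mono (hf.int_mul cw) ((i1.const_mul _).add (i2.const_mul _))
    intro x
    change f x * wt X (tt n) x ω ≤ Real.exp (gam d / 2 * M) * (f x * (wt X (tt n) x ω * Real.exp (-(gam d / 2) * Yq X q (tt n) x ω))) + M⁻¹ * (f x * psi X q (tt n) x ω)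
    by_cases hx : x ∈ Metric.closedBall (0 : EE d) N
    · have y0 := hω n x hx
      have w0 := wt_pos X (tt n) x ω
      have hb : 1 ≤ Real.exp (gam d / 2 * M) * Real.exp (-(gam d / 2) * Yq X q (tt n) x ω) + M⁻¹ * Yq X q (tt n) x ω := by
        by_cases hy : Yq X q (tt n) x ω ≤ M
        · rw [← Real.exp_add]
          have : 1 ≤ Real.exp (gam d / 2 * M + -(gam d / 2) * Yq X q (tt n) x ω) := Real.one_le_exp (by have := gam_nonneg d; nlinarith)
          have : 0 ≤ M⁻¹ * Yq X q (tt n) x ω := by positivity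
          linarith
        · have : 1 ≤ M⁻¹ * Yq X q (tt n) x ω := by rw [inv_mul_eq_div, le_div_iff₀ hM]; linarith
          have : 0 ≤ Real.exp (gam d / 2 * M) * Real.exp (-(gam d / 2) * Yq X q (tt n) x ω) := by positivity
          linarith
      unfold psi
      have := mul_le_mul_of_nonneg_left hb (mul_nonneg (hf0 x) w0.le)
      linarith
    · rw [hf.supp x hx]; simp
  have : l2 - l1 ≤ 0 := by
    have lim : Tendsto (fun M : ℝ => M⁻¹ * l1) atTop (nhds (0 * l1)) := tendsto_inv_atTop_zero.mul_const _
    rw [zero_mul] at lim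
    exact ge_of_tendsto lim ((eventually_gt_atTop 0).mono key)
  rwa [le_antisymm this l0] at hlim

end

end DM

set_option linter.unusedSectionVars false
set_option linter.unusedVariables false

namespace DM

variable {d : ℕ} {Ω : Type*} [m0 : MeasurableSpace Ω]

lemma conv_of_approx {φ : ℝ → ℝ} (H : ∀ ε > 0, ∃ l, ∃ φ' : ℝ → ℝ, Tendsto φ' atTop (nhds l) ∧ ∀ᶠ t in atTop, |φ t - φ' t| ≤ ε) :
    ∃ l, Tendsto φ atTop (nhds l) := by
  rw [← cauchy_map_iff_exists_tendsto, Metric.cauchy_iff]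
  refine ⟨inferInstance, fun ε hε => ?_⟩
  obtain ⟨l, φ', h1, h2⟩ := H (ε/4) (by positivity)
  refine ⟨Metric.ball l (ε/2), ?_, fun x hx y hy => ?_⟩
  · rw [Filter.mem_map]
    rw [Metric.tendsto_nhds] at h1
    filter_upwards [h1 (ε/4) (by positivity), h2] with t e1 e2
    rw [Set.mem_preimage, Metric.mem_ball]
    rw [Real.dist_eq] at *
    calc |φ t - l| = |(φ t - φ' t) + (φ' t - l)| := by ring_nf
      _ ≤ _ := abs_add_le _ _
      _ < ε/2 := by linarith
  · have := dist_triangle_right x y l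
    rw [Metric.mem_ball] at hx hy; linarith

def chi (d n : ℕ) (x : EE d) : ℝ := max 0 (min 1 ((n:ℝ) + 1 - ‖x‖))

lemma chi_nonneg (n : ℕ) (x : EE d) : 0 ≤ chi d n x := le_max_left _ _
lemma chi_one (n : ℕ) (x : EE d) (hx : x ∈ Metric.closedBall (0 : EE d) n) : chi d n x = 1 := by
  rw [mem_closedBall_zero_iff] at hx
  unfold chi
  rw [min_eq_left (by linarith), max_eq_right (by norm_num)]
lemma chi_TF (n : ℕ) : TF (chi d n) (n+1) := by
  refine ⟨by unfold chi; fun_prop, fun x hx => ?_⟩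
  rw [mem_closedBall_zero_iff] at hx
  push_cast at hx
  unfold chi
  exact max_eq_left (min_le_of_right_le (by linarith))

lemma TF.mul_cont {f : EE d → ℝ} {N : ℕ} (hf : TF f N) {g : EE d → ℝ} (hg : Continuous g) : TF (fun x => f x * g x) N :=
  ⟨hf.cont.mul hg, fun x hx => by simp [hf.supp x hx]⟩
lemma TF.up {f : EE d → ℝ} {N N' : ℕ} (hf : TF f N) (h : N ≤ N') : TF f N' :=
  ⟨hf.cont, fun x hx => hf.supp x fun h' => hx (Metric.closedBall_subset_closedBall (by exact_mod_cast h) h')⟩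
lemma TF.chi_mul {f : EE d → ℝ} {N : ℕ} (hf : TF f N) (x : EE d) : chi d N x * f x = f x := by
  by_cases hx : x ∈ Metric.closedBall (0 : EE d) N
  · rw [chi_one N x hx, one_mul]
  · rw [hf.supp x hx, mul_zero]
lemma TF.le_chi {f : EE d → ℝ} {N : ℕ} (hf : TF f N) {F : ℝ} (hF : ∀ x, |f x| ≤ F) (x : EE d) : |f x| ≤ F * chi d N x := by
  rw [← hf.chi_mul x, abs_mul, abs_of_nonneg (chi_nonneg _ _), mul_comm F]
  exact mul_le_mul_of_nonneg_left (hF x) (chi_nonneg _ _)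

lemma exists_cs_TF {f : EE d → ℝ} (hc : Continuous f) (hs : HasCompactSupport f) : ∃ N : ℕ, TF f N := by
  obtain ⟨r, hr⟩ := hs.isCompact.isBounded.subset_closedBall 0
  obtain ⟨N, hN⟩ := exists_nat_ge r
  refine ⟨N, hc, fun x hx => ?_⟩
  by_contra h0
  exact hx (Metric.closedBall_subset_closedBall hN (hr (subset_tsupport _ h0)))

def pk (d k : ℕ) : C(EE d, ℝ) := TopologicalSpace.denseSeq C(EE d, ℝ) k

lemma pk_approx {f : EE d → ℝ} (hf : Continuous f) {ε : ℝ} (hε : 0 < ε) (r : ℝ) : ∃ k, ∀ x ∈ Metric.closedBall (0 : EE d) r, |f x - pk d k x| < ε := by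
  have h1 : (⟨f, hf⟩ : C(EE d, ℝ)) ∈ closure (Set.range (TopologicalSpace.denseSeq C(EE d, ℝ))) := TopologicalSpace.denseRange_denseSeq _ _
  rw [mem_closure_iff_seq_limit] at h1
  obtain ⟨u, hu, hl⟩ := h1
  rw [ContinuousMap.tendsto_iff_forall_isCompact_tendstoUniformlyOn] at hl
  have h2 := hl _ (isCompact_closedBall (0 : EE d) r)
  rw [Metric.tendstoUniformlyOn_iff] at h2
  obtain ⟨n, hn⟩ := (h2 ε hε).exists
  obtain ⟨k, hk⟩ := hu n
  refine ⟨k, fun x hx => ?_⟩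
  have := hn x hx
  rw [← hk, Real.dist_eq] at this
  exact this

section
variable {P : Measure Ω} {X : ℝ → EE d → Ω → ℝ} {L R : ℝ} {f : EE d → ℝ} {N : ℕ}

structure Good (X : ℝ → EE d → Ω → ℝ) (ω : Ω) : Prop where
  good : ∀ n : ℕ, ∃ q : ℕ, GG X q n ω
  conv : ∀ n k q : ℕ, GG X q (n+1) ω → ∃ l, Tendsto (fun t => Fi (fun x => chi d n x * pk d k x) (psi X q t) ω) atTop (nhds l)
  conv1 : ∀ n q : ℕ, GG X q (n+1) ω → ∃ l, Tendsto (fun t => Fi (chi d n) (psi X q t) ω) atTop (nhds l)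
  neg : ∀ n q : ℕ, GG X q (n+1) ω → Tendsto (fun t => ∫ x, chi d n x * max (-(psi X q t x ω)) 0) atTop (nhds 0)
  wt0 : ∀ n q : ℕ, GG X q (n+1) ω → Tendsto (fun t => Fi (chi d n) (wt X t) ω) atTop (nhds 0)

lemma Good_ae (h : Setup P X L R) (hd : 1 ≤ d) : ∀ᵐ ω ∂P, Good X ω := by
  have a1 : ∀ᵐ ω ∂P, ∀ n k q : ℕ, GG X q (n+1) ω → ∃ l, Tendsto (fun t => Fi (fun x => chi d n x * pk d k x) (psi X q t) ω) atTop (nhds l) := by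
    simp_rw [ae_all_iff]
    intro n k q
    filter_upwards [psi_conv h hd q ((chi_TF n).mul_cont (pk d k).continuous)] with ω hω hG
    obtain ⟨l, -, hl⟩ := hω hG
    exact ⟨l, hl⟩
  have a2 : ∀ᵐ ω ∂P, ∀ n q : ℕ, GG X q (n+1) ω → ∃ l, Tendsto (fun t => Fi (chi d n) (psi X q t) ω) atTop (nhds l) := by
    simp_rw [ae_all_iff]
    intro n q
    filter_upwards [psi_conv h hd q (chi_TF n)] with ω hω hG
    obtain ⟨l, -, hl⟩ := hω hG
    exact ⟨l, hl⟩
  have a3 : ∀ᵐ ω ∂P, ∀ n q : ℕ, GG X q (n+1) ω → Tendsto (fun t => ∫ x, chi d n x * max (-(psi X q t x ω)) 0) atTop (nhds 0) := by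
    simp_rw [ae_all_iff]
    intro n q
    exact neg_conv h hd q (chi_TF n) (chi_nonneg n)
  have a4 : ∀ᵐ ω ∂P, ∀ n q : ℕ, GG X q (n+1) ω → Tendsto (fun t => Fi (chi d n) (wt X t) ω) atTop (nhds 0) := by
    simp_rw [ae_all_iff]
    intro n q
    exact wt_conv h hd q (chi_TF n) (chi_nonneg n)
  filter_upwards [good_ae h hd, a1, a2, a3, a4] with ω b0 b1 b2 b3 b4
  exact ⟨b0, b1, b2, b3, b4⟩

/-- comparison with chi -/
lemma Fi_abs_le (h : Setup P X L R) {g : EE d → ℝ} {M n : ℕ} (hg : TF g M) {ε : ℝ} (hle : ∀ x, |g x| ≤ ε * chi d n x) (q t : ℝ) (ω : Ω) :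
    |Fi g (psi X q t) ω| ≤ ε * (Fi (chi d n) (psi X q t) ω + 2 * ∫ x, chi d n x * max (-(psi X q t x ω)) 0) := by
  have c := cont_psi h q t ω
  have c2 : Continuous fun x => max (-(psi X q t x ω)) 0 := by fun_prop
  have i1 := (chi_TF (d := d) n).int_mul c
  have i2 := (chi_TF (d := d) n).int_mul c2
  unfold Fi
  rw [← integral_const_mul, ← integral_add i1 (i2.const_mul 2), ← integral_const_mul]
  refine (abs_integral_le_integral_abs).trans (integral_mono (hg.int_mul c).abs ((i1.add (i2.const_mul 2)).const_mul ε) fun x => ?_)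
  change |g x * psi X q t x ω| ≤ ε * (chi d n x * psi X q t x ω + 2 * (chi d n x * max (-(psi X q t x ω)) 0))
  have e : ε * (chi d n x * psi X q t x ω + 2 * (chi d n x * max (-(psi X q t x ω)) 0)) = (ε * chi d n x) * |psi X q t x ω| := by
    rcases le_total 0 (psi X q t x ω) with h0 | h0
    · rw [max_eq_right (by linarith), abs_of_nonneg h0]; ring
    · rw [max_eq_left (by linarith), abs_of_nonpos h0]; ring
  rw [e, abs_mul]
  exact mul_le_mul_of_nonneg_right (hle x) (abs_nonneg _)

lemma Good.wt_zero (h : Setup P X L R) {ω : Ω} (hω : Good X ω) (hf : TF f N) : Tendsto (fun t => Fi f (wt X t) ω) atTop (nhds 0) := by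
  obtain ⟨F, hF⟩ := hf.bdd
  obtain ⟨q, hq⟩ := hω.good (N+1)
  have h1 := (hω.wt0 N q hq).const_mul F
  rw [mul_zero] at h1
  refine squeeze_zero_norm (fun t => ?_) h1
  have c := cont_wt h t ω
  unfold Fi
  rw [← integral_const_mul, Real.norm_eq_abs]
  refine (abs_integral_le_integral_abs).trans (integral_mono (hf.int_mul c).abs (((chi_TF N).int_mul c).const_mul F) fun x => ?_)
  change |f x * wt X t x ω| ≤ F * (chi d N x * wt X t x ω)
  rw [abs_mul, abs_of_pos (wt_pos _ _ _ _), ← mul_assoc]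
  exact mul_le_mul_of_nonneg_right (hf.le_chi hF x) (wt_pos _ _ _ _).le

/-- the limit is the same for every q -/
lemma Good.psi_q (h : Setup P X L R) {ω : Ω} (hω : Good X ω) (hf : TF f N) {l : ℝ} (q r : ℝ) (hl : Tendsto (fun t => Fi f (psi X q t) ω) atTop (nhds l)) :
    Tendsto (fun t => Fi f (psi X r t) ω) atTop (nhds l) := by
  have h1 := hl.add ((hω.wt_zero h hf).const_mul (r - q))
  rw [mul_zero, add_zero] at h1
  refine h1.congr fun t => ?_
  rw [← Fi_psi_add h q (r-q) t hf]; ring_nf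

lemma Good.conv_q (h : Setup P X L R) {ω : Ω} (hω : Good X ω) (hf : TF f N) (q : ℕ) (hq : GG X q (N+1) ω) : ∃ l, Tendsto (fun t => Fi f (psi X q t) ω) atTop (nhds l) := by
  obtain ⟨lc, hlc⟩ := hω.conv1 N q hq
  have hb := hlc.add ((hω.neg N q hq).const_mul 2)
  rw [mul_zero, add_zero] at hb
  have hb1 : ∀ᶠ t in atTop, Fi (chi d N) (psi X q t) ω + 2 * ∫ x, chi d N x * max (-(psi X q t x ω)) 0 ≤ |lc| + 1 :=
    hb.eventually (eventually_le_nhds (by have := le_abs_self lc; linarith))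
  apply conv_of_approx
  intro ε hε
  obtain ⟨k, hk⟩ := pk_approx hf.cont (ε := ε / (|lc| + 1)) (by positivity) ((N+1 : ℕ) : ℝ)
  obtain ⟨l, hl⟩ := hω.conv N k q hq
  refine ⟨l, _, hl, ?_⟩
  filter_upwards [hb1] with t ht
  have T1 := (chi_TF (d := d) N).mul_cont (pk d k).continuous
  have hg : TF (fun x => f x - chi d N x * pk d k x) (N+1) :=
    ⟨hf.cont.sub T1.cont, fun x hx => by rw [(hf.up (Nat.le_succ N)).supp x hx, (chi_TF N).supp x hx]; simp⟩
  have e : Fi f (psi X q t) ω - Fi (fun x => chi d N x * pk d k x) (psi X q t) ω = Fi (fun x => f x - chi d N x * pk d k x) (psi X q t) ω := by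
    unfold Fi
    rw [← integral_sub (hf.int_mul (cont_psi h q t ω)) (T1.int_mul (cont_psi h q t ω))]
    congr 1; ext x; ring
  rw [e]
  have hle : ∀ x, |f x - chi d N x * pk d k x| ≤ ε / (|lc| + 1) * chi d N x := by
    intro x
    by_cases hx : x ∈ Metric.closedBall (0 : EE d) ((N+1 : ℕ) : ℝ)
    · rw [← hf.chi_mul x, ← mul_sub, abs_mul, abs_of_nonneg (chi_nonneg _ _), mul_comm]
      exact mul_le_mul_of_nonneg_right (hk x hx).le (chi_nonneg _ _)
    · rw [(hf.up (Nat.le_succ N)).supp x hx, (chi_TF N).supp x hx]; simp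
  refine (Fi_abs_le h hg hle q t ω).trans ?_
  calc _ ≤ ε / (|lc| + 1) * (|lc| + 1) := mul_le_mul_of_nonneg_left ht (by positivity)
    _ = ε := by field_simp

lemma Good.conv0 (h : Setup P X L R) {ω : Ω} (hω : Good X ω) (hf : TF f N) : ∃ l, ∀ q : ℝ, Tendsto (fun t => Fi f (psi X q t) ω) atTop (nhds l) := by
  obtain ⟨q, hq⟩ := hω.good (N+1)
  obtain ⟨l, hl⟩ := hω.conv_q h hf q hq
  exact ⟨l, fun r => hω.psi_q h hf q r hl⟩

/-- The limiting functional. -/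
def lim0 (X : ℝ → EE d → Ω → ℝ) (f : EE d → ℝ) (ω : Ω) : ℝ := limUnder atTop (fun t => Fi f (psi X 0 t) ω)

lemma Good.lim (h : Setup P X L R) {ω : Ω} (hω : Good X ω) (hf : TF f N) (q : ℝ) : Tendsto (fun t => Fi f (psi X q t) ω) atTop (nhds (lim0 X f ω)) := by
  obtain ⟨l, hl⟩ := hω.conv0 h hf
  have : lim0 X f ω = l := (hl 0).limUnder_eq
  rw [this]; exact hl q

lemma Good.lim_nonneg (h : Setup P X L R) {ω : Ω} (hω : Good X ω) (hf : TF f N) (hf0 : ∀ x, 0 ≤ f x) : 0 ≤ lim0 X f ω := by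
  obtain ⟨F, hF⟩ := hf.bdd
  obtain ⟨q, hq⟩ := hω.good (N+1)
  have h1 := (hω.neg N q hq).const_mul F
  rw [mul_zero] at h1
  have h2 := (hω.lim h hf q).add h1
  rw [add_zero] at h2
  refine ge_of_tendsto h2 (Eventually.of_forall fun t => ?_)
  have c := cont_psi h q t ω
  have c2 : Continuous fun x => max (-(psi X q t x ω)) 0 := by fun_prop
  have i1 := hf.int_mul c
  have i2 := (chi_TF (d := d) N).int_mul c2
  unfold Fi
  rw [← integral_const_mul, ← integral_add i1 (i2.const_mul _)]
  apply integral_nonneg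
  intro x
  change 0 ≤ f x * psi X q t x ω + F * (chi d N x * max (-(psi X q t x ω)) 0)
  have h3 := hf.le_chi hF x
  rw [abs_of_nonneg (hf0 x)] at h3
  have h4 := le_max_left (-(psi X q t x ω)) 0
  have h5 := le_max_right (-(psi X q t x ω)) 0
  have h6 := mul_le_mul_of_nonneg_right h3 h5
  have h7 := mul_le_mul_of_nonneg_left h4 (hf0 x)
  nlinarith

lemma Good.add (h : Setup P X L R) {ω : Ω} (hω : Good X ω) {g : EE d → ℝ} {M : ℕ} (hf : TF f N) (hg : TF g M) : lim0 X (fun x => f x + g x) ω = lim0 X f ω + lim0 X g ω := by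
  refine Tendsto.limUnder_eq (((hω.lim h hf 0).add (hω.lim h hg 0)).congr fun t => ?_)
  unfold Fi
  rw [← integral_add (hf.int_mul (cont_psi h 0 t ω)) (hg.int_mul (cont_psi h 0 t ω))]
  congr 1; ext x; ring

lemma Good.smul (h : Setup P X L R) {ω : Ω} (hω : Good X ω) (c : ℝ) (hf : TF f N) : lim0 X (fun x => c * f x) ω = c * lim0 X f ω := by
  refine Tendsto.limUnder_eq (((hω.lim h hf 0).const_mul c).congr fun t => ?_)
  unfold Fi
  rw [← integral_const_mul]
  congr 1; ext x; ring

open CompactlySupported in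
lemma Good.riesz (h : Setup P X L R) {ω : Ω} (hω : Good X ω) : ∃ μ : Measure (EE d), IsLocallyFiniteMeasure μ ∧
    ∀ f : EE d → ℝ, Continuous f → HasCompactSupport f → ∫ x, f x ∂μ = lim0 X f ω := by
  have tf : ∀ f : C_c(EE d, ℝ), ∃ N, TF f N := fun f => exists_cs_TF f.continuous f.hasCompactSupport
  let Λ0 : C_c(EE d, ℝ) →ₗ[ℝ] ℝ :=
    { toFun := fun f => lim0 X f ω
      map_add' := fun f g => by
        obtain ⟨N, hf⟩ := tf f
        obtain ⟨M, hg⟩ := tf g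
        exact hω.add h hf hg
      map_smul' := fun c f => by
        obtain ⟨N, hf⟩ := tf f
        exact hω.smul h c hf }
  let Λ : C_c(EE d, ℝ) →ₚ[ℝ] ℝ := PositiveLinearMap.mk₀ Λ0 (fun f hf => by
    obtain ⟨N, hN⟩ := tf f
    exact hω.lim_nonneg h hN (fun x => hf x))
  refine ⟨RealRMK.rieszMeasure Λ, inferInstance, fun f hc hs => ?_⟩
  exact RealRMK.integral_rieszMeasure Λ ⟨⟨f, hc⟩, hs⟩

end

end DM

set_option linter.unusedSectionVars false
set_option linter.unusedVariables false

namespace DM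

variable {d : ℕ} {Ω : Type*} [m0 : MeasurableSpace Ω]

def phj (j : ℕ) (s : ℝ) : ℝ := min 1 (max 0 (j * s))

lemma phj_cont (j : ℕ) : Continuous (phj j) := by unfold phj; fun_prop
lemma phj_bd (j : ℕ) (s : ℝ) : |phj j s| ≤ 1 := by
  unfold phj
  rw [abs_of_nonneg (le_min (by norm_num) (le_max_left _ _))]
  exact min_le_left _ _
lemma phj_lim (s : ℝ) : Tendsto (fun j => phj j s) atTop (nhds (if 0 < s then 1 else 0)) := by
  split_ifs with h
  · obtain ⟨j0, hj⟩ := exists_nat_gt (1 / s)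
    refine tendsto_const_nhds.congr' ?_
    filter_upwards [eventually_ge_atTop j0] with j hjj
    unfold phj
    have : 1 ≤ (j:ℝ) * s := by
      rw [div_lt_iff₀ h] at hj
      have : (j0:ℝ) ≤ j := by exact_mod_cast hjj
      nlinarith
    rw [max_eq_right (by linarith), min_eq_left this]
  · refine tendsto_const_nhds.congr fun j => ?_
    unfold phj
    have : (j:ℝ) * s ≤ 0 := mul_nonpos_of_nonneg_of_nonpos (by positivity) (by linarith)
    rw [max_eq_left this]; simp

lemma indep_lim {P : Measure Ω} [IsProbabilityMeasure P] {S : ℕ → Ω → ℝ} {E B : Set Ω} (hE : MeasurableSet E) (hB : MeasurableSet B)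
    (hS : ∀ n, Measurable (S n)) (hi : ∀ᶠ n in atTop, IndepFun (S n) (B.indicator (fun _ => (1:ℝ))) P)
    (hl : ∀ᵐ ω ∂P, ∃ l, Tendsto (fun n => S n ω) atTop (nhds l) ∧ (0 < l ↔ ω ∈ E)) : P (E ∩ B) = P E * P B := by
  classical
  choose! T hT using fun ω => (show ∃ T, (∃ l, Tendsto (fun n => S n ω) atTop (nhds l) ∧ (0 < l ↔ ω ∈ E)) → Tendsto (fun n => S n ω) atTop (nhds T) ∧ (0 < T ↔ ω ∈ E) from by
    by_cases h : ∃ l, Tendsto (fun n => S n ω) atTop (nhds l) ∧ (0 < l ↔ ω ∈ E)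
    · obtain ⟨l, hl⟩ := h; exact ⟨l, fun _ => hl⟩
    · exact ⟨0, fun h' => absurd h' h⟩)
  have hTl : ∀ᵐ ω ∂P, Tendsto (fun n => S n ω) atTop (nhds (T ω)) ∧ (0 < T ω ↔ ω ∈ E) := hl.mono fun ω h => hT ω h
  have mT : AEStronglyMeasurable T P := aestronglyMeasurable_of_tendsto_ae atTop (fun n => (hS n).aestronglyMeasurable) (hTl.mono fun ω h => h.1)
  have mB : Measurable (B.indicator (fun _ => (1:ℝ))) := measurable_const.indicator hB
  have B1 : ∀ ω, |B.indicator (fun _ => (1:ℝ)) ω| ≤ 1 := by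
    intro ω
    by_cases h : ω ∈ B <;> simp [h]
  have step1 : ∀ j, ∫ ω, phj j (T ω) * B.indicator (fun _ => (1:ℝ)) ω ∂P = (∫ ω, phj j (T ω) ∂P) * ∫ ω, B.indicator (fun _ => (1:ℝ)) ω ∂P := by
    intro j
    have l1 : Tendsto (fun n => ∫ ω, phj j (S n ω) * B.indicator (fun _ => (1:ℝ)) ω ∂P) atTop (nhds (∫ ω, phj j (T ω) * B.indicator (fun _ => (1:ℝ)) ω ∂P)) := by
      refine tendsto_integral_of_dominated_convergence (fun _ => 1) (fun n => (((phj_cont j).measurable.comp (hS n)).mul mB).aestronglyMeasurable) (integrable_const _) (fun n => Eventually.of_forall fun ω => ?_) ?_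
      · rw [Real.norm_eq_abs, abs_mul]
        exact mul_le_one₀ (phj_bd _ _) (abs_nonneg _) (B1 ω)
      · filter_upwards [hTl] with ω h
        exact (((phj_cont j).tendsto _).comp h.1).mul_const _
    have l2 : Tendsto (fun n => ∫ ω, phj j (S n ω) ∂P) atTop (nhds (∫ ω, phj j (T ω) ∂P)) := by
      refine tendsto_integral_of_dominated_convergence (fun _ => 1) (fun n => (((phj_cont j).measurable.comp (hS n))).aestronglyMeasurable) (integrable_const _) (fun n => Eventually.of_forall fun ω => ?_) ?_
      · exact phj_bd _ _
      · filter_upwards [hTl] with ω h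
        exact (((phj_cont j).tendsto _).comp h.1)
    refine tendsto_nhds_unique l1 ((l2.mul_const _).congr' ?_)
    filter_upwards [hi] with n hn
    have := hn.comp (phj_cont j).measurable measurable_id
    exact (this.integral_mul_eq_mul_integral ((phj_cont j).measurable.comp (hS n)).aestronglyMeasurable mB.aestronglyMeasurable).symm
  have l1 : Tendsto (fun j => ∫ ω, phj j (T ω) * B.indicator (fun _ => (1:ℝ)) ω ∂P) atTop (nhds (∫ ω, E.indicator (fun _ => (1:ℝ)) ω * B.indicator (fun _ => (1:ℝ)) ω ∂P)) := by
    refine tendsto_integral_of_dominated_convergence (fun _ => 1) (fun n => (((phj_cont n).comp_aestronglyMeasurable mT).mul mB.aestronglyMeasurable)) (integrable_const _) (fun n => Eventually.of_forall fun ω => ?_) ?_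
    · rw [Real.norm_eq_abs, abs_mul]
      exact mul_le_one₀ (phj_bd _ _) (abs_nonneg _) (B1 ω)
    · filter_upwards [hTl] with ω h
      refine Tendsto.mul_const _ ?_
      have := phj_lim (T ω)
      simp only [h.2] at this
      exact this
  have l2 : Tendsto (fun j => ∫ ω, phj j (T ω) ∂P) atTop (nhds (∫ ω, E.indicator (fun _ => (1:ℝ)) ω ∂P)) := by
    refine tendsto_integral_of_dominated_convergence (fun _ => 1) (fun n => (((phj_cont n).comp_aestronglyMeasurable mT))) (integrable_const _) (fun n => Eventually.of_forall fun ω => ?_) ?_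
    · exact phj_bd _ _
    · filter_upwards [hTl] with ω h
      have := phj_lim (T ω)
      simp only [h.2] at this
      exact this
  have fin := tendsto_nhds_unique l1 ((l2.mul_const _).congr fun j => (step1 j).symm)
  have e1 : ∀ A : Set Ω, MeasurableSet A → ∫ ω, A.indicator (fun _ => (1:ℝ)) ω ∂P = P.real A := fun A hA => by
    rw [integral_indicator hA]; simp
  have e2 : ∀ ω, E.indicator (fun _ => (1:ℝ)) ω * B.indicator (fun _ => (1:ℝ)) ω = (E ∩ B).indicator (fun _ => (1:ℝ)) ω := by
    intro ω
    by_cases h : ω ∈ E <;> by_cases h' : ω ∈ B <;> simp [h, h']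
  simp_rw [e2] at fin
  rw [e1 _ (hE.inter hB), e1 _ hE, e1 _ hB] at fin
  rw [← ENNReal.toReal_eq_toReal_iff' (measure_ne_top _ _) (ENNReal.mul_ne_top (measure_ne_top _ _) (measure_ne_top _ _)), ENNReal.toReal_mul]
  exact fin

section
variable {P : Measure Ω} {X : ℝ → EE d → Ω → ℝ} {L R : ℝ} {f : EE d → ℝ} {N : ℕ}

/-- stopped process bound -/
lemma stopped_le (X : ℝ → EE d → Ω → ℝ) (q : ℝ) (n : ℕ) (x : EE d) (ω : Ω) :
    (ω ∈ surv X q n x → psi X q 0 x ω + ∑ i ∈ Finset.range n, hh X q i (tt (i+1)) x ω = psi X q (tt n) x ω) ∧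
    (ω ∉ surv X q n x → psi X q 0 x ω + ∑ i ∈ Finset.range n, hh X q i (tt (i+1)) x ω ≤ 0) := by
  induction n with
  | zero =>
    simp only [Finset.range_zero, Finset.sum_empty, add_zero, tt_zero, true_and, implies_true]
    intro hω
    unfold surv at hω
    simp only [Nat.le_zero_eq, forall_eq, tt_zero, Set.mem_setOf_eq, not_le] at hω
    unfold psi
    exact mul_nonpos_of_nonpos_of_nonneg hω.le (wt_pos _ _ _ _).le
  | succ n ih =>
    rw [Finset.sum_range_succ, ← add_assoc, surv_succ]
    by_cases hs : ω ∈ surv X q n x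
    · have e : hh X q n (tt (n+1)) x ω = psi X q (tt (n+1)) x ω - psi X q (tt n) x ω := by
        unfold hh; rw [Set.indicator_of_mem hs]
      rw [ih.1 hs, e]
      refine ⟨fun _ => by ring, fun hn => ?_⟩
      have : Yq X q (tt (n+1)) x ω < 0 := by
        by_contra h0
        exact hn ⟨hs, not_lt.1 h0⟩
      have : psi X q (tt (n+1)) x ω ≤ 0 := mul_nonpos_of_nonpos_of_nonneg this.le (wt_pos _ _ _ _).le
      linarith
    · have e : hh X q n (tt (n+1)) x ω = 0 := by
        unfold hh; rw [Set.indicator_of_notMem hs]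
      rw [e, add_zero]
      exact ⟨fun h => absurd h.1 hs, fun _ => ih.2 hs⟩

lemma tt_tendsto : Tendsto tt atTop atTop := by
  unfold tt; exact tendsto_natCast_atTop_atTop.atTop_mul_const ell_pos

lemma psi_mono {q r : ℝ} (hqr : q ≤ r) (t : ℝ) (x : EE d) (ω : Ω) : psi X q t x ω ≤ psi X r t x ω := by
  unfold psi Yq
  exact mul_le_mul_of_nonneg_right (by linarith) (wt_pos _ _ _ _).le

/-- For a.e. ω, integrability of the x-slices of hh against f -/
lemma hh_slice (h : Setup P X L R) (q : ℝ) (hf : TF f N) (n : ℕ) (ω : Ω) : Integrable fun x => f x * hh X q n (tt (n+1)) x ω := by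
  have jm := (hh_fld h q n (tt_lt_succ n).le le_rfl).jm.mono (Fil_le h.meas _)
  have m : Measurable fun x => hh X q n (tt (n+1)) x ω := by
    have : Measurable (fun p : Ω × EE d => hh X q n (tt (n+1)) p.2 p.1) := jm
    exact this.comp (measurable_const.prodMk measurable_id)
  have i := hf.int_mul ((cont_psi h q (tt (n+1)) ω).sub (cont_psi h q (tt n) ω))
  refine i.mono (hf.meas.mul m).aestronglyMeasurable (Eventually.of_forall fun x => ?_)
  rw [norm_mul, norm_mul]
  refine mul_le_mul_of_nonneg_left ?_ (norm_nonneg _)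
  unfold hh
  by_cases hs : ω ∈ surv X q n x
  · rw [Set.indicator_of_mem hs]; exact le_rfl
  · rw [Set.indicator_of_notMem hs, norm_zero]; exact norm_nonneg _

lemma LL_le (h : Setup P X L R) {q r : ℝ} (hqr : q ≤ r) (hf : TF f N) (hf0 : ∀ x, 0 ≤ f x) {ω : Ω} (hω : GG X r N ω) (n : ℕ) :
    LL X q f n ω ≤ Fi f (psi X r (tt n)) ω := by
  unfold LL Fi
  rw [← integral_finset_sum _ (fun i _ => hh_slice h q hf i ω), ← integral_add (hf.int_mul (cont_psi h q 0 ω)) (integrable_finset_sum _ (fun i _ => hh_slice h q hf i ω))]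
  refine integral_mono ((hf.int_mul (cont_psi h q 0 ω)).add (integrable_finset_sum _ (fun i _ => hh_slice h q hf i ω))) (hf.int_mul (cont_psi h r (tt n) ω)) fun x => ?_
  change f x * psi X q 0 x ω + ∑ i ∈ Finset.range n, f x * hh X q i (tt (i+1)) x ω ≤ f x * psi X r (tt n) x ω
  rw [← Finset.mul_sum, ← mul_add]
  by_cases hx : x ∈ Metric.closedBall (0 : EE d) N
  · refine mul_le_mul_of_nonneg_left ?_ (hf0 x)
    have hr : 0 ≤ psi X r (tt n) x ω := mul_nonneg (hω n x hx) (wt_pos _ _ _ _).le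
    by_cases hs : ω ∈ surv X q n x
    · rw [(stopped_le X q n x ω).1 hs]; exact psi_mono hqr _ _ _
    · exact ((stopped_le X q n x ω).2 hs).trans hr
  · rw [hf.supp x hx]; simp

lemma LL_mean1 (h : Setup P X L R) (hf : TF f N) (n : ℕ) : ∫ ω, LL X 1 f n ω ∂P = ∫ x, f x := by
  have := h.prob
  rw [LL_mean h 1 hf.meas hf.int n]
  have e := (psi_fld h 1 (le_refl 0) (le_refl 0)).set_int hf.meas hf.int MeasurableSet.univ
  simp only [Measure.restrict_univ] at e
  rw [e]
  congr 1; ext x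
  have : ∫ ω, psi X 1 0 x ω ∂P = ∫ ω, (1:ℝ) ∂P := by
    refine integral_congr_ae ?_
    filter_upwards [h.zero x] with ω hω
    unfold psi Yq wt
    rw [hω]; simp
  rw [this]; simp

lemma pos_prob (h : Setup P X L R) (hd : 1 ≤ d) (hf : TF f N) (hf0 : ∀ x, 0 ≤ f x) (ha : 0 < ∫ x, f x) : ¬ (∀ᵐ ω ∂P, lim0 X f ω ≤ 0) := by
  intro hcon
  have := h.prob
  obtain ⟨F, hF⟩ := hf.bdd
  obtain ⟨C, hC⟩ := LL_sq h hd 1 hf.meas hf.int hF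
  have hlim : ∀ᵐ ω ∂P, Tendsto (fun n => max (LL X 1 f n ω) 0) atTop (nhds 0) := by
    filter_upwards [Good_ae h hd, hcon] with ω hω h0
    obtain ⟨q, hq⟩ := hω.good N
    have hq' : GG X ((q:ℝ) + 1) N ω := GG_mono (by linarith) hq
    have h1 := (hω.lim h hf ((q:ℝ)+1)).comp tt_tendsto
    have h2 : Tendsto (fun n => max (Fi f (psi X ((q:ℝ)+1) (tt n)) ω) 0) atTop (nhds (max (lim0 X f ω) 0)) := h1.max tendsto_const_nhds
    rw [max_eq_right h0] at h2
    refine squeeze_zero (fun n => le_max_right _ _) (fun n => max_le_max_right _ ?_) h2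
    exact LL_le h (by have : (0:ℝ) ≤ q := Nat.cast_nonneg q
                      linarith) hf hf0 hq' n
  have mL : ∀ n, Measurable (LL X 1 f n) := fun n => ((LL_sm h 1 hf.meas n).mono (Fil_le h.meas _)).measurable
  have key : ∀ η : ℝ, 0 < η → ∫ x, f x ≤ η * C := by
    intro η hη
    have l1 : Tendsto (fun n => ∫ ω, min (max (LL X 1 f n ω) 0) η⁻¹ ∂P) atTop (nhds (∫ ω, (0:ℝ) ∂P)) := by
      refine tendsto_integral_of_dominated_convergence (fun _ => η⁻¹) (fun n => (((mL n).max measurable_const).min measurable_const).aestronglyMeasurable) (integrable_const _) (fun n => Eventually.of_forall fun ω => ?_) ?_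
      · rw [Real.norm_eq_abs, abs_of_nonneg (le_min (le_max_right _ _) (by positivity))]
        exact min_le_right _ _
      · filter_upwards [hlim] with ω hω
        have := hω.min (tendsto_const_nhds (x := η⁻¹))
        rwa [min_eq_left (by positivity)] at this
    rw [integral_zero] at l1
    have l2 := (tendsto_const_nhds (x := η * C)).add l1
    rw [add_zero] at l2
    refine ge_of_tendsto l2 (Eventually.of_forall fun n => ?_)
    rw [← LL_mean1 h hf n]
    have L2 := LL_memLp h 1 hf.meas hf.int n
    have i1 : Integrable (fun ω => η * LL X 1 f n ω ^ 2) P := L2.integrable_sq.const_mul η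
    have i2 : Integrable (fun ω => min (max (LL X 1 f n ω) 0) η⁻¹) P := by
      refine Integrable.mono' (integrable_const η⁻¹) (((mL n).max measurable_const).min measurable_const).aestronglyMeasurable (Eventually.of_forall fun ω => ?_)
      rw [Real.norm_eq_abs, abs_of_nonneg (le_min (le_max_right _ _) (by positivity))]
      exact min_le_right _ _
    calc ∫ ω, LL X 1 f n ω ∂P ≤ ∫ ω, (η * LL X 1 f n ω ^ 2 + min (max (LL X 1 f n ω) 0) η⁻¹) ∂P := by
          refine integral_mono (L2.integrable one_le_two) (i1.add i2) fun ω => ?_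
          change LL X 1 f n ω ≤ η * LL X 1 f n ω ^ 2 + min (max (LL X 1 f n ω) 0) η⁻¹
          set u := LL X 1 f n ω
          by_cases hu : u ≤ η⁻¹
          · have : u ≤ min (max u 0) η⁻¹ := le_min (le_max_left _ _) hu
            have : 0 ≤ η * u^2 := by positivity
            linarith
          · push Not at hu
            have h1 : 0 ≤ min (max u 0) η⁻¹ := le_min (le_max_right _ _) (by positivity)
            have u0 : 0 < u := lt_trans (by positivity) hu
            have h2 : 1 < u * η := by rwa [inv_lt_iff_one_lt_mul₀ hη] at hu
            nlinarith
      _ = η * ∫ ω, LL X 1 f n ω ^ 2 ∂P + ∫ ω, min (max (LL X 1 f n ω) 0) η⁻¹ ∂P := by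
          rw [integral_add i1 i2, integral_const_mul]
      _ ≤ η * C + _ := by
          have := mul_le_mul_of_nonneg_left (hC n) hη.le
          linarith
  have l3 : Tendsto (fun η : ℝ => η * C) (nhdsWithin 0 (Set.Ioi 0)) (nhds (0 * C)) :=
    ((continuous_id.mul continuous_const).tendsto (0:ℝ)).mono_left nhdsWithin_le_nhds
  rw [zero_mul] at l3
  have := ge_of_tendsto l3 (eventually_mem_nhdsWithin.mono fun η hη => key η hη)
  linarith

/-- density of the shifted derivative martingale -/
def Dsh (X : ℝ → EE d → Ω → ℝ) (s t : ℝ) (x : EE d) (ω : Ω) : ℝ :=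
  (gam d * (t - s) - (X t x ω - X s x ω)) * Real.exp (gam d * (X t x ω - X s x ω) - d * (t - s))

lemma Dsh_eq (X : ℝ → EE d → Ω → ℝ) (s t : ℝ) (x : EE d) (ω : Ω) :
    Dsh X s t x ω = (wt X s x ω)⁻¹ * psi X 0 t x ω - (wt X s x ω)⁻¹ * Yq X 0 s x ω * wt X t x ω := by
  have w := (wt_pos X s x ω).ne'
  unfold psi Dsh
  rw [Yq_step X 0 s t, wt_step X s t]
  field_simp
  ring

lemma Dsh_sm (h : Setup P X L R) (s t : ℝ) (hf : Measurable f) : StronglyMeasurable[Inc X s t] (Fi f (Dsh X s t)) := by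
  refine Fi_sm (JM_of_cont (fun x => ?_) (fun ω => ?_)) hf
  · have m := meas_Inc X s t x
    exact (m.const_sub _).mul (((m.const_mul _).sub_const _).exp)
  · have := cont_X h t ω
    have := cont_X h s ω
    unfold Dsh; fun_prop

lemma lim_Dsh (h : Setup P X L R) {ω : Ω} (hω : Good X ω) (hf : TF f N) (s : ℝ) :
    Tendsto (fun n => Fi f (Dsh X s (tt n)) ω) atTop (nhds (lim0 X (fun x => f x * (wt X s x ω)⁻¹) ω)) := by
  have cw : Continuous fun x => (wt X s x ω)⁻¹ := (cont_wt h s ω).inv₀ fun x => (wt_pos _ _ _ _).ne'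
  have cy := cont_Yq h 0 s ω
  have T1 := hf.mul_cont cw
  have T2 : TF (fun x => f x * ((wt X s x ω)⁻¹ * Yq X 0 s x ω)) N := hf.mul_cont (cw.mul cy)
  have l1 := ((hω.lim h T1 0).sub (hω.wt_zero h T2)).comp tt_tendsto
  rw [sub_zero] at l1
  refine l1.congr fun n => ?_
  simp only [Function.comp]
  unfold Fi
  rw [← integral_sub (T1.int_mul (cont_psi h 0 _ ω)) (T2.int_mul (cont_wt h _ ω))]
  congr 1; ext x
  rw [Dsh_eq]; ring

lemma Good.lim_mono (h : Setup P X L R) {ω : Ω} (hω : Good X ω) {g : EE d → ℝ} {M : ℕ} (hf : TF f N) (hg : TF g M) (hfg : ∀ x, f x ≤ g x) : lim0 X f ω ≤ lim0 X g ω := by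
  have hf' := hf.mul_cont (continuous_const (y := (-1:ℝ)))
  have hs : TF (fun x => g x + f x * (-1)) (max N M) := ⟨hg.cont.add hf'.cont, fun x hx => by
    rw [(hf.up (le_max_left N M)).supp x hx, (hg.up (le_max_right N M)).supp x hx]; simp⟩
  have e := hω.add h hf hs
  have e2 : (fun x => f x + (g x + f x * (-1))) = g := by ext x; ring
  rw [e2] at e
  have := hω.lim_nonneg h hs (fun x => by have := hfg x; linarith)
  linarith

lemma lim_pos_iff (h : Setup P X L R) {ω : Ω} (hω : Good X ω) (hf : TF f N) (hf0 : ∀ x, 0 ≤ f x) (s : ℝ) :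
    0 < lim0 X (fun x => f x * (wt X s x ω)⁻¹) ω ↔ 0 < lim0 X f ω := by
  have cw : Continuous fun x => (wt X s x ω)⁻¹ := (cont_wt h s ω).inv₀ fun x => (wt_pos _ _ _ _).ne'
  have T1 := hf.mul_cont cw
  obtain ⟨A, hA⟩ := (isCompact_closedBall (0 : EE d) (N:ℝ)).exists_bound_of_continuousOn cw.continuousOn
  obtain ⟨B, hB⟩ := (isCompact_closedBall (0 : EE d) (N:ℝ)).exists_bound_of_continuousOn (cont_wt h s ω).continuousOn
  have h1 : lim0 X (fun x => f x * (wt X s x ω)⁻¹) ω ≤ A * lim0 X f ω := by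
    rw [← hω.smul h A hf]
    have T2 : TF (fun x => A * f x) N := ⟨continuous_const.mul hf.cont, fun x hx => by rw [hf.supp x hx, mul_zero]⟩
    refine hω.lim_mono h T1 T2 fun x => ?_
    by_cases hx : x ∈ Metric.closedBall (0 : EE d) (N:ℝ)
    · rw [mul_comm A]
      exact mul_le_mul_of_nonneg_left ((le_abs_self _).trans (hA x hx)) (hf0 x)
    · rw [hf.supp x hx]; simp
  have h2 : lim0 X f ω ≤ B * lim0 X (fun x => f x * (wt X s x ω)⁻¹) ω := by
    rw [← hω.smul h B T1]
    have T2 : TF (fun x => B * (f x * (wt X s x ω)⁻¹)) N := ⟨continuous_const.mul T1.cont, fun x hx => by rw [hf.supp x hx]; simp⟩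
    refine hω.lim_mono h hf T2 fun x => ?_
    by_cases hx : x ∈ Metric.closedBall (0 : EE d) (N:ℝ)
    · have w := wt_pos X s x ω
      have b := (le_abs_self _).trans (hB x hx)
      have : f x = wt X s x ω * (f x * (wt X s x ω)⁻¹) := by field_simp
      have g0 : 0 ≤ f x * (wt X s x ω)⁻¹ := mul_nonneg (hf0 x) (inv_nonneg.2 w.le)
      calc f x = wt X s x ω * (f x * (wt X s x ω)⁻¹) := this
        _ ≤ _ := mul_le_mul_of_nonneg_right b g0
    · rw [hf.supp x hx]; simp
  have n1 := hω.lim_nonneg h hf hf0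
  have n2 := hω.lim_nonneg h T1 (fun x => mul_nonneg (hf0 x) (inv_nonneg.2 (wt_pos _ _ _ _).le))
  constructor
  · intro hp
    refine lt_of_le_of_ne n1 fun e => ?_
    rw [← e, mul_zero] at h1; linarith
  · intro hp
    refine lt_of_le_of_ne n2 fun e => ?_
    rw [← e, mul_zero] at h2; linarith

/-- tail-like event -/
def Ev (X : ℝ → EE d → Ω → ℝ) (f : EE d → ℝ) : Set Ω := ⋃ j : ℕ, ⋃ n0 : ℕ, ⋂ n : ℕ, ⋂ (_ : n0 ≤ n), {ω | 1 / ((j:ℝ)+1) ≤ Fi f (psi X 0 (tt n)) ω}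

lemma Ev_iff (h : Setup P X L R) {ω : Ω} (hω : Good X ω) (hf : TF f N) : ω ∈ Ev X f ↔ 0 < lim0 X f ω := by
  have hl := (hω.lim h hf 0).comp tt_tendsto
  unfold Ev
  simp only [Set.mem_iUnion, Set.mem_iInter, Set.mem_setOf_eq]
  constructor
  · rintro ⟨j, n0, hj⟩
    have : 1 / ((j:ℝ)+1) ≤ lim0 X f ω := ge_of_tendsto hl (eventually_atTop.2 ⟨n0, hj⟩)
    exact lt_of_lt_of_le (by positivity) this
  · intro hp
    obtain ⟨j, hj⟩ := exists_nat_one_div_lt hp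
    obtain ⟨n0, hn⟩ := eventually_atTop.1 (hl.eventually (eventually_ge_nhds hj))
    exact ⟨j, n0, hn⟩

lemma Ev_meas (h : Setup P X L R) (hf : TF f N) : MeasurableSet[⨆ m : ℕ, Fil X (tt m)] (Ev X f) := by
  refine MeasurableSet.iUnion fun j => MeasurableSet.iUnion fun n0 => MeasurableSet.iInter fun n => MeasurableSet.iInter fun _ => ?_
  have m1 : Measurable[Fil X (tt n)] (Fi f (psi X 0 (tt n))) := (Fi_sm (psi_fld h 0 (tt_nonneg n) le_rfl).jm hf.meas).measurable
  have m2 : MeasurableSet[Fil X (tt n)] {ω | 1 / ((j:ℝ)+1) ≤ Fi f (psi X 0 (tt n)) ω} := m1 measurableSet_Ici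
  exact le_iSup (fun m : ℕ => Fil X (tt m)) n _ m2

lemma Ev_indep (h : Setup P X L R) (hd : 1 ≤ d) (hf : TF f N) (hf0 : ∀ x, 0 ≤ f x) (m : ℕ) {B : Set Ω} (hB : MeasurableSet[Fil X (tt m)] B) :
    P (Ev X f ∩ B) = P (Ev X f) * P B := by
  have := h.prob
  have hle : (⨆ m : ℕ, Fil X (tt m)) ≤ m0 := iSup_le fun m => Fil_le h.meas _
  refine indep_lim (S := fun n => Fi f (Dsh X (tt m) (tt n))) (hle _ (Ev_meas h hf)) (Fil_le h.meas _ _ hB)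
    (fun n => ((Dsh_sm h (tt m) (tt n) hf.meas).mono (Inc_le h.meas _ _)).measurable) ?_ ?_
  · filter_upwards [eventually_gt_atTop m] with n hn
    have hlt : tt m < tt n := lt_of_lt_of_le (tt_lt_succ m) (tt_mono hn)
    refine indepFun_of (h.indep (tt m) (tt n) (tt_nonneg m) hlt) (Dsh_sm h (tt m) (tt n) hf.meas).measurable ?_
    exact (@measurable_const _ _ _ (Fil X (tt m)) _).indicator hB
  · filter_upwards [Good_ae h hd] with ω hω
    exact ⟨_, lim_Dsh h hω hf (tt m), (lim_pos_iff h hω hf hf0 (tt m)).trans (Ev_iff h hω hf).symm⟩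

theorem lim_pos (h : Setup P X L R) (hd : 1 ≤ d) (hf : TF f N) (hf0 : ∀ x, 0 ≤ f x) (ha : 0 < ∫ x, f x) : ∀ᵐ ω ∂P, 0 < lim0 X f ω := by
  have := h.prob
  have hle : (⨆ m : ℕ, Fil X (tt m)) ≤ m0 := iSup_le fun m => Fil_le h.meas _
  have mE := hle _ (Ev_meas h hf)
  have hg : MeasurableSpace.generateFrom {Ev X f} ≤ m0 := MeasurableSpace.generateFrom_le fun s hs => by rw [Set.mem_singleton_iff.1 hs]; exact mE
  have hI : Indep (⨆ m : ℕ, Fil X (tt m)) (MeasurableSpace.generateFrom {Ev X f}) P := by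
    refine indep_iSup_of_monotone (fun m => ?_) (fun m => Fil_le h.meas _) hg (fun a b hab => Fil_mono X (tt_mono hab))
    refine IndepSets.indep (p1 := {s | MeasurableSet[Fil X (tt m)] s}) (p2 := {Ev X f}) (Fil_le h.meas _) hg (@MeasurableSpace.isPiSystem_measurableSet _ (Fil X (tt m))) (IsPiSystem.singleton _) (@MeasurableSpace.generateFrom_measurableSet _ (Fil X (tt m))).symm rfl ?_
    rw [IndepSets_iff]
    intro s t hs ht
    rw [Set.mem_singleton_iff.1 ht, Set.inter_comm, mul_comm]
    exact Ev_indep h hd hf hf0 m hs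
  have hself : IndepSet (Ev X f) (Ev X f) P := by
    refine indep_of_indep_of_le_left hI (MeasurableSpace.generateFrom_le fun s hs => ?_)
    rw [Set.mem_singleton_iff.1 hs]; exact Ev_meas h hf
  rcases measure_eq_zero_or_one_of_indepSet_self hself with h0 | h1
  · exfalso
    refine pos_prob h hd hf hf0 ha ?_
    have h0' : ∀ᵐ ω ∂P, ω ∉ Ev X f := measure_eq_zero_iff_ae_notMem.1 h0
    filter_upwards [h0', Good_ae h hd] with ω a1 a2
    by_contra hc
    exact a1 ((Ev_iff h a2 hf).2 (not_le.1 hc))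
  · have h1' : ∀ᵐ ω ∂P, ω ∈ Ev X f := (mem_ae_iff_prob_eq_one mE).2 h1
    filter_upwards [h1', Good_ae h hd] with ω a1 a2
    exact (Ev_iff h a2 hf).1 a1

def bump (d : ℕ) (c : EE d) (r : ℝ) (x : EE d) : ℝ := max 0 (r - dist x c)

theorem main_setup (h : Setup P X L R) (hd : 1 ≤ d) : ∀ᵐ ω ∂P, ∃ μ : Measure (EE d), IsLocallyFiniteMeasure μ ∧
    (∀ f : EE d → ℝ, Continuous f → HasCompactSupport f → Tendsto (fun t => Fi f (psi X 0 t) ω) atTop (nhds (∫ x, f x ∂μ))) ∧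
    (∀ A : Set (EE d), IsOpen A → A.Nonempty → 0 < μ A) := by
  have hb : ∀ c : EE d, ∀ r : ℝ, Continuous (bump d c r) := by intro c r; unfold bump; fun_prop
  have hs : ∀ c : EE d, ∀ r : ℝ, HasCompactSupport (bump d c r) := by
    intro c r
    refine HasCompactSupport.intro (isCompact_closedBall c r) fun x hx => ?_
    rw [Metric.mem_closedBall, not_le] at hx
    exact max_eq_left (by linarith)
  have a1 : ∀ᵐ ω ∂P, ∀ i j : ℕ, 0 < lim0 X (bump d (TopologicalSpace.denseSeq (EE d) i) (1 / ((j:ℝ)+1))) ω := by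
    simp_rw [ae_all_iff]
    intro i j
    set c := TopologicalSpace.denseSeq (EE d) i
    have r0 : 0 < 1 / ((j:ℝ)+1) := by positivity
    obtain ⟨N, hN⟩ := exists_cs_TF (hb c (1 / ((j:ℝ)+1))) (hs _ _)
    refine lim_pos h hd hN (fun x => le_max_left _ _) ?_
    refine (hb c _).integral_pos_of_hasCompactSupport_nonneg_nonzero (hs _ _) (fun x => le_max_left _ _) (x := c) ?_
    unfold bump
    rw [dist_self, sub_zero, max_eq_right r0.le]
    exact r0.ne'
  filter_upwards [Good_ae h hd, a1] with ω hω h1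
  obtain ⟨μ, hμ, hintg⟩ := hω.riesz h
  refine ⟨μ, hμ, fun f hc hcs => ?_, fun A hA hne => ?_⟩
  · obtain ⟨N, hN⟩ := exists_cs_TF hc hcs
    rw [hintg f hc hcs]
    exact hω.lim h hN 0
  · obtain ⟨x, hx⟩ := hne
    obtain ⟨ε, ε0, hε⟩ := Metric.isOpen_iff.1 hA x hx
    obtain ⟨j, hj⟩ := exists_nat_one_div_lt (half_pos ε0)
    obtain ⟨i, hi⟩ := (TopologicalSpace.denseRange_denseSeq (EE d)).exists_dist_lt x (half_pos ε0)
    by_contra hz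
    have hz' : μ A = 0 := le_antisymm (not_lt.1 hz) zero_le
    have := h1 i j
    rw [← hintg _ (hb _ _) (hs _ _)] at this
    have e : ∫ y, bump d (TopologicalSpace.denseSeq (EE d) i) (1 / ((j:ℝ)+1)) y ∂μ = 0 := by
      refine integral_eq_zero_of_ae ?_
      have : ∀ᵐ y ∂μ, y ∉ A := measure_eq_zero_iff_ae_notMem.1 hz'
      filter_upwards [this] with y hy
      have : ε ≤ dist y x := by
        by_contra hlt
        exact hy (hε (not_le.1 hlt))
      have := dist_triangle_right y x (TopologicalSpace.denseSeq (EE d) i)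
      exact max_eq_left (by linarith)
    linarith

end

end DM

set_option linter.unusedSectionVars false
set_option linter.unusedVariables false

namespace DM

variable {d : ℕ} {Ω : Type*} [m0 : MeasurableSpace Ω]

lemma trace_ae {P : Measure Ω} {G : Set Ω} (hG : ∀ᵐ ω ∂P, ω ∈ G) {m : MeasurableSpace Ω} {A : Set Ω}
    (hA : MeasurableSet[MeasurableSpace.map (Subtype.val : G → Ω) (MeasurableSpace.comap (Subtype.val : G → Ω) m)] A) :
    ∃ A', MeasurableSet[m] A' ∧ A =ᵐ[P] A' := by
  obtain ⟨A', h1, h2⟩ := hA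
  refine ⟨A', h1, ?_⟩
  filter_upwards [hG] with ω hω
  have : (⟨ω, hω⟩ : G) ∈ (Subtype.val : G → Ω) ⁻¹' A' ↔ (⟨ω, hω⟩ : G) ∈ (Subtype.val : G → Ω) ⁻¹' A := by rw [h2]
  exact propext this.symm

lemma comap_trace {G : Set Ω} {m : MeasurableSpace Ω} {U V : Ω → ℝ} (hV : MeasurableSpace.comap V inferInstance ≤ m) (hUV : ∀ ω ∈ G, U ω = V ω) :
    MeasurableSpace.comap U inferInstance ≤ MeasurableSpace.map (Subtype.val : G → Ω) (MeasurableSpace.comap (Subtype.val : G → Ω) m) := by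
  rintro A ⟨S, hS, rfl⟩
  refine ⟨V ⁻¹' S, hV _ ⟨S, hS, rfl⟩, ?_⟩
  ext ⟨ω, hω⟩
  simp [hUV ω hω]

lemma indep_trace {P : Measure Ω} {G : Set Ω} (hG : ∀ᵐ ω ∂P, ω ∈ G) {m1 m2 n1 n2 : MeasurableSpace Ω} (h : Indep m1 m2 P)
    (h1 : n1 ≤ MeasurableSpace.map (Subtype.val : G → Ω) (MeasurableSpace.comap (Subtype.val : G → Ω) m1))
    (h2 : n2 ≤ MeasurableSpace.map (Subtype.val : G → Ω) (MeasurableSpace.comap (Subtype.val : G → Ω) m2)) : Indep n1 n2 P := by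
  rw [Indep_iff] at *
  intro A B hA hB
  obtain ⟨A', hA', eA⟩ := @trace_ae Ω m0 P G hG m1 A (h1 A hA)
  obtain ⟨B', hB', eB⟩ := @trace_ae Ω m0 P G hG m2 B (h2 B hB)
  rw [measure_congr (eA.inter eB), measure_congr eA, measure_congr eB]
  exact h A' B' hA' hB'

end DM

theorem derivative_measure_weak_limit_full_support
    {d : ℕ} (hd : 1 ≤ d)
    {Ω : Type*} [m0 : MeasurableSpace Ω] (P : Measure Ω) [IsProbabilityMeasure P]
    (k : EuclideanSpace ℝ (Fin d) → ℝ)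
    (hk1 : ContDiff ℝ 1 k) (hk0 : k 0 = 1) (hkb : ∀ z, |k z| ≤ 1)
    (hksupp : HasCompactSupport k)
    (hkpd : ∀ (n : ℕ) (z : Fin n → EuclideanSpace ℝ (Fin d)) (c : Fin n → ℝ),
      0 ≤ ∑ i, ∑ j, c i * c j * k (z i - z j))
    (X : ℝ → EuclideanSpace ℝ (Fin d) → Ω → ℝ)
    (hXmeas : ∀ t x, Measurable (X t x))
    (hXgauss : ∀ (n : ℕ) (c : Fin n → ℝ) (t : Fin n → ℝ)
        (x : Fin n → EuclideanSpace ℝ (Fin d)),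
      ∃ v : NNReal,
        Measure.map (fun ω => ∑ i, c i * X (t i) (x i) ω) P = gaussianReal 0 v)
    (hXcent : ∀ t x, ∫ ω, X t x ω ∂P = 0)
    (hXcov : ∀ t, 0 ≤ t → ∀ x y : EuclideanSpace ℝ (Fin d),
      ∫ ω, X t x ω * X t y ω ∂P = ∫ u in Set.Icc (1:ℝ) (Real.exp t), k (u • (x - y)) / u)
    (hXcont : ∀ᵐ ω ∂P, Continuous fun p : ℝ × EuclideanSpace ℝ (Fin d) => X p.1 p.2 ω)
    (hXindep : ∀ s t : ℝ, 0 ≤ s → s < t →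
      Indep (⨆ x : EuclideanSpace ℝ (Fin d),
          MeasurableSpace.comap (fun ω => X t x ω - X s x ω) inferInstance)
        (⨆ u ∈ Set.Icc (0:ℝ) s, ⨆ x : EuclideanSpace ℝ (Fin d),
          MeasurableSpace.comap (X u x) inferInstance) P)
    :
    ∀ᵐ ω ∂P, ∃ μ : Measure (EuclideanSpace ℝ (Fin d)),
      IsLocallyFiniteMeasure μ ∧
      (∀ f : EuclideanSpace ℝ (Fin d) → ℝ, Continuous f → HasCompactSupport f →
        Tendsto (fun t : ℝ =>
            ∫ x, f x * ((Real.sqrt (2 * (d:ℝ)) * t - X t x ω) *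
              Real.exp (Real.sqrt (2 * (d:ℝ)) * X t x ω - (d:ℝ) * t)))
          atTop (nhds (∫ x, f x ∂μ))) ∧
      (∀ A : Set (EuclideanSpace ℝ (Fin d)), IsOpen A → A.Nonempty → 0 < μ A) := by
  obtain ⟨G, hGm, hG, hGc⟩ : ∃ G : Set Ω, MeasurableSet G ∧ (∀ᵐ ω ∂P, ω ∈ G) ∧
      ∀ ω ∈ G, Continuous fun p : ℝ × EuclideanSpace ℝ (Fin d) => X p.1 p.2 ω := by
    obtain ⟨T, h1, h2, h3⟩ := exists_measurable_superset_of_null (ae_iff.1 hXcont)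
    refine ⟨Tᶜ, h2.compl, measure_eq_zero_iff_ae_notMem.1 h3, fun ω hω => ?_⟩
    by_contra hc
    exact hω (h1 hc)
  let Y : ℝ → DM.EE d → Ω → ℝ := fun t x => G.indicator (X t x)
  have hY : ∀ ω ∈ G, ∀ t x, Y t x ω = X t x ω := fun ω hω t x => Set.indicator_of_mem hω _
  have hYm : ∀ t x, Measurable (Y t x) := fun t x => (hXmeas t x).indicator hGm
  obtain ⟨L, R, h⟩ := DM.setup_of P k hk1 hk0 hksupp Y hYm
    (fun n c t x => by
      obtain ⟨v, hv⟩ := hXgauss n c t x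
      refine ⟨v, ?_⟩
      rw [← hv]
      refine Measure.map_congr ?_
      filter_upwards [hG] with ω hω
      simp only [hY ω hω])
    (fun t x => by
      rw [← hXcent t x]
      refine integral_congr_ae ?_
      filter_upwards [hG] with ω hω
      simp only [hY ω hω])
    (fun t ht x y => by
      rw [← hXcov t ht x y]
      refine integral_congr_ae ?_
      filter_upwards [hG] with ω hω
      simp only [hY ω hω])
    (fun ω => by
      by_cases hω : ω ∈ G
      · simp only [hY ω hω]; exact hGc ω hω
      · have : (fun p : ℝ × DM.EE d => Y p.1 p.2 ω) = fun _ => 0 := by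
          ext p; exact Set.indicator_of_notMem hω _
        rw [this]; exact continuous_const)
    (fun s t hs hst => by
      refine DM.indep_trace hG (hXindep s t hs hst) ?_ ?_
      · refine iSup_le fun x => DM.comap_trace (V := fun ω => X t x ω - X s x ω) ?_ (fun ω hω => by simp only [hY ω hω])
        exact le_iSup (fun x : EuclideanSpace ℝ (Fin d) => MeasurableSpace.comap (fun ω => X t x ω - X s x ω) inferInstance) x
      · refine iSup₂_le fun u hu => iSup_le fun x => DM.comap_trace (V := X u x) ?_ (fun ω hω => hY ω hω u x)
        exact le_iSup₂_of_le u hu (le_iSup (fun x : EuclideanSpace ℝ (Fin d) => MeasurableSpace.comap (X u x) inferInstance) x))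
  filter_upwards [hG, DM.main_setup h hd] with ω hω hmain
  obtain ⟨μ, h1, h2, h3⟩ := hmain
  refine ⟨μ, h1, fun f hc hs => ?_, h3⟩
  refine (h2 f hc hs).congr fun t => ?_
  unfold DM.Fi DM.psi DM.Yq DM.wt DM.gam
  simp only [hY ω hω, add_zero]
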